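/- arXiv:1910.10876 — 5 statements merged into one kernel-verified Lean document; each statement's English description precedes it below -/
import Mathlib

section
/- Fix an integer k ≥ 3. For every ε > 0 there exists N such that for all n ≥ N: if (E,K) is a dominating set of G_{k,2} with |E| + |K| = γ(G_{k,2}), then |E| + (C(k,2) − 1)·|K| ≥ (1/2 − ε)·n². -/
/-- `(E, K)` is a dominating set of the bipartite graph `G_{k,l}` whose vertex
classes are the `k`-element and `l`-element subsets of `[n] = {1, …, n}`
(modelled as `Finset.range n`), a `k`-set `A` being adjacent to an `l`-set `B`
iff `B ⊆ A`. -/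
def IsDomSet (n k l : ℕ) (E K : Finset (Finset ℕ)) : Prop :=
  (∀ e ∈ E, e ⊆ Finset.range n ∧ e.card = l) ∧
  (∀ A ∈ K, A ⊆ Finset.range n ∧ A.card = k) ∧
  (∀ A, A ⊆ Finset.range n → A.card = k → A ∉ K → ∃ e ∈ E, e ⊆ A) ∧
  (∀ e, e ⊆ Finset.range n → e.card = l → e ∉ E → ∃ A ∈ K, e ⊆ A)

/-- The domination number `γ(G_{k,l})`: the minimum of `|E| + |K|` over all
dominating sets `(E, K)` of `G_{k,l}`. -/
noncomputable def gamma (n k l : ℕ) : ℕ :=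
  sInf {m | ∃ E K : Finset (Finset ℕ), IsDomSet n k l E K ∧ m = E.card + K.card}

open Finset in
/-- If all large subsets of `s` have edge density at least `d` to `t`, then few vertices of `s` have
fewer than `d * #t` neighbours in `t`. -/
lemma SimpleGraph.card_filter_few_neighbors_lt {α : Type*} (G : SimpleGraph α)
    [DecidableRel G.Adj] {d m : ℝ} (hm : 0 < m) (s t : Finset α) (ht : t.Nonempty)
    (h : ∀ X ⊆ s, m ≤ #X → d ≤ G.edgeDensity X t) :
    (#{x ∈ s | (#{y ∈ t | G.Adj x y} : ℝ) < d * #t} : ℝ) < m := by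
  classical
  by_contra! hX
  set X := {x ∈ s | (#{y ∈ t | G.Adj x y} : ℝ) < d * #t} with hXdef
  have hXne : X.Nonempty := by
    rw [← card_pos]
    exact_mod_cast hm.trans_le hX
  have hd := h X (filter_subset _ _) hX
  have hX0 : (0 : ℝ) < #X := by exact_mod_cast hXne.card_pos
  have ht0 : (0 : ℝ) < #t := by exact_mod_cast ht.card_pos
  rw [SimpleGraph.edgeDensity_def] at hd
  push_cast at hd
  rw [le_div_iff₀ (by positivity)] at hd
  have hcard : (#(G.interedges X t) : ℝ) ≤ ∑ x ∈ X, (#{y ∈ t | G.Adj x y} : ℝ) := by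
    have : #(G.interedges X t) ≤ ∑ x ∈ X, #{y ∈ t | G.Adj x y} := by
      refine (card_le_card (subset_of_eq (Rel.interedges_eq_biUnion _))).trans ?_
      refine card_biUnion_le.trans ?_
      simp only [card_map, le_refl]
    exact_mod_cast this
  have hlt : ∑ x ∈ X, (#{y ∈ t | G.Adj x y} : ℝ) < ∑ _x ∈ X, d * #t :=
    sum_lt_sum_of_nonempty hXne fun x hx ↦ (mem_filter.1 hx).2
  rw [sum_const, nsmul_eq_mul] at hlt
  nlinarith

open Finset in
/-- A one-sided clique counting lemma: disjoint vertex sets all of whose large subsets span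
pairwise density at least `d` span many transversal cliques. -/
lemma SimpleGraph.pow_le_card_transversal_cliques {α ι : Type*} [Fintype α] [DecidableEq α]
    [DecidableEq ι] (G : SimpleGraph α) [DecidableRel G.Adj] {d m t : ℝ} (hd : 0 < d) (hd1 : d ≤ 1)
    (hm : 0 < m) (ht : 0 ≤ t) (I : Finset ι) :
    ∀ (S : ι → Finset α) (s : ℝ), (∀ i ∈ I, s ≤ #(S i)) → #I * m + t ≤ d ^ #I * s →
      (∀ i ∈ I, ∀ j ∈ I, i ≠ j → Disjoint (S i) (S j)) →
      (∀ i ∈ I, ∀ j ∈ I, i ≠ j → ∀ X ⊆ S i, ∀ Y ⊆ S j, m ≤ #X → m ≤ #Y →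
        d ≤ G.edgeDensity X Y) →
      t ^ #I ≤ #{A ∈ G.cliqueFinset #I | A ⊆ I.biUnion S} := by
  induction I using Finset.induction_on with
  | empty =>
    intro S s _ _ _ _
    have : (1 : ℕ) ≤ #{A ∈ G.cliqueFinset #(∅ : Finset ι) | A ⊆ (∅ : Finset ι).biUnion S} := by
      rw [Nat.one_le_iff_ne_zero, ← Nat.pos_iff_ne_zero, card_pos]
      exact ⟨∅, by simp [SimpleGraph.mem_cliqueFinset_iff]⟩
    simpa using this
  | insert i I hi ih =>
    intro S s hs hst hdisj hdens
    rw [card_insert_of_notMem hi] at hst ⊢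
    push_cast at hst
    have hI0 : (0 : ℝ) ≤ #I := by positivity
    have hpow : d ^ (#I + 1) ≤ 1 := pow_le_one₀ hd.le hd1
    have hs0 : 0 < s := by
      by_contra! h
      have : d ^ (#I + 1) * s ≤ 0 := mul_nonpos_of_nonneg_of_nonpos (by positivity) h
      nlinarith
    have hle : d ^ (#I + 1) * s ≤ s := mul_le_of_le_one_left hs0.le hpow
    have hms : m ≤ s := by nlinarith
    set W := {v ∈ S i | ∀ j ∈ I, d * #(S j) ≤ #{y ∈ S j | G.Adj v y}} with hW
    have hne : ∀ j ∈ I, i ≠ j := fun j hj h ↦ hi (h ▸ hj)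
    have hbad : ∀ j ∈ I, (#{x ∈ S i | (#{y ∈ S j | G.Adj x y} : ℝ) < d * #(S j)} : ℝ) ≤ m := by
      intro j hj
      refine (G.card_filter_few_neighbors_lt hm (S i) (S j) ?_ ?_).le
      · rw [← card_pos]
        exact_mod_cast hs0.trans_le (hs j (mem_insert_of_mem hj))
      · intro X hX hmX
        exact hdens i (mem_insert_self _ _) j (mem_insert_of_mem hj) (hne j hj) X hX _ subset_rfl
          hmX (hms.trans (hs j (mem_insert_of_mem hj)))
    have hWcard : t ≤ #W := by
      have hsub : S i ⊆ W ∪ I.biUnion fun j ↦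
          {x ∈ S i | (#{y ∈ S j | G.Adj x y} : ℝ) < d * #(S j)} := by
        intro v hv
        by_cases h : ∀ j ∈ I, d * #(S j) ≤ #{y ∈ S j | G.Adj v y}
        · exact mem_union_left _ (mem_filter.2 ⟨hv, h⟩)
        · push Not at h
          obtain ⟨j, hj, hlt⟩ := h
          exact mem_union_right _ (mem_biUnion.2 ⟨j, hj, mem_filter.2 ⟨hv, hlt⟩⟩)
      have h1 : (#(S i) : ℝ) ≤ #W + ∑ j ∈ I,
          (#{x ∈ S i | (#{y ∈ S j | G.Adj x y} : ℝ) < d * #(S j)} : ℝ) := by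
        have := (card_le_card hsub).trans ((card_union_le _ _).trans
          (Nat.add_le_add_left card_biUnion_le _))
        exact_mod_cast this
      have h2 := sum_le_sum hbad
      rw [sum_const, nsmul_eq_mul] at h2
      have h3 := hs i (mem_insert_self _ _)
      nlinarith
    let C : α → Finset (Finset α) := fun v ↦
      {A ∈ G.cliqueFinset #I | A ⊆ I.biUnion fun j ↦ {y ∈ S j | G.Adj v y}}
    have hC : ∀ v ∈ W, t ^ #I ≤ #(C v) := by
      intro v hv
      refine ih (fun j ↦ {y ∈ S j | G.Adj v y}) (d * s) ?_ ?_ ?_ ?_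
      · intro j hj
        exact (mul_le_mul_of_nonneg_left (hs j (mem_insert_of_mem hj)) hd.le).trans
          ((mem_filter.1 hv).2 j hj)
      · rw [← mul_assoc, ← pow_succ]
        nlinarith
      · intro j hj k hk hjk
        exact (hdisj j (mem_insert_of_mem hj) k (mem_insert_of_mem hk) hjk).mono
          (filter_subset _ _) (filter_subset _ _)
      · intro j hj k hk hjk X hX Y hY
        exact hdens j (mem_insert_of_mem hj) k (mem_insert_of_mem hk) hjk X
          (hX.trans (filter_subset _ _)) Y (hY.trans (filter_subset _ _))
    have hsum : t ^ (#I + 1) ≤ (#(W.sigma C) : ℝ) := by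
      rw [card_sigma]
      push_cast
      calc t ^ (#I + 1) = t * t ^ #I := pow_succ' _ _
        _ ≤ #W * t ^ #I := by gcongr
        _ = ∑ _v ∈ W, t ^ #I := by rw [sum_const, nsmul_eq_mul]
        _ ≤ _ := sum_le_sum hC
    refine hsum.trans ?_
    norm_cast
    have hdisjA : ∀ v ∈ S i, ∀ w, ∀ A ∈ C w, v ∉ A := by
      intro v hv w A hA hvA
      obtain ⟨j, hj, hvj⟩ := mem_biUnion.1 ((mem_filter.1 hA).2 hvA)
      have hij := hdisj i (mem_insert_self _ _) j (mem_insert_of_mem hj) (hne j hj)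
      exact Finset.disjoint_left.1 hij hv (mem_filter.1 hvj).1
    refine card_le_card_of_injOn (fun p ↦ insert p.1 p.2) ?_ ?_
    · rintro ⟨v, A⟩ hp
      obtain ⟨hv, hA⟩ := mem_sigma.1 hp
      simp only at hv hA
      have hA' := mem_filter.1 hA
      refine mem_filter.2 ⟨?_, ?_⟩
      · rw [SimpleGraph.mem_cliqueFinset_iff]
        refine (SimpleGraph.mem_cliqueFinset_iff.1 hA'.1).insert fun b hb ↦ ?_
        obtain ⟨j, hj, hbj⟩ := mem_biUnion.1 (hA'.2 hb)
        exact (mem_filter.1 hbj).2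
      · refine insert_subset (mem_biUnion.2 ⟨i, mem_insert_self _ _, (mem_filter.1 hv).1⟩) ?_
        intro b hb
        obtain ⟨j, hj, hbj⟩ := mem_biUnion.1 (hA'.2 hb)
        exact mem_biUnion.2 ⟨j, mem_insert_of_mem hj, (mem_filter.1 hbj).1⟩
    · rintro ⟨v, A⟩ hp ⟨w, B⟩ hq heq
      obtain ⟨hv, hA⟩ := mem_sigma.1 (mem_coe.1 hp)
      obtain ⟨hw, hB⟩ := mem_sigma.1 (mem_coe.1 hq)
      simp only at hv hA hw hB heq
      have hvS := (mem_filter.1 hv).1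
      have hwS := (mem_filter.1 hw).1
      have hvw : v = w := by
        have : v ∈ insert w B := heq ▸ mem_insert_self v A
        exact (mem_insert.1 this).resolve_right (hdisjA v hvS w B hB)
      subst hvw
      have hAB : A = B := by
        rw [← erase_insert (hdisjA v hvS v A hA), heq, erase_insert (hdisjA v hvS v B hB)]
      rw [hAB]

open Finset in
/-- Passing to the reduced graph of a uniform equipartition destroys few adjacencies. -/
lemma SimpleGraph.card_unreduced_lt {α : Type*} [Fintype α] [DecidableEq α] [Nonempty α]
    (G : SimpleGraph α) [DecidableRel G.Adj] {P : Finpartition (univ : Finset α)} {ε η δ : ℝ}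
    (hε : 0 < ε) (hη : 0 < η) (hδ : 0 ≤ δ) (hP : P.IsEquipartition) (hPη : P.IsUniform G η)
    (hP' : 4 / ε ≤ #P.parts) :
    (#{p : α × α | G.Adj p.1 p.2 ∧ ¬ (G.regularityReduced P η δ).Adj p.1 p.2} : ℝ)
      < (4 * η + ε / 2 + 4 * δ) * (Fintype.card α : ℝ) ^ 2 := by
  have hsub : ({p : α × α | G.Adj p.1 p.2 ∧ ¬ (G.regularityReduced P η δ).Adj p.1 p.2} :
      Finset (α × α)) ⊆ (P.nonUniforms G η).biUnion (fun (U, V) ↦ U ×ˢ V) ∪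
        P.parts.biUnion offDiag ∪ (P.sparsePairs G δ).biUnion fun (U, V) ↦ G.interedges U V := by
    rintro ⟨x, y⟩
    simp only [mem_filter, mem_univ, true_and, SimpleGraph.regularityReduced_adj, not_and,
      not_exists, not_le, mem_biUnion, mem_union, mem_product, Prod.exists, mem_offDiag, and_imp,
      or_assoc, and_assoc, P.mk_mem_nonUniforms, Finpartition.mk_mem_sparsePairs,
      SimpleGraph.mem_interedges_iff]
    intro h h'
    replace h' := h' h
    obtain ⟨U, hU, hx⟩ := P.exists_mem (mem_univ x)
    obtain ⟨V, hV, hy⟩ := P.exists_mem (mem_univ y)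
    obtain rfl | hUV := eq_or_ne U V
    · exact Or.inr (Or.inl ⟨U, hU, hx, hy, G.ne_of_adj h⟩)
    by_cases h₂ : G.IsUniform η U V
    · exact Or.inr <| Or.inr ⟨U, V, hU, hV, hUV, h' _ hU _ hV hx hy hUV h₂, hx, hy, h⟩
    · exact Or.inl ⟨U, V, hU, hV, hUV, h₂, hx, hy⟩
  have h1 := hP.sum_nonUniforms_lt (G := G) univ_nonempty hη hPη
  have h2 := hP.card_biUnion_offDiag_le hε hP'
  have h3 := hP.card_interedges_sparsePairs_le (G := G) hδ
  have h4 := (card_le_card hsub).trans ((card_union_le _ _).trans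
    (Nat.add_le_add_right (card_union_le _ _) _))
  have h5 : (#{p : α × α | G.Adj p.1 p.2 ∧ ¬ (G.regularityReduced P η δ).Adj p.1 p.2} : ℝ) ≤
      #((P.nonUniforms G η).biUnion fun (U, V) ↦ U ×ˢ V) + #(P.parts.biUnion offDiag) +
        #((P.sparsePairs G δ).biUnion fun (U, V) ↦ G.interedges U V) := by
    exact_mod_cast h4
  rw [card_univ] at h1 h2 h3
  linarith

open Finset in
/-- A clique in the reduced graph of a uniform equipartition forces many cliques in the graph. -/
lemma SimpleGraph.pow_le_card_cliqueFinset_of_regularityReduced {α : Type*} [Fintype α]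
    [DecidableEq α] (G : SimpleGraph α) [DecidableRel G.Adj]
    {P : Finpartition (univ : Finset α)} {k : ℕ} (hk : 0 < k) {d : ℝ} (hd : 0 < d) (hd1 : d ≤ 1)
    (hP : P.IsEquipartition) {T : Finset α}
    (hT : (G.regularityReduced P (d ^ k / (4 * k)) (2 * d)).IsNClique k T) :
    (d ^ k / 2 * (Fintype.card α / #P.parts : ℕ)) ^ k ≤ (#(G.cliqueFinset k) : ℝ) := by
  have hTk : #T = k := hT.card_eq
  set s : ℕ := Fintype.card α / #P.parts with hs
  have hpart : ∀ v, P.part v ∈ P.parts := fun v ↦ P.part_mem.2 (mem_univ v)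
  have hk1 : (1 : ℝ) ≤ k := by exact_mod_cast hk
  obtain ⟨v₀, -⟩ : T.Nonempty := card_pos.1 (by omega)
  have hs1 : 1 ≤ s :=
    (Nat.one_le_div_iff (card_pos.2 ⟨_, hpart v₀⟩)).2 (by simpa using P.card_parts_le_card)
  have hs1' : (1 : ℝ) ≤ s := by exact_mod_cast hs1
  have hlow : ∀ v, (s : ℝ) ≤ #(P.part v) := fun v ↦ by
    have := hP.average_le_card_part (hpart v)
    rw [card_univ] at this
    exact_mod_cast this
  have hup : ∀ v, (#(P.part v) : ℝ) ≤ 2 * s := fun v ↦ by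
    have := hP.card_part_le_average_add_one (hpart v)
    rw [card_univ] at this
    have : #(P.part v) ≤ 2 * s := by omega
    exact_mod_cast this
  have hη : 0 < d ^ k / (4 * k) := by positivity
  have hηd : d ^ k / (4 * k) ≤ d := by
    rw [div_le_iff₀ (by positivity)]
    have : d ^ k ≤ d := pow_le_of_le_one hd.le hd1 hk.ne'
    nlinarith
  have hpair : ∀ u ∈ T, ∀ v ∈ T, u ≠ v → P.part u ≠ P.part v ∧
      G.IsUniform (d ^ k / (4 * k)) (P.part u) (P.part v) ∧
      2 * d ≤ G.edgeDensity (P.part u) (P.part v) := by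
    intro u hu v hv huv
    obtain ⟨-, U, hU, V, hV, huU, hvV, hUV, hunif, hdens⟩ := hT.isClique hu hv huv
    rw [P.part_eq_of_mem hU huU, P.part_eq_of_mem hV hvV]
    exact ⟨hUV, hunif, hdens⟩
  have key := G.pow_le_card_transversal_cliques hd hd1 (m := d ^ k / (4 * k) * (2 * s))
    (t := d ^ k / 2 * s) (by positivity) (by positivity) T P.part s (fun v _ ↦ hlow v) (by
      rw [hTk]
      apply le_of_eq
      field_simp
      ring)
    (fun u hu v hv huv ↦ P.disjoint (hpart u) (hpart v) (hpair u hu v hv huv).1)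
    (by
      intro u hu v hv huv X hX Y hY hmX hmY
      obtain ⟨-, hunif, hdens⟩ := hpair u hu v hv huv
      have := hunif hX hY
        (by rw [mul_comm]; exact (mul_le_mul_of_nonneg_left (hup u) hη.le).trans hmX)
        (by rw [mul_comm]; exact (mul_le_mul_of_nonneg_left (hup v) hη.le).trans hmY)
      rw [abs_sub_lt_iff] at this
      linarith)
  rw [hTk] at key
  exact key.trans (by exact_mod_cast card_le_card (filter_subset _ _))

open Finset in
/-- **Clique removal lemma** for graphs with at most quadratically many cliques. -/
lemma SimpleGraph.exists_cliqueFree_of_card_cliqueFinset_le_sq {k : ℕ} (hk : 3 ≤ k) {ε : ℝ}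
    (hε : 0 < ε) :
    ∃ N : ℕ, ∀ (α : Type) [Fintype α] [DecidableEq α] (G : SimpleGraph α) [DecidableRel G.Adj],
      N ≤ Fintype.card α → #(G.cliqueFinset k) ≤ Fintype.card α ^ 2 →
      ∃ (G' : SimpleGraph α) (_ : DecidableRel G'.Adj), G' ≤ G ∧ G'.CliqueFree k ∧
        (#{p : α × α | G.Adj p.1 p.2 ∧ ¬ G'.Adj p.1 p.2} : ℝ)
          ≤ ε * (Fintype.card α : ℝ) ^ 2 := by
  set d : ℝ := min ε 1 / 32 with hd
  have hd0 : 0 < d := by positivity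
  have hdε : d ≤ ε / 32 := by have := min_le_left ε 1; linarith
  have hd1 : d ≤ 1 := by have := min_le_right ε 1; linarith
  set η : ℝ := d ^ k / (4 * k) with hη
  have hk1 : (1 : ℝ) ≤ k := by exact_mod_cast (by omega : 1 ≤ k)
  have hη0 : 0 < η := by positivity
  have hηd : η ≤ d := by
    rw [hη, div_le_iff₀ (by positivity)]
    have : d ^ k ≤ d := pow_le_of_le_one hd0.le hd1 (by omega)
    nlinarith
  set l : ℕ := ⌈4 / ε⌉₊ with hl
  set B : ℕ := SzemerediRegularity.bound η l with hB
  have hB1 : (1 : ℝ) ≤ B := by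
    exact_mod_cast Nat.succ_le_of_lt (SzemerediRegularity.bound_pos η l)
  set c : ℝ := d ^ k / (4 * B) with hc
  have hc0 : 0 < c := by positivity
  have hc1 : c ≤ 1 := by
    rw [hc, div_le_one (by positivity)]
    have : d ^ k ≤ 1 := pow_le_one₀ hd0.le hd1
    linarith
  refine ⟨max (max l 1) (⌈1 / c ^ 3⌉₊ + 1), fun α _ _ G _ hN hG ↦ ?_⟩
  set n := Fintype.card α with hn
  have hln : l ≤ n := (le_max_left _ _).trans ((le_max_left _ _).trans hN)
  have hn1 : 1 ≤ n := (le_max_right _ _).trans ((le_max_left _ _).trans hN)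
  have hcn : 1 < c ^ 3 * n := by
    have h1 : ⌈1 / c ^ 3⌉₊ + 1 ≤ n := (le_max_right _ _).trans hN
    have h2 : (⌈1 / c ^ 3⌉₊ : ℝ) + 1 ≤ n := by exact_mod_cast h1
    have h3 : 1 / c ^ 3 < n := by linarith [Nat.le_ceil (1 / c ^ 3)]
    rwa [div_lt_iff₀' (by positivity)] at h3
  have : Nonempty α := Fintype.card_pos_iff.1 hn1
  have hn1' : (1 : ℝ) ≤ n := by exact_mod_cast hn1
  obtain ⟨P, hP, hPl, hPB, hPunif⟩ := szemeredi_regularity G hη0 hln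
  refine ⟨G.regularityReduced P η (2 * d), inferInstance, SimpleGraph.regularityReduced_le,
    ?_, ?_⟩
  · intro T hT
    have key := G.pow_le_card_cliqueFinset_of_regularityReduced (by omega) hd0 hd1 hP hT
    have hPpos : 0 < #P.parts := (P.parts_nonempty univ_nonempty.ne_empty).card_pos
    have hPn : #P.parts ≤ n := by simpa using P.card_parts_le_card
    have hdiv : n ≤ 2 * B * (n / #P.parts) := by
      have h1 : 1 ≤ n / #P.parts := (Nat.one_le_div_iff hPpos).2 hPn
      have h2 := Nat.mod_add_div n #P.parts
      have h3 := Nat.mod_lt n hPpos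
      have h4 : #P.parts * 1 ≤ #P.parts * (n / #P.parts) := Nat.mul_le_mul_left _ h1
      have h5 : #P.parts * (n / #P.parts) ≤ B * (n / #P.parts) := Nat.mul_le_mul_right _ hPB
      rw [mul_assoc]
      omega
    have hdiv' : (n : ℝ) ≤ 2 * B * (n / #P.parts : ℕ) := by exact_mod_cast hdiv
    have hbase : c * n ≤ d ^ k / 2 * (n / #P.parts : ℕ) := by
      calc c * n ≤ c * (2 * B * (n / #P.parts : ℕ)) := by gcongr
        _ = _ := by rw [hc]; field_simp; ring
    have hcn1 : 1 ≤ c * n := by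
      have : c ^ 3 ≤ c := pow_le_of_le_one hc0.le hc1 (by norm_num)
      nlinarith
    have hG' : (#(G.cliqueFinset k) : ℝ) ≤ (n : ℝ) ^ 2 := by exact_mod_cast hG
    have h1 : (c * n) ^ 3 ≤ (n : ℝ) ^ 2 :=
      calc (c * n) ^ 3 ≤ (c * n) ^ k := pow_le_pow_right₀ hcn1 hk
        _ ≤ (d ^ k / 2 * (n / #P.parts : ℕ)) ^ k := by gcongr
        _ ≤ _ := key.trans hG'
    have h2 : (n : ℝ) ^ 2 < (c * n) ^ 3 := by
      calc (n : ℝ) ^ 2 = 1 * (n : ℝ) ^ 2 := (one_mul _).symm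
        _ < c ^ 3 * n * (n : ℝ) ^ 2 := by gcongr
        _ = _ := by ring
    linarith
  · have hl' : 4 / ε ≤ #P.parts := (Nat.le_ceil _).trans (by exact_mod_cast hPl)
    refine (G.card_unreduced_lt hε hη0 (by positivity : 0 ≤ 2 * d) hP hPunif hl').le.trans ?_
    gcongr
    linarith

lemma gamma_two_le_choose {n k : ℕ} (hk : 2 ≤ k) : gamma n k 2 ≤ n.choose 2 := by
  refine Nat.sInf_le ⟨Finset.powersetCard 2 (Finset.range n), ∅, ⟨?_, by simp, ?_, ?_⟩, by simp⟩
  · intro e he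
    exact Finset.mem_powersetCard.1 he
  · intro A hA hAk _
    obtain ⟨e, he, hcard⟩ := Finset.exists_subset_card_eq (hAk ▸ hk : 2 ≤ A.card)
    exact ⟨e, Finset.mem_powersetCard.2 ⟨he.trans hA, hcard⟩, he⟩
  · intro e he hcard h
    exact absurd (Finset.mem_powersetCard.2 ⟨he, hcard⟩) h

/-- The graph on `Fin n` whose edges are the pairs outside `E`. -/
def pairComplement (n : ℕ) (E : Finset (Finset ℕ)) : SimpleGraph (Fin n) where
  Adj a b := a ≠ b ∧ ({(a : ℕ), (b : ℕ)} : Finset ℕ) ∉ E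
  symm.symm a b h := ⟨h.1.symm, by rw [Finset.pair_comm]; exact h.2⟩

instance (n : ℕ) (E : Finset (Finset ℕ)) : DecidableRel (pairComplement n E).Adj :=
  fun a b ↦ inferInstanceAs (Decidable (a ≠ b ∧ ({(a : ℕ), (b : ℕ)} : Finset ℕ) ∉ E))

lemma IsDomSet.card_cliqueFinset_pairComplement_le {n k : ℕ} {E K : Finset (Finset ℕ)}
    (h : IsDomSet n k 2 E K) : ((pairComplement n E).cliqueFinset k).card ≤ K.card := by
  refine Finset.card_le_card_of_injOn (fun A ↦ A.map Fin.valEmbedding) ?_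
    (Finset.map_injective _).injOn
  intro A hA
  have hA' := SimpleGraph.mem_cliqueFinset_iff.1 hA
  by_contra hAK
  obtain ⟨e, he, heA⟩ := h.2.2.1 (A.map Fin.valEmbedding)
    (fun x hx ↦ by
      obtain ⟨y, -, rfl⟩ := Finset.mem_map.1 hx
      exact Finset.mem_range.2 y.2)
    (by rw [Finset.card_map, hA'.card_eq]) hAK
  obtain ⟨x, y, hxy, rfl⟩ := Finset.card_eq_two.1 (h.1 e he).2
  obtain ⟨a, ha, rfl⟩ := Finset.mem_map.1 (heA (Finset.mem_insert_self _ _))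
  obtain ⟨b, hb, rfl⟩ := Finset.mem_map.1
    (heA (Finset.mem_insert_of_mem (Finset.mem_singleton_self _)))
  exact (hA'.isClique ha hb (fun hab ↦ hxy (by rw [hab]))).2 he

/-- If deleting a set of adjacencies makes the complement of `E` free of `k`-cliques, then each
member of `K` covers at most `C(k,2) - 1` of the remaining pairs. -/
lemma IsDomSet.choose_le_of_cliqueFree {n k : ℕ} {E K : Finset (Finset ℕ)}
    (h : IsDomSet n k 2 E K) (G : SimpleGraph (Fin n)) [DecidableRel G.Adj]
    (hG : G.CliqueFree k) :
    n.choose 2 ≤ E.card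
      + (Finset.univ.filter fun p : Fin n × Fin n ↦
          (pairComplement n E).Adj p.1 p.2 ∧ ¬ G.Adj p.1 p.2).card
      + (k.choose 2 - 1) * K.card := by
  classical
  set R := Finset.univ.filter fun p : Fin n × Fin n ↦
    (pairComplement n E).Adj p.1 p.2 ∧ ¬ G.Adj p.1 p.2
  let F : Finset ℕ → Prop := fun e ↦ ∃ a b : Fin n, G.Adj a b ∧ e = {(a : ℕ), (b : ℕ)}
  have hsub : Finset.powersetCard 2 (Finset.range n) ⊆
      (E ∪ R.image fun p ↦ {(p.1 : ℕ), (p.2 : ℕ)}) ∪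
        K.biUnion fun A ↦ (Finset.powersetCard 2 A).filter F := by
    intro e he
    obtain ⟨hen, hcard⟩ := Finset.mem_powersetCard.1 he
    by_cases heE : e ∈ E
    · exact Finset.mem_union_left _ (Finset.mem_union_left _ heE)
    obtain ⟨A, hA, heA⟩ := h.2.2.2 e hen hcard heE
    by_cases heF : F e
    · exact Finset.mem_union_right _ (Finset.mem_biUnion.2
        ⟨A, hA, Finset.mem_filter.2 ⟨Finset.mem_powersetCard.2 ⟨heA, hcard⟩, heF⟩⟩)
    obtain ⟨x, y, hxy, rfl⟩ := Finset.card_eq_two.1 hcard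
    have hx : x < n := Finset.mem_range.1 (hen (by simp))
    have hy : y < n := Finset.mem_range.1 (hen (by simp))
    refine Finset.mem_union_left _ (Finset.mem_union_right _ (Finset.mem_image.2
      ⟨(⟨x, hx⟩, ⟨y, hy⟩), Finset.mem_filter.2 ⟨Finset.mem_univ _, ⟨?_, heE⟩, ?_⟩, rfl⟩))
    · simpa using hxy
    · exact fun hadj ↦ heF ⟨_, _, hadj, rfl⟩
  have hA : ∀ A ∈ K, ((Finset.powersetCard 2 A).filter F).card ≤ k.choose 2 - 1 := by
    intro A hA
    obtain ⟨hAn, hAk⟩ := h.2.1 A hA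
    refine Nat.le_sub_one_of_lt ?_
    rw [← hAk, ← Finset.card_powersetCard]
    refine Finset.card_lt_card (Finset.filter_ssubset.2 ?_)
    by_contra! hall
    refine hG (Finset.univ.filter fun a : Fin n ↦ (a : ℕ) ∈ A) ⟨?_, ?_⟩
    · intro a ha b hb hab
      have ha' := (Finset.mem_filter.1 ha).2
      have hb' := (Finset.mem_filter.1 hb).2
      obtain ⟨c, d, hcd, heq⟩ := hall {(a : ℕ), (b : ℕ)} (Finset.mem_powersetCard.2
        ⟨Finset.insert_subset ha' (Finset.singleton_subset_iff.2 hb'),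
          Finset.card_pair fun h ↦ hab (Fin.ext h)⟩)
      have haq : (a : ℕ) ∈ ({(c : ℕ), (d : ℕ)} : Finset ℕ) := heq ▸ by simp
      have hbq : (b : ℕ) ∈ ({(c : ℕ), (d : ℕ)} : Finset ℕ) := heq ▸ by simp
      simp only [Finset.mem_insert, Finset.mem_singleton, ← Fin.ext_iff] at haq hbq
      rcases haq with rfl | rfl <;> rcases hbq with rfl | rfl
      · exact absurd rfl hab
      · exact hcd
      · exact hcd.symm
      · exact absurd rfl hab
    · rw [← hAk, ← Finset.card_map Fin.valEmbedding]
      congr 1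
      ext x
      simp only [Finset.mem_map, Finset.mem_filter, Finset.mem_univ, true_and,
        Fin.valEmbedding_apply]
      exact ⟨by rintro ⟨a, ha, rfl⟩; exact ha,
        fun hx ↦ ⟨⟨x, Finset.mem_range.1 (hAn hx)⟩, hx, rfl⟩⟩
  have h1 := Finset.card_le_card hsub
  rw [Finset.card_powersetCard, Finset.card_range] at h1
  refine h1.trans ((Finset.card_union_le _ _).trans (Nat.add_le_add
    ((Finset.card_union_le _ _).trans (Nat.add_le_add_left Finset.card_image_le _)) ?_))
  rw [mul_comm]
  exact Finset.card_biUnion_le_card_mul _ _ _ hA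

/-- For an optimal dominating set `(E, K)` of `G_{k,2}`,
`|E| + (C(k,2) - 1)·|K| ≥ n²/2 + o(n²)`. -/
theorem optimal_domset_weighted_lower (k : ℕ) (hk : 3 ≤ k) (ε : ℝ) (hε : 0 < ε) :
    ∃ N : ℕ, ∀ n : ℕ, N ≤ n → ∀ E K : Finset (Finset ℕ),
      IsDomSet n k 2 E K → E.card + K.card = gamma n k 2 →
      (1 / 2 - ε) * (n : ℝ) ^ 2 ≤ (E.card : ℝ) + ((k.choose 2 : ℝ) - 1) * (K.card : ℝ) := by
  obtain ⟨N, hN⟩ := SimpleGraph.exists_cliqueFree_of_card_cliqueFinset_le_sq hk (half_pos hε)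
  refine ⟨max N ⌈1 / ε⌉₊, fun n hn E K hEK hopt ↦ ?_⟩
  have hK : ((pairComplement n E).cliqueFinset k).card ≤ Fintype.card (Fin n) ^ 2 := by
    rw [Fintype.card_fin]
    have h1 := hEK.card_cliqueFinset_pairComplement_le
    have h2 := gamma_two_le_choose (n := n) (k := k) (by omega)
    have h3 : n.choose 2 ≤ n ^ 2 := Nat.choose_le_pow n 2
    omega
  obtain ⟨G, _, -, hfree, hR⟩ := hN (Fin n) (pairComplement n E)
    (by rw [Fintype.card_fin]; exact (le_max_left _ _).trans hn) hK
  rw [Fintype.card_fin] at hR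
  have hcount := hEK.choose_le_of_cliqueFree G hfree
  have hk1 : 1 ≤ k.choose 2 := Nat.choose_pos (by omega)
  have hcount' : ((n.choose 2 : ℕ) : ℝ) ≤ E.card
      + (Finset.univ.filter fun p : Fin n × Fin n ↦
          (pairComplement n E).Adj p.1 p.2 ∧ ¬ G.Adj p.1 p.2).card
      + ((k.choose 2 : ℝ) - 1) * K.card := by
    have : ((k.choose 2 - 1 : ℕ) : ℝ) = (k.choose 2 : ℝ) - 1 := by push_cast [hk1]; ring
    rw [← this]
    exact_mod_cast hcount
  rw [Nat.cast_choose_two] at hcount'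
  have hn1 : 1 / ε ≤ n := (Nat.le_ceil _).trans (by exact_mod_cast (le_max_right _ _).trans hn)
  have hn2 : 1 ≤ ε * n := by rwa [div_le_iff₀' hε] at hn1
  have hn3 : (n : ℝ) ≤ ε * n ^ 2 := by nlinarith [Nat.cast_nonneg (α := ℝ) n]
  linarith
end

section
/- Fix an integer k ≥ 3. For every ε > 0 there exists N such that for all n ≥ N, the domination number satisfies γ(G_{k,2}) ≥ ((k² + k − 4)/(2k(k−1)²) − ε) · n². -/
/-- If every `(r + 1)`-subset of `M` contains a two-element member of `F`, then Turán's theorem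
bounds the size of `F` from below. -/
theorem turan_le_card_of_forall_exists_subset {r : ℕ} (hr : 0 < r) (M : Finset ℕ)
    (F : Finset (Finset ℕ))
    (hF : ∀ A ⊆ M, A.card = r + 1 → ∃ e ∈ F, e.card = 2 ∧ e ⊆ A) :
    (M.card : ℝ) ^ 2 / (2 * r) - M.card / 2 ≤ F.card := by
  classical
  let G : SimpleGraph M :=
    { Adj := fun x y => x ≠ y ∧ ({(x : ℕ), (y : ℕ)} : Finset ℕ) ∉ F
      symm := ⟨fun x y h => ⟨h.1.symm, by rw [Finset.pair_comm]; exact h.2⟩⟩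
      loopless := ⟨fun x h => h.1 rfl⟩ }
  have hfree : G.CliqueFree (r + 1) := by
    intro s hs
    obtain ⟨e, heF, he2, hes⟩ := hF (s.map (Function.Embedding.subtype _))
      (by intro x hx; simp at hx; exact hx.1) (by simpa using hs.card_eq)
    obtain ⟨x, y, hxy, rfl⟩ := Finset.card_eq_two.1 he2
    have hx := hes (Finset.mem_insert_self x {y})
    have hy := hes (Finset.mem_insert_of_mem (Finset.mem_singleton_self y) : y ∈ {x, y})
    simp only [Finset.mem_map, Function.Embedding.subtype_apply] at hx hy
    obtain ⟨a, ha, rfl⟩ := hx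
    obtain ⟨b, hb, rfl⟩ := hy
    exact (hs.isClique ha hb (fun h => hxy (by rw [h]))).2 heF
  have hturan : 2 * r * G.edgeFinset.card ≤ (r - 1) * M.card ^ 2 := by
    obtain ⟨H, _, hH⟩ := SimpleGraph.exists_isTuranMaximal (V := M) hr
    have h := hH.2 hfree
    have h' := SimpleGraph.mul_card_edgeFinset_turanGraph_le (n := Fintype.card M) (r := r)
    rw [← ((SimpleGraph.isTuranMaximal_iff_nonempty_iso_turanGraph hr).1 hH).some.card_edgeFinset_eq,
      Fintype.card_coe] at h'
    refine le_trans (Nat.mul_le_mul_left _ ?_) h'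
    convert! h
  have hcover : M.powersetCard 2 ⊆
      F ∪ G.edgeFinset.image (fun s => s.toFinset.map (Function.Embedding.subtype _)) := by
    intro e he
    rw [Finset.mem_powersetCard] at he
    by_cases heF : e ∈ F
    · exact Finset.mem_union_left _ heF
    refine Finset.mem_union_right _ ?_
    obtain ⟨x, y, hxy, rfl⟩ := Finset.card_eq_two.1 he.2
    have hx : x ∈ M := he.1 (by simp)
    have hy : y ∈ M := he.1 (by simp)
    rw [Finset.mem_image]
    refine ⟨s(⟨x, hx⟩, ⟨y, hy⟩), ?_, ?_⟩
    · rw [SimpleGraph.mem_edgeFinset, SimpleGraph.mem_edgeSet]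
      exact ⟨fun h => hxy (congrArg Subtype.val h), heF⟩
    · ext z
      simp [Sym2.mem_toFinset]
      grind
  have hcard : M.card.choose 2 ≤ F.card + G.edgeFinset.card := by
    rw [← Finset.card_powersetCard]
    exact (Finset.card_le_card hcover).trans
      ((Finset.card_union_le _ _).trans (Nat.add_le_add_left Finset.card_image_le _))
  have hcard' : (M.card : ℝ) * (M.card - 1) / 2 ≤ F.card + G.edgeFinset.card := by
    rw [← Nat.cast_choose_two]; exact_mod_cast hcard
  have hturan' : 2 * (r : ℝ) * G.edgeFinset.card ≤ (r - 1) * M.card ^ 2 := by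
    have : ((r - 1 : ℕ) : ℝ) = (r : ℝ) - 1 := by rw [Nat.cast_sub hr]; simp
    rw [← this]; exact_mod_cast hturan
  have hr' : (0 : ℝ) < 2 * r := by positivity
  rw [sub_le_iff_le_add, div_le_iff₀ hr']
  nlinarith [mul_le_mul_of_nonneg_left hcard' hr'.le]

namespace IsDomSet

variable {n k : ℕ} {E K : Finset (Finset ℕ)}

theorem turan_le_card_filter_add_card_filter {r : ℕ} (hr : 0 < r)
    (h : IsDomSet n (r + 1) 2 E K) {M : Finset ℕ} (hM : M ⊆ Finset.range n) :
    (M.card : ℝ) ^ 2 / (2 * r) - M.card / 2 ≤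
      (E.filter (· ⊆ M)).card + (K.filter (· ⊆ M)).card := by
  classical
  obtain ⟨hE, hK, hEK, -⟩ := h
  have hpair : ∀ A : Finset ℕ, ∃ e : Finset ℕ, A ∈ K → e ⊆ A ∧ e.card = 2 := by
    intro A
    by_cases hA : A ∈ K
    · obtain ⟨e, he⟩ := Finset.exists_subset_card_eq (s := A) (n := 2) (by rw [(hK A hA).2]; omega)
      exact ⟨e, fun _ => he⟩
    · exact ⟨∅, fun h => absurd h hA⟩
  choose p hp using hpair
  refine (turan_le_card_of_forall_exists_subset hr M
    (E.filter (· ⊆ M) ∪ (K.filter (· ⊆ M)).image p) ?_).trans ?_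
  · intro A hA hAc
    by_cases hAK : A ∈ K
    · exact ⟨p A, Finset.mem_union_right _ (Finset.mem_image_of_mem p (by simp [hAK, hA])),
        (hp A hAK).2, (hp A hAK).1⟩
    · obtain ⟨e, he, heA⟩ := hEK A (hA.trans hM) hAc hAK
      exact ⟨e, Finset.mem_union_left _ (by simp [he, heA.trans hA]), (hE e he).2, heA⟩
  · exact_mod_cast (Finset.card_union_le _ _).trans
      (Nat.add_le_add_left Finset.card_image_le _)

theorem choose_mul_turan_le {r m : ℕ} (hr : 2 ≤ r) (hm : 3 ≤ m) (h : IsDomSet n (r + 1) 2 E K) :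
    (n.choose m : ℝ) * ((m : ℝ) ^ 2 / (2 * r) - m / 2) ≤
      E.card * (n - 2).choose (m - 2) + K.card * (n - 3).choose (m - 3) := by
  classical
  have hsum := Finset.sum_le_sum fun M (hM : M ∈ (Finset.range n).powersetCard m) =>
    h.turan_le_card_filter_add_card_filter (by omega : 0 < r) (Finset.mem_powersetCard.1 hM).1
  have hconst : ∑ M ∈ (Finset.range n).powersetCard m,
      ((M.card : ℝ) ^ 2 / (2 * r) - M.card / 2) =
      (n.choose m : ℝ) * ((m : ℝ) ^ 2 / (2 * r) - m / 2) := by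
    rw [Finset.sum_congr rfl (g := fun _ => (m : ℝ) ^ 2 / (2 * r) - m / 2)
      fun M hM => by rw [(Finset.mem_powersetCard.1 hM).2],
      Finset.sum_const, Finset.card_powersetCard, Finset.card_range, nsmul_eq_mul]
  rw [hconst, Finset.sum_add_distrib] at hsum
  refine hsum.trans (add_le_add ?_ ?_)
  · have := Finset.sum_card_bipartiteAbove_eq_sum_card_bipartiteBelow
      (s := (Finset.range n).powersetCard m) (t := E) (fun M e => e ⊆ M)
    simp only [Finset.bipartiteAbove, Finset.bipartiteBelow] at this
    norm_cast
    rw [this, ← smul_eq_mul]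
    refine Finset.sum_le_card_nsmul _ _ _ fun e he => ?_
    obtain ⟨hen, he2⟩ := h.1 e he
    rw [Finset.card_filter_powersetCard_subset _ _ _ hen (by omega), he2, Finset.card_range]
  · have := Finset.sum_card_bipartiteAbove_eq_sum_card_bipartiteBelow
      (s := (Finset.range n).powersetCard m) (t := K) (fun M A => A ⊆ M)
    simp only [Finset.bipartiteAbove, Finset.bipartiteBelow] at this
    norm_cast
    rw [this, ← smul_eq_mul]
    refine Finset.sum_le_card_nsmul _ _ _ fun A hA => ?_
    obtain ⟨hAn, hAk⟩ := h.2.1 A hA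
    obtain ⟨B, hBA, hB⟩ := Finset.exists_subset_card_eq (s := A) (n := 3) (by omega)
    have hcount := Finset.card_filter_powersetCard_subset B (Finset.range n) m (hBA.trans hAn) (by omega)
    rw [hB, Finset.card_range] at hcount
    rw [← hcount]
    exact Finset.card_le_card (Finset.monotone_filter_right _ fun M _ hM => hBA.trans hM)

/-- Averaging Turán's theorem over all `m`-subsets of the ground set. -/
theorem turan_average_le {r m : ℕ} (hr : 2 ≤ r) (hm : 3 ≤ m) (hmn : m ≤ n)
    (h : IsDomSet n (r + 1) 2 E K) :
    (n : ℝ) * (n - 1) / 2 * (1 / r - 1 / (m - 1)) ≤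
      E.card + K.card * ((m - 2) / (n - 2)) := by
  have hsum := h.choose_mul_turan_le hr hm
  have hab : (n.choose m : ℝ) * (m * (m - 1)) = n * (n - 1) * (n - 2).choose (m - 2) := by
    have := Nat.choose_mul (n := n) (k := m) (s := 2) (by omega)
    have this' : (n.choose m : ℝ) * m.choose 2 = n.choose 2 * (n - 2).choose (m - 2) := by
      exact_mod_cast this
    rw [Nat.cast_choose_two, Nat.cast_choose_two] at this'
    linarith
  have hcb : ((n - 3).choose (m - 3) : ℝ) * (n - 2) = (n - 2).choose (m - 2) * (m - 2) := by
    obtain ⟨a, rfl⟩ := Nat.exists_eq_add_of_le' hm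
    obtain ⟨b, rfl⟩ := Nat.exists_eq_add_of_le' (hm.trans hmn)
    have := Nat.add_one_mul_choose_eq b a
    have this' : ((b : ℝ) + 1) * b.choose a = (b + 1).choose (a + 1) * (a + 1) := by
      exact_mod_cast this
    simp only [Nat.add_sub_cancel, show b + 3 - 2 = b + 1 by omega,
      show a + 3 - 2 = a + 1 by omega]
    push_cast
    linarith
  have hb : (0 : ℝ) < (n - 2).choose (m - 2) := by
    exact_mod_cast Nat.choose_pos (by omega)
  have hm' : (3 : ℝ) ≤ m := by exact_mod_cast hm
  have hn' : (3 : ℝ) ≤ n := by exact_mod_cast hm.trans hmn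
  have hr' : (2 : ℝ) ≤ r := by exact_mod_cast hr
  have hn2 : (n : ℝ) - 2 ≠ 0 := by linarith
  have hm1 : (0 : ℝ) < m - 1 := by linarith
  have hc : ((n - 3).choose (m - 3) : ℝ) = (n - 2).choose (m - 2) * ((m - 2) / (n - 2)) := by
    field_simp; linarith
  have ha : (n.choose m : ℝ) = (n - 2).choose (m - 2) * (n * (n - 1) / (m * (m - 1))) := by
    field_simp; linarith
  rw [hc, ha] at hsum
  have hmain : (n : ℝ) * (n - 1) / (m * (m - 1)) * ((m : ℝ) ^ 2 / (2 * r) - m / 2) ≤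
      E.card + K.card * ((m - 2) / (n - 2)) := by
    refine le_of_mul_le_mul_left ?_ hb
    linarith
  refine le_trans ?_ hmain
  have hfac : (n : ℝ) * (n - 1) / (m * (m - 1)) * ((m : ℝ) ^ 2 / (2 * r) - m / 2) =
      n * (n - 1) / 2 * (1 / r - 1 / (m - 1) + 1 / (r * (m - 1))) := by
    field_simp
    ring
  rw [hfac]
  refine mul_le_mul_of_nonneg_left ?_ (by nlinarith)
  have : (0 : ℝ) ≤ 1 / (r * (m - 1)) := by positivity
  linarith

theorem choose_two_le (h : IsDomSet n k 2 E K) :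
    n.choose 2 ≤ E.card + K.card * k.choose 2 := by
  classical
  have hcover : (Finset.range n).powersetCard 2 ⊆ E ∪ K.biUnion (Finset.powersetCard 2) := by
    intro e he
    rw [Finset.mem_powersetCard] at he
    by_cases heE : e ∈ E
    · exact Finset.mem_union_left _ heE
    · obtain ⟨A, hA, heA⟩ := h.2.2.2 e he.1 he.2 heE
      exact Finset.mem_union_right _ (Finset.mem_biUnion.2
        ⟨A, hA, Finset.mem_powersetCard.2 ⟨heA, he.2⟩⟩)
  calc n.choose 2 = ((Finset.range n).powersetCard 2).card := by simp
    _ ≤ E.card + (K.biUnion (Finset.powersetCard 2)).card :=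
      (Finset.card_le_card hcover).trans (Finset.card_union_le _ _)
    _ ≤ E.card + K.card * k.choose 2 := by
      refine Nat.add_le_add_left (Finset.card_biUnion_le_card_mul _ _ _ fun A hA => ?_) _
      rw [Finset.card_powersetCard, (h.2.1 A hA).2]

end IsDomSet

theorem exists_isDomSet_card_eq_gamma {n k l : ℕ} :
    ∃ E K : Finset (Finset ℕ), IsDomSet n k l E K ∧ gamma n k l = E.card + K.card := by
  refine Nat.sInf_mem (s := {m | ∃ E K : Finset (Finset ℕ),
    IsDomSet n k l E K ∧ m = E.card + K.card}) ⟨_, (Finset.range n).powersetCard l,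
    (Finset.range n).powersetCard k, ⟨?_, ?_, ?_, ?_⟩, rfl⟩
  · exact fun e he => Finset.mem_powersetCard.1 he
  · exact fun A hA => Finset.mem_powersetCard.1 hA
  · exact fun A hA hAk hAK => absurd (Finset.mem_powersetCard.2 ⟨hA, hAk⟩) hAK
  · exact fun e he hel heE => absurd (Finset.mem_powersetCard.2 ⟨he, hel⟩) heE

/-- For fixed `k ≥ 3`, `γ(G_{k,2}) ≥ (k² + k - 4)/(2k(k-1)²) · n² + o(n²)`. -/
theorem domination_number_Gk2_lower_weak (k : ℕ) (hk : 3 ≤ k) (ε : ℝ) (hε : 0 < ε) :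
    ∃ N : ℕ, ∀ n : ℕ, N ≤ n →
      (((k : ℝ) ^ 2 + (k : ℝ) - 4) / (2 * (k : ℝ) * ((k : ℝ) - 1) ^ 2) - ε) * (n : ℝ) ^ 2
        ≤ (gamma n k 2 : ℝ) := by
  obtain ⟨r, rfl⟩ : ∃ r, k = r + 1 := ⟨k - 1, by omega⟩
  have hr : 2 ≤ r := by omega
  have hr' : (2 : ℝ) ≤ r := by exact_mod_cast hr
  have hr0 : (0 : ℝ) < r := by linarith
  obtain ⟨m₀, hm₀⟩ := exists_nat_ge (2 / ε)
  let m := m₀ + 4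
  have hm₁ : 2 ≤ ε * (m - 1) := by
    rw [div_le_iff₀ hε] at hm₀
    simp only [m]; push_cast; nlinarith
  have hm4 : (4 : ℝ) ≤ m := by simp [m]
  obtain ⟨N₀, hN₀⟩ := exists_nat_ge (4 * m / ε)
  refine ⟨N₀ + m + 2, fun n hn => ?_⟩
  have hn' : (N₀ : ℝ) + m + 2 ≤ n := by exact_mod_cast hn
  obtain ⟨E, K, hEK, hg⟩ := exists_isDomSet_card_eq_gamma (n := n) (k := r + 1) (l := 2)
  rw [hg]
  push_cast
  set x : ℝ := (E.card : ℝ)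
  set y : ℝ := (K.card : ℝ)
  set c : ℝ := ((r + 1 : ℝ) ^ 2 + (r + 1) - 4) / (2 * (r + 1) * (r + 1 - 1) ^ 2) with hc
  have hx : 0 ≤ x := Nat.cast_nonneg _
  have hy : 0 ≤ y := Nat.cast_nonneg _
  have hc1 : c ≤ 1 := by
    rw [hc, div_le_one (by rw [add_sub_cancel_right]; positivity)]
    nlinarith [mul_nonneg hr0.le hr0.le, mul_nonneg (mul_nonneg hr0.le hr0.le) (sub_nonneg.2 hr')]
  have havg := hEK.turan_average_le (m := m) hr (by omega) (by omega)
  have hcov : (n : ℝ) * (n - 1) / 2 ≤ x + y * ((r + 1) * r / 2) := by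
    have h := hEK.choose_two_le
    have h' : (n.choose 2 : ℝ) ≤ E.card + K.card * (r + 1).choose 2 := by exact_mod_cast h
    rw [Nat.cast_choose_two, Nat.cast_choose_two] at h'
    simpa using h'
  rcases le_total ((n : ℝ) ^ 2) y with hyn | hyn
  · nlinarith [sq_nonneg (n : ℝ)]
  have hη : 1 / ((m : ℝ) - 1) ≤ ε / 2 := by
    rw [div_le_iff₀ (by linarith)]; linarith
  have hN₁ : 4 * m ≤ ε * N₀ := by
    rw [div_le_iff₀ hε] at hN₀; linarith
  have hδ : ((m : ℝ) - 2) / (n - 2) ≤ ε / 4 := by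
    rw [div_le_iff₀ (by linarith)]; nlinarith
  have hδ0 : 0 ≤ ((m : ℝ) - 2) / (n - 2) := div_nonneg (by linarith) (by linarith)
  set P : ℝ := (n : ℝ) * (n - 1) / 2 with hP
  have hP0 : 0 ≤ P := by rw [hP]; nlinarith
  have h1 : P * (1 / r - ε / 2) ≤ x + y * (ε / 4) :=
    (mul_le_mul_of_nonneg_left (by linarith) hP0).trans
      (havg.trans (by gcongr))
  have hεn : 4 ≤ ε * n := by nlinarith
  set θ : ℝ := 2 / ((r + 1) * r) with hθ
  have hθ0 : 0 ≤ θ := by positivity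
  have hθ1 : θ ≤ 1 := by
    rw [hθ, div_le_one (by positivity)]; nlinarith
  have hθr : θ * ((r + 1) * r / 2) = 1 := by rw [hθ]; field_simp
  have hcθ : 2 * c = (1 - θ) * (1 / r) + θ := by
    rw [hc, hθ, add_sub_cancel_right]; field_simp; ring
  have h2 := mul_le_mul_of_nonneg_left h1 (sub_nonneg.2 hθ1)
  have h3 := mul_le_mul_of_nonneg_left hcov hθ0
  have h4 : θ * (x + y * ((r + 1) * r / 2)) = θ * x + y := by
    linear_combination y * hθr
  have h6 : P * (2 * c) = c * n ^ 2 - c * n := by rw [hP]; ring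
  have h7 : P * (ε / 2) ≤ n ^ 2 * (ε / 4) := by
    have : 0 ≤ n * ε := by positivity
    rw [hP]
    linarith
  clear_value x y c P θ
  have h5 : P * (2 * c) - P * (ε / 2) ≤ x + y + (n : ℝ) ^ 2 * (ε / 4) := by
    have e1 : 0 ≤ θ * P * ε := by positivity
    have e2 : (1 - θ) * (y * (ε / 4)) ≤ (n : ℝ) ^ 2 * (ε / 4) :=
      (mul_le_of_le_one_left (by positivity) (by linarith)).trans (by gcongr)
    rw [hcθ]
    linarith
  have hn0 : (0 : ℝ) ≤ n := Nat.cast_nonneg n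
  have h8 : c * n ≤ n := mul_le_of_le_one_left hn0 hc1
  have h9 := mul_le_mul_of_nonneg_right hεn hn0
  linarith
end

section
/- Fix integers k > ℓ ≥ 2 and a real number α ∈ [0,1], and suppose that ex(n, K_k^{(ℓ)})/C(n,ℓ) → 1 − α as n → ∞. Then for every ε > 0 there exists N such that for all n ≥ N, γ(G_{k,ℓ}) ≥ (α + (1−α)/(C(k,ℓ) − 1) − ε) · C(n,ℓ). -/
/-- The Turán number `ex(n, K_k^{(l)})`: the maximum size of a family `F` of
`l`-element subsets of `[n]` such that no `k`-element subset of `[n]` has all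
of its `l`-element subsets in `F`. -/
noncomputable def exTuran (n k l : ℕ) : ℕ :=
  sSup {m | ∃ F : Finset (Finset ℕ),
    (∀ e ∈ F, e ⊆ Finset.range n ∧ e.card = l) ∧
    (∀ A, A ⊆ Finset.range n → A.card = k → ∃ e, e ⊆ A ∧ e.card = l ∧ e ∉ F) ∧
    m = F.card}

open Filter Topology MeasureTheory Set
open scoped ENNReal symmDiff

namespace Loeb

/-- The space of sequences with `n`-th term in `W n`. -/
def Seq (W : ℕ → Type) : Type := ∀ n, W n

/-- The internal set attached to a sequence of sets: all sequences lying termwise in it for almost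
all indices with respect to a fixed nonprincipal ultrafilter. -/
def intSet {W : ℕ → Type} (A : ∀ n, Set (W n)) : Set (Seq W) :=
  {ω | ∀ᶠ n in (hyperfilter ℕ : Filter ℕ), ω n ∈ A n}

/-- The algebra of all internal sets. -/
def internal (W : ℕ → Type) : Set (Set (Seq W)) := range intSet

instance instMeasurableSpaceSeq (W : ℕ → Type) : MeasurableSpace (Seq W) :=
  MeasurableSpace.generateFrom (internal W)

section
variable {W : ℕ → Type}

lemma mem_intSet {A : ∀ n, Set (W n)} {ω : Seq W} :
    ω ∈ intSet A ↔ ∀ᶠ n in (hyperfilter ℕ : Filter ℕ), ω n ∈ A n := Iff.rfl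

lemma intSet_empty : intSet (fun n => (∅ : Set (W n))) = ∅ := by
  ext ω
  simp only [mem_intSet, mem_empty_iff_false, iff_false]
  exact fun h => (h.exists).elim fun _ h => h

lemma intSet_univ : intSet (fun n => (univ : Set (W n))) = univ := by
  ext ω; simp [mem_intSet]

lemma intSet_compl (A : ∀ n, Set (W n)) : (intSet A)ᶜ = intSet (fun n => (A n)ᶜ) := by
  ext ω
  simp only [mem_compl_iff, mem_intSet]
  exact Ultrafilter.eventually_not.symm

lemma intSet_union (A B : ∀ n, Set (W n)) :
    intSet A ∪ intSet B = intSet (fun n => A n ∪ B n) := by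
  ext ω
  simp only [mem_union, mem_intSet]
  exact Ultrafilter.eventually_or.symm

lemma intSet_inter (A B : ∀ n, Set (W n)) :
    intSet A ∩ intSet B = intSet (fun n => A n ∩ B n) := by
  ext ω
  simp only [mem_inter_iff, mem_intSet]
  exact eventually_and.symm

lemma intSet_sdiff (A B : ∀ n, Set (W n)) :
    intSet A \ intSet B = intSet (fun n => A n \ B n) := by
  simp only [sdiff_eq, intSet_compl, ← intSet_inter]

lemma intSet_biInter {ι : Type*} (t : Finset ι) (A : ι → ∀ n, Set (W n)) :
    ⋂ i ∈ t, intSet (A i) = intSet (fun n => ⋂ i ∈ t, A i n) := by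
  ext ω
  simp only [mem_iInter, mem_intSet]
  exact (eventually_all_finset t).symm

lemma isSetAlgebra_internal : IsSetAlgebra (internal W) where
  empty_mem := ⟨_, intSet_empty⟩
  compl_mem := by
    rintro _ ⟨A, rfl⟩
    exact ⟨_, (intSet_compl A).symm⟩
  union_mem := by
    rintro _ _ ⟨A, rfl⟩ ⟨B, rfl⟩
    exact ⟨_, (intSet_union A B).symm⟩

lemma measurableSet_intSet (A : ∀ n, Set (W n)) : MeasurableSet (intSet A) :=
  MeasurableSpace.measurableSet_generateFrom ⟨A, rfl⟩

variable [∀ n, Nonempty (W n)]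

lemma eventually_eq_empty {A : ∀ n, Set (W n)} (h : intSet A = ∅) :
    ∀ᶠ n in (hyperfilter ℕ : Filter ℕ), A n = ∅ := by
  classical
  by_contra hc
  have hc' := Ultrafilter.eventually_not.2 hc
  have : ∀ n, ∃ x : W n, A n ≠ ∅ → x ∈ A n := by
    intro n
    by_cases hn : A n = ∅
    · exact ⟨Classical.arbitrary _, fun h => absurd hn h⟩
    · obtain ⟨x, hx⟩ := nonempty_iff_ne_empty.2 hn
      exact ⟨x, fun _ => hx⟩
  choose ω hω using this
  have hmem : (ω : Seq W) ∈ intSet A := hc'.mono fun n hn => hω n hn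
  rw [h] at hmem
  exact hmem

lemma eventually_eq_of_intSet_eq {A B : ∀ n, Set (W n)} (h : intSet A = intSet B) :
    ∀ᶠ n in (hyperfilter ℕ : Filter ℕ), A n = B n := by
  have h1 := eventually_eq_empty (A := fun n => A n \ B n)
    (by rw [← intSet_sdiff, h, Set.sdiff_self])
  have h2 := eventually_eq_empty (A := fun n => B n \ A n)
    (by rw [← intSet_sdiff, h, Set.sdiff_self])
  filter_upwards [h1, h2] with n h1 h2
  exact subset_antisymm (sdiff_eq_empty.1 h1) (sdiff_eq_empty.1 h2)

/-- Countable saturation. -/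
lemma exists_eq_empty_of_iInter_eq_empty {S : ℕ → Set (Seq W)} (hS : ∀ m, S m ∈ internal W)
    (hanti : Antitone S) (hempty : ⋂ m, S m = ∅) : ∃ m, S m = ∅ := by
  by_contra! hne
  choose A hA using hS
  have key : ∀ n M, ∃ x : W n, ∀ j ≤ M, (∃ y, ∀ i ≤ j, y ∈ A i n) → x ∈ A j n := by
    intro n M
    induction M with
    | zero =>
      by_cases h : ∃ y, y ∈ A 0 n
      · obtain ⟨y, hy⟩ := h
        refine ⟨y, fun j hj _ => ?_⟩
        obtain rfl : j = 0 := by omega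
        exact hy
      · refine ⟨Classical.arbitrary _, fun j hj ⟨y, hy⟩ => ?_⟩
        exact absurd ⟨y, hy 0 (Nat.zero_le _)⟩ h
    | succ M ih =>
      by_cases h : ∃ y, ∀ i ≤ M + 1, y ∈ A i n
      · obtain ⟨y, hy⟩ := h
        exact ⟨y, fun j hj _ => hy j hj⟩
      · obtain ⟨x, hx⟩ := ih
        refine ⟨x, fun j hj hy => ?_⟩
        rcases Nat.lt_or_ge M j with hlt | hle
        · obtain rfl : j = M + 1 := by omega
          exact absurd hy h
        · exact hx j hle hy
  choose ω hω using fun n => key n n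
  have hmem : (ω : Seq W) ∈ ⋂ m, S m := by
    refine mem_iInter.2 fun m => ?_
    rw [← hA m]
    obtain ⟨ω', hω'⟩ := hne m
    have h1 : ∀ᶠ n in (hyperfilter ℕ : Filter ℕ), ∀ i ∈ Finset.range (m + 1), ω' n ∈ A i n := by
      rw [eventually_all_finset]
      intro i hi
      have : ω' ∈ S i := hanti (by simpa [Nat.lt_succ_iff] using hi) hω'
      rwa [← hA i] at this
    have h2 : ∀ᶠ n in (hyperfilter ℕ : Filter ℕ), m ≤ n :=
      Nat.hyperfilter_le_atTop (eventually_ge_atTop m)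
    filter_upwards [h1, h2] with n h1 h2
    exact hω n m h2 ⟨ω' n, fun i hi => h1 i (by simpa [Nat.lt_succ_iff] using hi)⟩
  rw [hempty] at hmem
  exact hmem

end

section
variable {W : ℕ → Type} [∀ n, Fintype (W n)] [∀ n, Nonempty (W n)]

/-- Normalised counting measure of a finite set. -/
noncomputable def dens {X : Type*} [Fintype X] (A : Set X) : ℝ≥0∞ :=
  (A.ncard : ℝ≥0∞) / (Fintype.card X : ℝ≥0∞)

lemma dens_union {X : Type*} [Fintype X] {A B : Set X} (h : Disjoint A B) :
    dens (A ∪ B) = dens A + dens B := by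
  rw [dens, ncard_union_eq h, Nat.cast_add, ENNReal.add_div]
  rfl

lemma dens_univ {X : Type*} [Fintype X] [Nonempty X] : dens (univ : Set X) = 1 := by
  rw [dens, ncard_univ, Nat.card_eq_fintype_card]
  exact ENNReal.div_self (by simp) (by simp)

open Classical in
/-- The limiting density of an internal set. -/
noncomputable def contentFun (S : Set (Seq W)) : ℝ≥0∞ :=
  if h : S ∈ internal W then
    ((hyperfilter ℕ).map (fun n => dens (h.choose n))).lim
  else 0

lemma tendsto_contentFun (A : ∀ n, Set (W n)) :
    Tendsto (fun n => dens (A n)) (hyperfilter ℕ : Filter ℕ) (𝓝 (contentFun (intSet A))) := by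
  have h : intSet A ∈ internal W := ⟨A, rfl⟩
  rw [contentFun, dif_pos h]
  have h1 : Tendsto (fun n => dens (h.choose n)) (hyperfilter ℕ : Filter ℕ)
      (𝓝 (((hyperfilter ℕ).map (fun n => dens (h.choose n))).lim)) :=
    ((hyperfilter ℕ).map (fun n => dens (h.choose n))).le_nhds_lim
  refine h1.congr' ?_
  filter_upwards [eventually_eq_of_intSet_eq h.choose_spec] with n hn
  rw [hn]

/-- Limiting density as an additive content. -/
noncomputable def content (W : ℕ → Type) [∀ n, Fintype (W n)] [∀ n, Nonempty (W n)] :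
    AddContent ℝ≥0∞ (internal W) :=
  isSetAlgebra_internal.isSetRing.addContent_of_union contentFun
    (by
      have := tendsto_contentFun (fun n => (∅ : Set (W n)))
      rw [intSet_empty] at this
      refine tendsto_nhds_unique this ?_
      simp [dens])
    (by
      rintro _ _ ⟨A, rfl⟩ ⟨B, rfl⟩ hd
      have h0 := eventually_eq_empty (A := fun n => A n ∩ B n)
        (by rw [← intSet_inter]; exact disjoint_iff_inter_eq_empty.1 hd)
      refine tendsto_nhds_unique ?_ ((tendsto_contentFun A).add (tendsto_contentFun B))
      rw [intSet_union]
      refine (tendsto_contentFun (fun n => A n ∪ B n)).congr' ?_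
      filter_upwards [h0] with n hn
      exact dens_union (disjoint_iff_inter_eq_empty.2 hn))

lemma content_univ : content W univ = 1 := by
  have := tendsto_contentFun (fun n => (univ : Set (W n)))
  rw [intSet_univ] at this
  refine tendsto_nhds_unique this ?_
  simp [dens_univ]

lemma isSigmaSubadditive_content : (content W).IsSigmaSubadditive := by
  have hR := (isSetAlgebra_internal (W := W)).isSetRing
  refine isSigmaSubadditive_of_addContent_iUnion_eq_tsum hR ?_
  intro f hf hU hd
  refine addContent_iUnion_eq_sum_of_tendsto_zero hR _ ?_ ?_ hf hU hd
  · intro s hs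
    refine ne_top_of_le_ne_top ENNReal.one_ne_top ?_
    rw [← content_univ (W := W)]
    exact addContent_mono hR.isSetSemiring hs isSetAlgebra_internal.univ_mem (subset_univ _)
  · intro s hs hanti hempty
    obtain ⟨m, hm⟩ := exists_eq_empty_of_iInter_eq_empty hs hanti hempty
    refine tendsto_const_nhds.congr' ?_
    filter_upwards [eventually_ge_atTop m] with n hn
    have : s n = ∅ := subset_empty_iff.1 (hm ▸ hanti hn)
    rw [this, addContent_empty]

/-- The Loeb measure. -/
noncomputable def loeb (W : ℕ → Type) [∀ n, Fintype (W n)] [∀ n, Nonempty (W n)] :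
    Measure (Seq W) :=
  (content W).measure isSetAlgebra_internal.isSetRing.isSetSemiring le_rfl
    isSigmaSubadditive_content

lemma tendsto_loeb (A : ∀ n, Set (W n)) :
    Tendsto (fun n => dens (A n)) (hyperfilter ℕ : Filter ℕ) (𝓝 (loeb W (intSet A))) := by
  have h : intSet A ∈ internal W := ⟨A, rfl⟩
  rw [loeb, AddContent.measure_eq _ _ rfl _ h]
  exact tendsto_contentFun A

instance : IsProbabilityMeasure (loeb W) := by
  constructor
  rw [loeb, AddContent.measure_eq _ _ rfl _ isSetAlgebra_internal.univ_mem]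
  exact content_univ

lemma tendsto_loeb_real (A : ∀ n, Set (W n)) :
    Tendsto (fun n => ((A n).ncard : ℝ) / (Fintype.card (W n) : ℝ)) (hyperfilter ℕ : Filter ℕ)
      (𝓝 ((loeb W).real (intSet A))) := by
  have := (ENNReal.tendsto_toReal (measure_ne_top (loeb W) (intSet A))).comp (tendsto_loeb A)
  refine this.congr fun n => ?_
  simp [dens]

end

lemma exists_measure_symmDiff_lt {Ω : Type*} {mΩ : MeasurableSpace Ω} (μ : Measure Ω)
    [IsFiniteMeasure μ] {𝒜 : Set (Set Ω)} (h𝒜 : IsSetAlgebra 𝒜)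
    (hle : MeasurableSpace.generateFrom 𝒜 ≤ mΩ) {s : Set Ω}
    (hs : MeasurableSet[MeasurableSpace.generateFrom 𝒜] s) {ε : ℝ} (hε : 0 < ε) :
    ∃ t ∈ 𝒜, μ (s ∆ t) < ENNReal.ofReal ε := by
  have key : ∀ {m : MeasurableSpace Ω} (ν : Measure Ω) [IsFiniteMeasure ν],
      m = MeasurableSpace.generateFrom 𝒜 → MeasurableSet[m] s →
        ∃ t ∈ 𝒜, ν (s ∆ t) < ENNReal.ofReal ε := by
    intro m ν _ hm hs
    exact (Measure.MeasureDense.of_generateFrom_isSetAlgebra_finite (μ := ν) h𝒜 hm).approx s hs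
      (measure_ne_top _ _) ε hε
  obtain ⟨t, ht, h⟩ := @key _ (μ.trim hle) (isFiniteMeasure_trim hle) rfl hs
  refine ⟨t, ht, ?_⟩
  rwa [trim_measurableSet_eq] at h
  exact @MeasurableSet.symmDiff _ (MeasurableSpace.generateFrom 𝒜) _ _ hs
    (MeasurableSpace.measurableSet_generateFrom ht)

/-- The coordinatewise combination of `x` on `e` and `y` off `e`. -/
def mix {k : ℕ} {X : Type*} (e : Finset (Fin k)) (x y : Fin k → X) : Fin k → X :=
  fun i => if i ∈ e then x i else y i

lemma exists_abs_sum_le_abs_sum_mix {k : ℕ} {X : Type*} [Fintype X] [Nonempty X]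
    (e : Finset (Fin k)) (F : (Fin k → X) → ℝ) :
    ∃ y, |∑ x, F x| ≤ |∑ x, F (mix e x y)| := by
  by_contra! h
  have hinv : Function.Involutive
      (fun p : (Fin k → X) × (Fin k → X) => (mix e p.1 p.2, mix e p.2 p.1)) := by
    rintro ⟨x, y⟩
    ext i <;> simp only [mix] <;> split_ifs <;> rfl
  have h1 : ∑ y, ∑ x, F (mix e x y) = ∑ y : Fin k → X, ∑ x, F x := by
    rw [← Fintype.sum_prod_type_right', ← Fintype.sum_prod_type_right']
    exact hinv.toPerm.sum_comp Finset.univ (fun p => F p.1) (by simp)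
  have h2 : |∑ y, ∑ x, F (mix e x y)| < ∑ y : Fin k → X, |∑ x, F x| :=
    (Finset.abs_sum_le_sum_abs _ _).trans_lt
      (Finset.sum_lt_sum_of_nonempty Finset.univ_nonempty fun y _ => h y)
  rw [h1] at h2
  simp [abs_mul] at h2

/-- A set of points that is determined by the coordinates in `e`. -/
def DepOn {k : ℕ} {X : Type*} (e : Finset (Fin k)) (A : Set (Fin k → X)) : Prop :=
  ∀ x y, (∀ i ∈ e, x i = y i) → (x ∈ A ↔ y ∈ A)

/-- The sequence of `k`-th powers of a sequence of types. -/
abbrev Pow (k : ℕ) (V : ℕ → Type) : ℕ → Type := fun n => Fin k → V n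

/-- The algebra of internal sets determined by the coordinates in `e`. -/
def alg {k : ℕ} (V : ℕ → Type) (e : Finset (Fin k)) : Set (Set (Seq (Pow k V))) :=
  {S | ∃ A : ∀ n, Set (Pow k V n), (∀ n, DepOn e (A n)) ∧ S = intSet A}

/-- The `σ`-algebra generated by the internal sets determined by the coordinates in `e`. -/
@[reducible] def sig {k : ℕ} (V : ℕ → Type) (e : Finset (Fin k)) :
    MeasurableSpace (Seq (Pow k V)) :=
  MeasurableSpace.generateFrom (alg V e)

section
variable {k : ℕ} {V : ℕ → Type}

lemma DepOn.mono {X : Type*} {e f : Finset (Fin k)} (h : e ⊆ f) {A : Set (Fin k → X)}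
    (hA : DepOn e A) : DepOn f A := fun x y hxy => hA x y fun i hi => hxy i (h hi)

lemma isSetAlgebra_alg (e : Finset (Fin k)) : IsSetAlgebra (alg V e) where
  empty_mem := ⟨_, fun _ _ _ _ => Iff.rfl, intSet_empty.symm⟩
  compl_mem := by
    rintro _ ⟨A, hA, rfl⟩
    exact ⟨_, fun n x y h => not_congr (hA n x y h), intSet_compl A⟩
  union_mem := by
    rintro _ _ ⟨A, hA, rfl⟩ ⟨B, hB, rfl⟩
    exact ⟨_, fun n x y h => or_congr (hA n x y h) (hB n x y h), intSet_union A B⟩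

lemma alg_mono {e f : Finset (Fin k)} (h : e ⊆ f) : alg V e ⊆ alg V f := by
  rintro _ ⟨A, hA, rfl⟩
  exact ⟨A, fun n => (hA n).mono h, rfl⟩

lemma sig_mono {e f : Finset (Fin k)} (h : e ⊆ f) : sig V e ≤ sig V f :=
  MeasurableSpace.generateFrom_mono (alg_mono h)

lemma sig_le (e : Finset (Fin k)) : sig V e ≤ instMeasurableSpaceSeq (Pow k V) :=
  MeasurableSpace.generateFrom_mono (by rintro _ ⟨A, -, rfl⟩; exact ⟨A, rfl⟩)

lemma iSup_sig_le (𝒢 : Set (Finset (Fin k))) (φ : Finset (Fin k) → Finset (Fin k)) :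
    ⨆ I ∈ 𝒢, sig V (φ I) ≤ instMeasurableSpaceSeq (Pow k V) :=
  iSup₂_le fun _ _ => sig_le _

lemma iSup_sig_eq (𝒢 : Set (Finset (Fin k))) :
    ⨆ I ∈ 𝒢, sig V I = MeasurableSpace.generateFrom (piiUnionInter (alg V) 𝒢) := by
  refine le_antisymm (iSup₂_le fun I hI => le_generateFrom_piiUnionInter 𝒢 hI) ?_
  refine MeasurableSpace.generateFrom_le ?_
  rintro _ ⟨t, ht, f, hf, rfl⟩
  refine @Finset.measurableSet_biInter _ _ (⨆ I ∈ 𝒢, sig V I) _ _ fun I hI => ?_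
  exact (le_iSup₂_of_le I (ht hI) le_rfl : sig V I ≤ ⨆ I ∈ 𝒢, sig V I) _
    (MeasurableSpace.measurableSet_generateFrom (hf I hI))

variable [∀ n, Fintype (V n)] [∀ n, Nonempty (V n)]

/-- `g` is an integrable limit of internal functions depending on the coordinates in `e`. -/
def IsInternalLimit (e : Finset (Fin k)) (g : Seq (Pow k V) → ℝ) : Prop :=
  StronglyMeasurable[sig V e] g ∧ Integrable g (loeb (Pow k V)) ∧
  ∃ G : ∀ n, Pow k V n → ℝ, (∀ n x y, (∀ i ∈ e, x i = y i) → G n x = G n y) ∧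
    ∀ A : ∀ n, Set (Pow k V n),
      Tendsto (fun n => (∑ x, (A n).indicator (G n) x) / (Fintype.card (Pow k V n) : ℝ))
        (hyperfilter ℕ : Filter ℕ) (𝓝 (∫ ω in intSet A, g ω ∂(loeb (Pow k V))))

lemma IsInternalLimit.add {e : Finset (Fin k)} {f g : Seq (Pow k V) → ℝ}
    (hf : IsInternalLimit e f) (hg : IsInternalLimit e g) : IsInternalLimit e (f + g) := by
  obtain ⟨hf1, hf2, F, hF, hF'⟩ := hf
  obtain ⟨hg1, hg2, G, hG, hG'⟩ := hg
  refine ⟨hf1.add hg1, hf2.add hg2, fun n => F n + G n, fun n x y h => ?_, fun A => ?_⟩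
  · simp [hF n x y h, hG n x y h]
  · simp only [Pi.add_apply]
    rw [integral_add hf2.integrableOn hg2.integrableOn]
    refine ((hF' A).add (hG' A)).congr fun n => ?_
    rw [← add_div, ← Finset.sum_add_distrib]
    simp only [indicator_add, Pi.add_def]

lemma isInternalLimit_indicator {e : Finset (Fin k)} {S : Set (Seq (Pow k V))}
    (hS : S ∈ alg V e) (c : ℝ) : IsInternalLimit e (S.indicator fun _ => c) := by
  classical
  have hm : MeasurableSet[sig V e] S := MeasurableSpace.measurableSet_generateFrom hS
  obtain ⟨C, hC, rfl⟩ := hS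
  refine ⟨stronglyMeasurable_const.indicator hm,
    (integrable_const c).indicator (measurableSet_intSet C),
    fun n => (C n).indicator fun _ => c, fun n x y h => ?_, fun A => ?_⟩
  · simp only [indicator, hC n x y h]
  · rw [setIntegral_indicator (measurableSet_intSet C), setIntegral_const, smul_eq_mul,
      intSet_inter]
    refine ((tendsto_loeb_real (fun n => A n ∩ C n)).mul_const c).congr fun n => ?_
    rw [div_mul_eq_mul_div]
    congr 1
    simp only [indicator_indicator]
    rw [Finset.sum_indicator_eq_sum_filter, Finset.sum_const, nsmul_eq_mul]
    congr 2
    rw [ncard_eq_toFinset_card']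
    congr 1
    ext x; simp

lemma exists_isInternalLimit {e : Finset (Fin k)} {g : Seq (Pow k V) → ℝ}
    (hg : StronglyMeasurable[sig V e] g) (hgi : Integrable g (loeb (Pow k V)))
    {ε : ℝ} (hε : 0 < ε) :
    ∃ g', IsInternalLimit e g' ∧ ∫ ω, |g ω - g' ω| ∂(loeb (Pow k V)) ≤ ε := by
  set μ := loeb (Pow k V)
  have hle := sig_le (V := V) e
  have := @MemLp.induction_dense _ ℝ (sig V e) _ 1 (μ.trim hle) ENNReal.one_ne_top
    (IsInternalLimit e) ?_ (fun f g => IsInternalLimit.add)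
    (fun f hf => hf.1.aestronglyMeasurable) g
    (memLp_one_iff_integrable.2 (hgi.trim hle hg)) (ENNReal.ofReal ε) (by simpa using hε)
  · obtain ⟨g', h1, h2⟩ := this
    refine ⟨g', h2, ?_⟩
    rw [eLpNorm_trim hle (hg.sub h2.1), eLpNorm_one_eq_lintegral_enorm] at h1
    have h3 : ∫ ω, |g ω - g' ω| ∂μ = (∫⁻ ω, ‖(g - g') ω‖ₑ ∂μ).toReal :=
      integral_norm_eq_lintegral_enorm (hgi.sub h2.2.1).aestronglyMeasurable
    rw [h3]
    exact ENNReal.toReal_le_of_le_ofReal hε.le h1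
  · intro c s hs _ δ hδ
    rcases eq_or_ne δ ⊤ with rfl | hδt
    · exact ⟨_, le_top, isInternalLimit_indicator (isSetAlgebra_alg e).empty_mem 0⟩
    have hδ' : 0 < δ.toReal := ENNReal.toReal_pos hδ hδt
    obtain ⟨t, ht, hst⟩ := exists_measure_symmDiff_lt μ (isSetAlgebra_alg e) hle hs
      (ε := δ.toReal / (|c| + 1)) (by positivity)
    refine ⟨_, ?_, isInternalLimit_indicator ht c⟩
    have htm : MeasurableSet[sig V e] t := MeasurableSpace.measurableSet_generateFrom ht
    rw [eLpNorm_indicator_sub_indicator]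
    refine (eLpNorm_indicator_const_le c 1).trans ?_
    rw [trim_measurableSet_eq hle (@MeasurableSet.symmDiff _ (sig V e) _ _ htm hs), symmDiff_comm]
    simp only [ENNReal.toReal_one, div_one, ENNReal.rpow_one]
    calc ‖c‖ₑ * μ (s ∆ t) ≤ ENNReal.ofReal |c| * ENNReal.ofReal (δ.toReal / (|c| + 1)) := by
          rw [Real.enorm_eq_ofReal_abs]; gcongr
      _ = ENNReal.ofReal (|c| * (δ.toReal / (|c| + 1))) := (ENNReal.ofReal_mul (abs_nonneg c)).symm
      _ ≤ ENNReal.ofReal δ.toReal := by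
          apply ENNReal.ofReal_le_ofReal
          rw [mul_div_assoc', div_le_iff₀ (by positivity)]
          nlinarith [abs_nonneg c]
      _ = δ := ENNReal.ofReal_toReal hδt

lemma setIntegral_eq_zero_of_forall_slice {e : Finset (Fin k)} {𝒢 : Set (Finset (Fin k))}
    {g : Seq (Pow k V) → ℝ} (hg : StronglyMeasurable[sig V e] g)
    (hgi : Integrable g (loeb (Pow k V)))
    (h0 : ∀ r, MeasurableSet[⨆ I ∈ 𝒢, sig V (I ∩ e)] r → ∫ ω in r, g ω ∂(loeb (Pow k V)) = 0)
    {s : Set (Seq (Pow k V))} (hs : s ∈ piiUnionInter (alg V) 𝒢) :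
    ∫ ω in s, g ω ∂(loeb (Pow k V)) = 0 := by
  set μ := loeb (Pow k V)
  obtain ⟨t, ht, f, hf, rfl⟩ := hs
  have : ∀ I, ∃ A : ∀ n, Set (Pow k V n), I ∈ t → (∀ n, DepOn I (A n)) ∧ f I = intSet A := by
    intro I
    by_cases hI : I ∈ t
    · obtain ⟨A, hA⟩ := hf I hI
      exact ⟨A, fun _ => hA⟩
    · exact ⟨fun _ => ∅, fun h => absurd h hI⟩
  choose A hA using this
  have hsA : ⋂ I ∈ t, f I = intSet (fun n => ⋂ I ∈ t, A I n) := by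
    rw [← intSet_biInter]
    exact iInter₂_congr fun I hI => (hA I hI).2
  rw [hsA, ← abs_nonpos_iff]
  refine le_of_forall_pos_le_add fun ε hε => ?_
  obtain ⟨g', ⟨hg'm, hg'i, G, hG, hlim⟩, hgg'⟩ := exists_isInternalLimit hg hgi (half_pos hε)
  have hdiff : ∀ r, |∫ ω in r, g ω ∂μ - ∫ ω in r, g' ω ∂μ| ≤ ε / 2 := by
    intro r
    rw [← integral_sub hgi.integrableOn hg'i.integrableOn]
    refine (abs_integral_le_integral_abs).trans (le_trans ?_ hgg')
    exact setIntegral_le_integral (hgi.sub hg'i).abs (Eventually.of_forall fun _ => abs_nonneg _)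
  choose y hy using fun n => exists_abs_sum_le_abs_sum_mix e
    (fun x => (⋂ I ∈ t, A I n).indicator (G n) x)
  let A' : Finset (Fin k) → ∀ n, Set (Pow k V n) := fun I n => {x | mix e x (y n) ∈ A I n}
  have hA' : ∀ I ∈ t, intSet (A' I) ∈ alg V (I ∩ e) := by
    intro I hI
    refine ⟨A' I, fun n x z hxz => (hA I hI).1 n _ _ fun i hi => ?_, rfl⟩
    simp only [mix]
    split_ifs with hie
    · exact hxz i (Finset.mem_inter.2 ⟨hi, hie⟩)
    · rfl
  have hr : MeasurableSet[⨆ I ∈ 𝒢, sig V (I ∩ e)] (intSet (fun n => ⋂ I ∈ t, A' I n)) := by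
    rw [← intSet_biInter]
    refine @Finset.measurableSet_biInter _ _ (⨆ I ∈ 𝒢, sig V (I ∩ e)) _ _ fun I hI => ?_
    exact (le_iSup₂_of_le I (ht hI) le_rfl : sig V (I ∩ e) ≤ ⨆ I ∈ 𝒢, sig V (I ∩ e)) _
      (MeasurableSpace.measurableSet_generateFrom (hA' I hI))
  have hcmp : |∫ ω in intSet (fun n => ⋂ I ∈ t, A I n), g' ω ∂μ| ≤
      |∫ ω in intSet (fun n => ⋂ I ∈ t, A' I n), g' ω ∂μ| := by
    refine le_of_tendsto_of_tendsto (hlim _).abs (hlim _).abs (Eventually.of_forall fun n => ?_)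
    beta_reduce
    rw [abs_div, abs_div]
    refine div_le_div_of_nonneg_right ((hy n).trans_eq ?_) (abs_nonneg _)
    congr 1
    refine Finset.sum_congr rfl fun x _ => ?_
    have hGx : G n (mix e x (y n)) = G n x := hG n _ _ fun i hi => by simp [mix, hi]
    have hmem : mix e x (y n) ∈ ⋂ I ∈ t, A I n ↔ x ∈ ⋂ I ∈ t, A' I n := by
      simp only [mem_iInter, A', mem_ofPred_eq]
    by_cases hx : x ∈ ⋂ I ∈ t, A' I n
    · rw [indicator_of_mem (hmem.2 hx), indicator_of_mem hx, hGx]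
    · rw [indicator_of_notMem (mt hmem.1 hx), indicator_of_notMem hx]
  have h1 := hdiff (intSet fun n => ⋂ I ∈ t, A I n)
  have h2 := hdiff (intSet fun n => ⋂ I ∈ t, A' I n)
  rw [h0 _ hr] at h2
  rw [zero_sub, abs_neg] at h2
  have h3 := abs_sub_abs_le_abs_sub (∫ ω in intSet (fun n => ⋂ I ∈ t, A I n), g ω ∂μ)
    (∫ ω in intSet (fun n => ⋂ I ∈ t, A I n), g' ω ∂μ)
  linarith

/-- Conditioning an event of `sig V e` on the sets in `𝒢` is the same as conditioning it on their
traces on `e`. -/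
theorem condExp_indicator_iSup_sig {e : Finset (Fin k)} (𝒢 : Set (Finset (Fin k)))
    {C : Set (Seq (Pow k V))} (hC : MeasurableSet[sig V e] C) :
    (loeb (Pow k V))[C.indicator (fun _ => (1 : ℝ)) | ⨆ I ∈ 𝒢, sig V I] =ᵐ[loeb (Pow k V)]
      (loeb (Pow k V))[C.indicator (fun _ => (1 : ℝ)) | ⨆ I ∈ 𝒢, sig V (I ∩ e)] := by
  set μ := loeb (Pow k V)
  set f : Seq (Pow k V) → ℝ := C.indicator (fun _ => (1 : ℝ)) with hf
  set m' := ⨆ I ∈ 𝒢, sig V (I ∩ e) with hm'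
  have hle : ⨆ I ∈ 𝒢, sig V I ≤ instMeasurableSpaceSeq (Pow k V) := iSup_sig_le 𝒢 id
  have hle' : m' ≤ instMeasurableSpaceSeq (Pow k V) := iSup_sig_le 𝒢 (· ∩ e)
  have hm'e : m' ≤ sig V e := iSup₂_le fun I _ => sig_mono Finset.inter_subset_right
  have hm'G : m' ≤ ⨆ I ∈ 𝒢, sig V I :=
    iSup₂_mono fun I _ => sig_mono Finset.inter_subset_left
  have hfi : Integrable f μ := (integrable_const 1).indicator (sig_le e _ hC)
  have hfm : StronglyMeasurable[sig V e] f := stronglyMeasurable_const.indicator hC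
  have hgi : Integrable (fun ω => μ[f | m'] ω - f ω) μ := integrable_condExp.sub hfi
  have hgm : StronglyMeasurable[sig V e] (fun ω => μ[f | m'] ω - f ω) :=
    (stronglyMeasurable_condExp.mono hm'e).sub hfm
  have h0 : ∀ r, MeasurableSet[m'] r → ∫ ω in r, (μ[f | m'] ω - f ω) ∂μ = 0 := by
    intro r hr
    rw [integral_sub integrable_condExp.integrableOn hfi.integrableOn,
      setIntegral_condExp hle' hfi hr, sub_self]
  have hzero : ∀ s, MeasurableSet[⨆ I ∈ 𝒢, sig V I] s →
      ∫ ω in s, (μ[f | m'] ω - f ω) ∂μ = 0 := by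
    refine MeasurableSpace.induction_on_inter (iSup_sig_eq 𝒢)
      (isPiSystem_piiUnionInter _ (fun I s hs t ht _ => (isSetAlgebra_alg I).inter_mem hs ht) _)
      (by simp) (fun t ht => setIntegral_eq_zero_of_forall_slice hgm hgi h0 ht) ?_ ?_
    · intro t ht hF0
      have h1 := integral_add_compl (hle _ ht) hgi
      have h2 := h0 univ MeasurableSet.univ
      rw [setIntegral_univ] at h2
      linarith
    · intro F hF hFm hF0
      rw [integral_iUnion (fun i => hle _ (hFm i)) hF hgi.integrableOn]
      simp [hF0]
  refine (ae_eq_condExp_of_forall_setIntegral_eq hle hfi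
    (fun s _ _ => integrable_condExp.integrableOn) (fun s hs _ => ?_)
    (stronglyMeasurable_condExp.mono hm'G).aestronglyMeasurable).symm
  have := hzero s hs
  rwa [integral_sub integrable_condExp.integrableOn hfi.integrableOn, sub_eq_zero] at this

end

section
variable {Ω : Type*} {m m' mΩ : MeasurableSpace Ω} {μ : Measure Ω}

/-- The conditional probability of an event given a `σ`-algebra. -/
noncomputable abbrev condProb (μ : Measure Ω) (m : MeasurableSpace Ω) (S : Set Ω) : Ω → ℝ :=
  μ[S.indicator (fun _ => (1 : ℝ)) | m]

variable [IsFiniteMeasure μ]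

lemma integrable_indicator_one {S : Set Ω} (hS : MeasurableSet S) :
    Integrable (S.indicator fun _ => (1 : ℝ)) μ := (integrable_const 1).indicator hS

lemma setIntegral_condProb (hm : m ≤ mΩ) {S W : Set Ω}
    (hS : MeasurableSet S) (hW : MeasurableSet[m] W) :
    ∫ ω in W, condProb μ m S ω ∂μ = μ.real (W ∩ S) := by
  rw [setIntegral_condExp hm (integrable_indicator_one hS) hW, setIntegral_indicator hS,
    setIntegral_const, smul_eq_mul, mul_one]

lemma condProb_mono {S T : Set Ω} (hS : MeasurableSet S)
    (hT : MeasurableSet T) (h : S ⊆ T) : condProb μ m S ≤ᵐ[μ] condProb μ m T :=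
  condExp_mono (integrable_indicator_one hS) (integrable_indicator_one hT)
    (Eventually.of_forall (indicator_le_indicator_of_subset h fun _ => zero_le_one))

omit [IsFiniteMeasure μ] in
lemma condProb_nonneg {S : Set Ω} : 0 ≤ᵐ[μ] condProb μ m S :=
  condExp_nonneg (Eventually.of_forall (indicator_nonneg fun _ _ => zero_le_one))

lemma condProb_inter_of_measurableSet {X C : Set Ω}
    (hX : MeasurableSet X) (hm : m ≤ mΩ) (hC : MeasurableSet[m] C) :
    condProb μ m (X ∩ C) =ᵐ[μ] condProb μ m X * condProb μ m C := by
  have h1 : condProb μ m C = C.indicator fun _ => (1 : ℝ) :=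
    condExp_of_stronglyMeasurable hm (stronglyMeasurable_const.indicator hC)
      (integrable_indicator_one (hm _ hC))
  have h2 : (X ∩ C).indicator (fun _ => (1 : ℝ)) = X.indicator (fun _ => (1 : ℝ)) *
      C.indicator fun _ => (1 : ℝ) := by
    ext ω
    by_cases h : ω ∈ X <;> by_cases h' : ω ∈ C <;> simp [h, h']
  rw [h1]
  simp only [condProb, h2]
  refine condExp_mul_of_stronglyMeasurable_right (stronglyMeasurable_const.indicator hC) ?_
    (integrable_indicator_one hX)
  rw [← h2]
  exact integrable_indicator_one (hX.inter (hm _ hC))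

/-- If conditioning `C` on `m` or on the larger `m'` is the same, then `C` is independent of `m'`
conditionally on `m`. -/
lemma condProb_inter_of_condProb_eq (hmm : m ≤ m') (hm' : m' ≤ mΩ)
    {X C : Set Ω} (hX : MeasurableSet[m'] X) (hC : MeasurableSet C)
    (h : condProb μ m' C =ᵐ[μ] condProb μ m C) :
    condProb μ m (X ∩ C) =ᵐ[μ] condProb μ m X * condProb μ m C := by
  have h2 : (X ∩ C).indicator (fun _ => (1 : ℝ)) = X.indicator (fun _ => (1 : ℝ)) *
      C.indicator fun _ => (1 : ℝ) := by
    ext ω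
    by_cases h : ω ∈ X <;> by_cases h' : ω ∈ C <;> simp [h, h']
  have h3 : condProb μ m' (X ∩ C) =ᵐ[μ] X.indicator (fun _ => (1 : ℝ)) * condProb μ m C := by
    refine EventuallyEq.trans ?_ (EventuallyEq.rfl.mul h)
    simp only [condProb, h2]
    refine condExp_mul_of_stronglyMeasurable_left (stronglyMeasurable_const.indicator hX) ?_
      (integrable_indicator_one hC)
    rw [← h2]
    exact integrable_indicator_one ((hm' _ hX).inter hC)
  have h4 : X.indicator (fun _ => (1 : ℝ)) * condProb μ m C = X.indicator (condProb μ m C) := by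
    ext ω
    by_cases hω : ω ∈ X <;> simp [hω]
  calc condProb μ m (X ∩ C) =ᵐ[μ] μ[condProb μ m' (X ∩ C) | m] :=
        (condExp_condExp_of_le hmm hm').symm
    _ =ᵐ[μ] μ[X.indicator (fun _ => (1 : ℝ)) * condProb μ m C | m] := condExp_congr_ae h3
    _ =ᵐ[μ] condProb μ m X * condProb μ m C := by
        refine condExp_mul_of_stronglyMeasurable_right stronglyMeasurable_condExp ?_
          (integrable_indicator_one (hm' _ hX))
        rw [h4]
        exact integrable_condExp.indicator (hm' _ hX)

/-- The region where the event `S` is conditionally negligible compared to the event `D`. -/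
def goodSet (μ : Measure Ω) (m : MeasurableSpace Ω) (κ : ℝ) (D S : Set Ω) : Set Ω :=
  {ω | condProb μ m S ω ≤ κ * condProb μ m D ω} ∩ {ω | 0 < condProb μ m D ω}

omit [IsFiniteMeasure μ] in
lemma measurableSet_goodSet {κ : ℝ} {D S : Set Ω} :
    MeasurableSet[m] (goodSet μ m κ D S) := by
  have hD : Measurable[m] (condProb μ m D) := stronglyMeasurable_condExp.measurable
  have hS : Measurable[m] (condProb μ m S) := stronglyMeasurable_condExp.measurable
  exact (@measurableSet_le _ _ _ _ _ m _ _ _ _ _ hS (hD.const_mul κ)).inter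
    (@measurableSet_lt _ _ _ _ _ m _ _ _ _ _ measurable_const hD)

lemma mul_measureReal_diff_goodSet_le (hm : m ≤ mΩ) {κ : ℝ} (hκ : 0 < κ)
    {D S : Set Ω} (hD : MeasurableSet D) (hS : MeasurableSet S) :
    κ * μ.real (D \ goodSet μ m κ D S) ≤ μ.real S := by
  have hDm : Measurable[m] (condProb μ m D) := stronglyMeasurable_condExp.measurable
  have hSm : Measurable[m] (condProb μ m S) := stronglyMeasurable_condExp.measurable
  set A : Set Ω := {ω | κ * condProb μ m D ω < condProb μ m S ω} with hA
  set B : Set Ω := {ω | condProb μ m D ω ≤ 0} with hB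
  have hAm : MeasurableSet[m] A := @measurableSet_lt _ _ _ _ _ m _ _ _ _ _ (hDm.const_mul κ) hSm
  have hBm : MeasurableSet[m] B := @measurableSet_le _ _ _ _ _ m _ _ _ _ _ hDm measurable_const
  have h1 : D \ goodSet μ m κ D S ⊆ (A ∩ D) ∪ (B ∩ D) := by
    rintro ω ⟨h1, h2⟩
    simp only [goodSet, mem_inter_iff, mem_ofPred_eq, not_and_or, not_le, not_lt] at h2
    exact h2.imp (fun h => ⟨h, h1⟩) fun h => ⟨h, h1⟩
  have h2 : μ.real (B ∩ D) ≤ 0 := by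
    rw [← setIntegral_condProb hm hD hBm]
    exact setIntegral_nonpos (hm _ hBm) fun ω hω => hω
  have h3 : κ * μ.real (A ∩ D) ≤ μ.real (A ∩ S) := by
    rw [← setIntegral_condProb hm hD hAm, ← setIntegral_condProb hm hS hAm, ← integral_const_mul]
    exact setIntegral_mono_on (integrable_condExp.const_mul κ).integrableOn
      integrable_condExp.integrableOn (hm _ hAm) fun ω hω => le_of_lt hω
  have h4 := (measureReal_mono h1).trans (measureReal_union_le (μ := μ) _ _)
  have h5 : μ.real (A ∩ S) ≤ μ.real S := measureReal_mono inter_subset_right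
  nlinarith

lemma measure_eq_zero_of_condProb_le (hm : m ≤ mΩ) {ι : Type*}
    {L : Finset ι} {κ : ℝ} (hκ : κ * L.card < 1) {W D : Set Ω} {H : ι → Set Ω}
    (hW : MeasurableSet[m] W) (hD : MeasurableSet D) (hH : ∀ e ∈ L, MeasurableSet (H e))
    (h0 : μ (⋂ e ∈ L, H e) = 0)
    (hle : ∀ e ∈ L, ∀ᵐ ω ∂μ, ω ∈ W → condProb μ m (D \ H e) ω ≤ κ * condProb μ m D ω)
    (hpos : ∀ᵐ ω ∂μ, ω ∈ W → 0 < condProb μ m D ω) : μ W = 0 := by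
  have h1 : W ∩ D ⊆ (⋂ e ∈ L, H e) ∪ ⋃ e ∈ L, (W ∩ (D \ H e)) := by
    rintro ω ⟨hw, hd⟩
    by_cases h : ω ∈ ⋂ e ∈ L, H e
    · exact Or.inl h
    · right
      simp only [mem_iInter, not_forall] at h
      obtain ⟨e, he, h⟩ := h
      exact mem_biUnion he ⟨hw, hd, h⟩
  have h2 : μ.real (W ∩ D) ≤ ∑ e ∈ L, μ.real (W ∩ (D \ H e)) := by
    refine (measureReal_mono h1).trans ((measureReal_union_le _ _).trans ?_)
    rw [measureReal_def, h0, ENNReal.toReal_zero, zero_add]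
    exact measureReal_biUnion_finset_le _ _
  have h3 : ∀ e ∈ L, μ.real (W ∩ (D \ H e)) ≤ κ * μ.real (W ∩ D) := by
    intro e he
    rw [← setIntegral_condProb hm hD hW, ← setIntegral_condProb hm (hD.diff (hH e he)) hW,
      ← integral_const_mul]
    exact setIntegral_mono_on_ae integrable_condExp.integrableOn
      (integrable_condExp.const_mul κ).integrableOn (hm _ hW) (hle e he)
  have h4 : μ.real (W ∩ D) ≤ L.card * (κ * μ.real (W ∩ D)) := by
    rw [← nsmul_eq_mul, ← Finset.sum_const]
    exact h2.trans (Finset.sum_le_sum h3)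
  have h5 : μ.real (W ∩ D) = 0 := by
    have : 0 ≤ μ.real (W ∩ D) := measureReal_nonneg
    nlinarith
  rw [← setIntegral_condProb hm hD hW, integral_eq_zero_iff_of_nonneg_ae
    (ae_restrict_of_ae condProb_nonneg) integrable_condExp.integrableOn] at h5
  rw [← Measure.restrict_eq_zero, ← ae_eq_bot, ← eventually_false_iff_eq_bot]
  filter_upwards [h5, (ae_restrict_iff' (hm _ hW)).2 hpos] with ω h h'
  simp [h] at h'

end

section
variable {k : ℕ} {V : ℕ → Type} [∀ n, Fintype (V n)] [∀ n, Nonempty (V n)]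

/-- The `σ`-algebra generated by the internal sets determined by fewer than `j` coordinates
in `e`. -/
@[reducible] def low (V : ℕ → Type) (j : ℕ) (e : Finset (Fin k)) :
    MeasurableSpace (Seq (Pow k V)) :=
  ⨆ I ∈ {I : Finset (Fin k) | I.card < j}, sig V (I ∩ e)

/-- The `σ`-algebra generated by the internal sets determined by fewer than `j` coordinates. -/
@[reducible] def skel (k : ℕ) (V : ℕ → Type) (j : ℕ) : MeasurableSpace (Seq (Pow k V)) :=
  ⨆ I ∈ {I : Finset (Fin k) | I.card < j}, sig V I

omit [∀ n, Fintype (V n)] [∀ n, Nonempty (V n)] in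
lemma skel_le (j : ℕ) : skel k V j ≤ instMeasurableSpaceSeq (Pow k V) := iSup_sig_le _ id

end

section
variable {k : ℕ} {V : ℕ → Type}

lemma low_le_skel (j : ℕ) (e : Finset (Fin k)) : low V j e ≤ skel k V j :=
  iSup₂_mono fun _ _ => sig_mono Finset.inter_subset_left

lemma low_le (j : ℕ) (e : Finset (Fin k)) : low V j e ≤ instMeasurableSpaceSeq (Pow k V) :=
  (low_le_skel j e).trans (skel_le j)

lemma low_zero (e : Finset (Fin k)) : low V 0 e = ⊥ := by simp [low]

lemma sig_le_low {j : ℕ} {e : Finset (Fin k)} (h : e.card < j) : sig V e ≤ low V j e := by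
  refine le_trans ?_ (le_iSup₂_of_le e h le_rfl)
  rw [Finset.inter_self]

/-- A set is adapted if it is a union of cells of finite partitions into internal sets determined
by at most `j` coordinates in `e`. -/
def Adapted (j : ℕ) (e : Finset (Fin k)) (U : Set (Seq (Pow k V))) : Prop :=
  ∃ (ι : Type) (_ : Fintype ι) (ψ : Finset (Fin k) → Seq (Pow k V) → ι),
    (∀ f i, ψ f ⁻¹' {i} ∈ alg V f) ∧
    ∀ ω ω', (∀ f, f ⊆ e → f.card ≤ j → ψ f ω = ψ f ω') → (ω ∈ U ↔ ω' ∈ U)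

/-- The part visible in `e` of the cell of colour `c`. -/
def cell {ι : Type} (j : ℕ) (ψ : Finset (Fin k) → Seq (Pow k V) → ι) (e : Finset (Fin k))
    (c : Finset (Fin k) → ι) : Set (Seq (Pow k V)) :=
  ⋂ f ∈ {f : Finset (Fin k) | f ⊆ e ∧ f.card ≤ j}.toFinset, ψ f ⁻¹' {c f}

lemma mem_cell {ι : Type} {j : ℕ} {ψ : Finset (Fin k) → Seq (Pow k V) → ι} {e : Finset (Fin k)}
    {c : Finset (Fin k) → ι} {ω : Seq (Pow k V)} :
    ω ∈ cell j ψ e c ↔ ∀ f, f ⊆ e → f.card ≤ j → ψ f ω = c f := by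
  simp [cell]

lemma cell_mem_alg {ι : Type} {j : ℕ} {ψ : Finset (Fin k) → Seq (Pow k V) → ι}
    (hψ : ∀ f i, ψ f ⁻¹' {i} ∈ alg V f) (e : Finset (Fin k)) (c : Finset (Fin k) → ι) :
    cell j ψ e c ∈ alg V e := by
  refine (isSetAlgebra_alg e).biInter_mem _ fun f hf => ?_
  simp only [mem_toFinset] at hf
  exact alg_mono hf.1 (hψ f _)

lemma Adapted.mem_alg {j : ℕ} {e : Finset (Fin k)} {U : Set (Seq (Pow k V))}
    (h : Adapted j e U) : U ∈ alg V e := by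
  classical
  obtain ⟨ι, _, ψ, hψ, hU⟩ := h
  have : U = ⋃ c ∈ Finset.univ.filter (fun c => (U ∩ cell j ψ e c).Nonempty), cell j ψ e c := by
    ext ω
    simp only [mem_iUnion, Finset.mem_filter, Finset.mem_univ, true_and, exists_prop]
    constructor
    · intro hω
      have : ω ∈ cell j ψ e (fun f => ψ f ω) := mem_cell.2 fun _ _ _ => rfl
      exact ⟨_, ⟨ω, hω, this⟩, this⟩
    · rintro ⟨c, ⟨ω', h1, h2⟩, h3⟩
      rw [mem_cell] at h2 h3
      exact (hU ω ω' fun f hf hj => (h3 f hf hj).trans (h2 f hf hj).symm).2 h1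
  rw [this]
  exact (isSetAlgebra_alg e).biUnion_mem _ fun c _ => cell_mem_alg hψ e c

lemma isSetAlgebra_adapted (j : ℕ) (e : Finset (Fin k)) :
    IsSetAlgebra {U : Set (Seq (Pow k V)) | Adapted j e U} where
  empty_mem := ⟨Unit, inferInstance, fun _ _ => (), fun f i => by
    convert (isSetAlgebra_alg (V := V) f).univ_mem using 1
    ext; simp, fun _ _ _ => Iff.rfl⟩
  compl_mem := by
    rintro _ ⟨ι, hι, ψ, hψ, hU⟩
    exact ⟨ι, hι, ψ, hψ, fun ω ω' h => not_congr (hU ω ω' h)⟩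
  union_mem := by
    rintro _ _ ⟨ι, hι, ψ, hψ, hU⟩ ⟨ι', hι', ψ', hψ', hU'⟩
    refine ⟨ι × ι', inferInstance, fun f ω => (ψ f ω, ψ' f ω), fun f i => ?_, fun ω ω' h => ?_⟩
    · convert (isSetAlgebra_alg f).inter_mem (hψ f i.1) (hψ' f i.2) using 1
      ext; simp [Prod.ext_iff]
    · exact or_congr (hU ω ω' fun f h1 h2 => congrArg Prod.fst (h f h1 h2))
        (hU' ω ω' fun f h1 h2 => congrArg Prod.snd (h f h1 h2))

lemma adapted_of_mem_alg {j : ℕ} {e f : Finset (Fin k)} {U : Set (Seq (Pow k V))}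
    (hU : U ∈ alg V f) (hfe : f ⊆ e) (hf : f.card ≤ j) : Adapted j e U := by
  classical
  refine ⟨Bool, inferInstance, fun g ω => decide (g = f ∧ ω ∈ U), fun g i => ?_, fun ω ω' h => ?_⟩
  · by_cases hg : g = f
    · subst hg
      cases i
      · convert (isSetAlgebra_alg g).compl_mem hU using 1
        ext; simp
      · convert hU using 1
        ext; simp
    · cases i
      · convert (isSetAlgebra_alg (V := V) g).univ_mem using 1
        ext; simp [hg]
      · convert (isSetAlgebra_alg (V := V) g).empty_mem using 1
        ext; simp [hg]
  · simpa using h f hfe hf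

lemma low_succ_le_generateFrom (j : ℕ) (e : Finset (Fin k)) :
    low V (j + 1) e ≤ MeasurableSpace.generateFrom {U : Set (Seq (Pow k V)) | Adapted j e U} := by
  refine iSup₂_le fun I hI => MeasurableSpace.generateFrom_mono fun U hU => ?_
  exact adapted_of_mem_alg hU Finset.inter_subset_right
    ((Finset.card_le_card Finset.inter_subset_left).trans (Nat.lt_succ_iff.1 hI))

lemma generateFrom_adapted_le (j : ℕ) (e : Finset (Fin k)) :
    MeasurableSpace.generateFrom {U : Set (Seq (Pow k V)) | Adapted j e U} ≤
      instMeasurableSpaceSeq (Pow k V) :=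
  (MeasurableSpace.generateFrom_mono fun _ h => h.mem_alg).trans (sig_le e)

lemma measurableSet_of_mem_alg {e : Finset (Fin k)} {U : Set (Seq (Pow k V))}
    (hU : U ∈ alg V e) : MeasurableSet U :=
  sig_le e _ (MeasurableSpace.measurableSet_generateFrom hU)

variable [∀ n, Fintype (V n)] [∀ n, Nonempty (V n)]

lemma condProb_skel {j : ℕ} {e : Finset (Fin k)} {C : Set (Seq (Pow k V))}
    (hC : MeasurableSet[sig V e] C) :
    condProb (loeb (Pow k V)) (skel k V j) C =ᵐ[loeb (Pow k V)]
      condProb (loeb (Pow k V)) (low V j e) C := condExp_indicator_iSup_sig _ hC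

lemma condProb_inter {j : ℕ} {f : Finset (Fin k)} (hf : f.card ≤ j)
    {X C : Set (Seq (Pow k V))} (hC : MeasurableSet[sig V f] C) (hX : MeasurableSet X)
    (hXf : f.card = j → MeasurableSet[⨆ I ∈ {I : Finset (Fin k) | ¬ f ⊆ I}, sig V I] X) :
    condProb (loeb (Pow k V)) (skel k V j) (X ∩ C) =ᵐ[loeb (Pow k V)]
      condProb (loeb (Pow k V)) (skel k V j) X * condProb (loeb (Pow k V)) (skel k V j) C := by
  rcases hf.lt_or_eq with h | h
  · exact condProb_inter_of_measurableSet hX (skel_le j)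
      ((le_iSup₂_of_le f h le_rfl : sig V f ≤ skel k V j) _ hC)
  · have hsub : ∀ I : Finset (Fin k), I.card < j → ¬ f ⊆ I := fun I hI hfI =>
      (Finset.card_le_card hfI).not_gt (h ▸ hI)
    refine condProb_inter_of_condProb_eq (biSup_mono hsub)
      (iSup_sig_le {I : Finset (Fin k) | ¬ f ⊆ I} id) (hXf h)
      (sig_le f _ hC) ?_
    refine (condExp_indicator_iSup_sig {I : Finset (Fin k) | ¬ f ⊆ I} hC).trans
      (EventuallyEq.trans ?_ (condProb_skel hC).symm)
    have : ⨆ I ∈ {I : Finset (Fin k) | ¬ f ⊆ I}, sig V (I ∩ f) = low V j f := by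
      refine le_antisymm (iSup₂_le fun I hI => ?_) (biSup_mono hsub)
      refine le_iSup₂_of_le (I ∩ f) ?_ (by rw [Finset.inter_assoc, Finset.inter_self])
      refine (Finset.card_lt_card
        (Finset.inter_subset_right.ssubset_of_ne fun h' => hI ?_)).trans_eq h
      exact Finset.inter_eq_right.1 h'
    rw [this]

/-- Sets determined by distinct `j`-element sets of coordinates are conditionally independent
given what is determined by fewer coordinates. -/
lemma condProb_inter_biInter {j : ℕ} (F : Finset (Finset (Fin k))) (hF : ∀ f ∈ F, f.card ≤ j)
    {C : Finset (Fin k) → Set (Seq (Pow k V))} (hC : ∀ f ∈ F, MeasurableSet[sig V f] (C f))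
    {e : Finset (Fin k)} {R : Set (Seq (Pow k V))} (hR : MeasurableSet[sig V e] R)
    (hRF : ∀ f ∈ F, ¬ f ⊆ e) :
    condProb (loeb (Pow k V)) (skel k V j) (R ∩ ⋂ f ∈ F, C f) =ᵐ[loeb (Pow k V)]
      condProb (loeb (Pow k V)) (skel k V j) R *
        ∏ f ∈ F, condProb (loeb (Pow k V)) (skel k V j) (C f) := by
  classical
  induction F using Finset.induction_on with
  | empty => simp
  | insert f F hfF ih =>
    have hF' : ∀ g ∈ F, g.card ≤ j := fun g hg => hF g (Finset.mem_insert_of_mem hg)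
    have hC' : ∀ g ∈ F, MeasurableSet[sig V g] (C g) := fun g hg =>
      hC g (Finset.mem_insert_of_mem hg)
    have ih := ih hF' hC' fun g hg => hRF g (Finset.mem_insert_of_mem hg)
    have hCf := hC f (Finset.mem_insert_self f F)
    have heq : R ∩ ⋂ g ∈ insert f F, C g = (R ∩ ⋂ g ∈ F, C g) ∩ C f := by
      rw [Finset.set_biInter_insert, inter_comm (C f), inter_assoc]
    rw [heq, Finset.prod_insert hfF, mul_comm (condProb _ _ (C f)), ← mul_assoc]
    refine (condProb_inter (hF f (Finset.mem_insert_self f F)) hCf ?_ fun hfj => ?_).trans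
      (ih.mul EventuallyEq.rfl)
    · exact (sig_le e _ hR).inter (Finset.measurableSet_biInter F fun g hg => sig_le g _ (hC' g hg))
    · refine @MeasurableSet.inter _ (_) _ _ ?_ (@Finset.measurableSet_biInter _ _ (_) _ _ ?_)
      · exact (le_iSup₂_of_le e (hRF f (Finset.mem_insert_self f F)) le_rfl :
          sig V e ≤ ⨆ I ∈ {I : Finset (Fin k) | ¬ f ⊆ I}, sig V I) _ hR
      · intro g hg
        have hfg : ¬ f ⊆ g := fun h => hfF
          (Finset.eq_of_subset_of_card_le h ((hF' g hg).trans_eq hfj.symm) ▸ hg)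
        exact (le_iSup₂_of_le g hfg le_rfl :
          sig V g ≤ ⨆ I ∈ {I : Finset (Fin k) | ¬ f ⊆ I}, sig V I) _ (hC' g hg)

end

section
variable {k : ℕ} {V : ℕ → Type}

lemma low_le_sig (j : ℕ) (e : Finset (Fin k)) : low V j e ≤ sig V e :=
  iSup₂_le fun _ _ => sig_mono Finset.inter_subset_right

lemma measurableSet_cell {ι : Type} {j : ℕ} {ψ : Finset (Fin k) → Seq (Pow k V) → ι}
    (hψ : ∀ f i, ψ f ⁻¹' {i} ∈ alg V f) (e : Finset (Fin k)) (c : Finset (Fin k) → ι) :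
    MeasurableSet[sig V e] (cell j ψ e c) :=
  MeasurableSpace.measurableSet_generateFrom (cell_mem_alg hψ e c)

/-- Finitely many sets that are adapted can be described by a common family of partitions. -/
lemma exists_common_partition {j : ℕ} {U : Finset (Fin k) → Set (Seq (Pow k V))}
    (hU : ∀ e, Adapted j e (U e)) :
    ∃ (ι : Type) (_ : Fintype ι) (ψ : Finset (Fin k) → Seq (Pow k V) → ι),
      (∀ f i, ψ f ⁻¹' {i} ∈ alg V f) ∧
      ∀ e ω ω', (∀ f, f ⊆ e → f.card ≤ j → ψ f ω = ψ f ω') → (ω ∈ U e ↔ ω' ∈ U e) := by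
  classical
  choose ι hι ψ hψ hU using hU
  refine ⟨∀ e, ι e, inferInstance, fun f ω e => ψ e f ω, fun f i => ?_, fun e ω ω' h => ?_⟩
  · convert (isSetAlgebra_alg f).biInter_mem Finset.univ fun e _ => hψ e f (i e) using 1
    ext ω
    simp [funext_iff]
  · exact hU e ω ω' fun f h1 h2 => congrFun (h f h1 h2) e

variable [∀ n, Fintype (V n)] [∀ n, Nonempty (V n)]

lemma measure_biInter_goodSet_eq_zero {ι : Type} {j : ℕ}
    {ψ : Finset (Fin k) → Seq (Pow k V) → ι} (hψ : ∀ f i, ψ f ⁻¹' {i} ∈ alg V f)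
    {L : Finset (Finset (Fin k))} {H : Finset (Fin k) → Set (Seq (Pow k V))}
    (hH : ∀ e ∈ L, MeasurableSet[sig V e] (H e)) (h0 : loeb (Pow k V) (⋂ e ∈ L, H e) = 0)
    {κ : ℝ} (hκ : κ * L.card < 1) (c : Finset (Fin k) → ι) :
    loeb (Pow k V) (⋂ e ∈ L, goodSet (loeb (Pow k V)) (low V j e) κ (cell j ψ e c)
      (cell j ψ e c \ H e)) = 0 := by
  classical
  set μ := loeb (Pow k V) with hμ
  set F : Finset (Finset (Fin k)) :=
    Finset.univ.filter fun f => f.card ≤ j ∧ ∃ e ∈ L, f ⊆ e with hF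
  set C : Finset (Fin k) → Set (Seq (Pow k V)) := fun f => ψ f ⁻¹' {c f} with hC
  have hCm : ∀ f, MeasurableSet[sig V f] (C f) := fun f =>
    MeasurableSpace.measurableSet_generateFrom (hψ f _)
  set D : Set (Seq (Pow k V)) := ⋂ f ∈ F, C f with hD
  have hDm : MeasurableSet D := Finset.measurableSet_biInter _ fun f _ => sig_le f _ (hCm f)
  let q : Finset (Fin k) → Seq (Pow k V) → ℝ := fun e =>
    ∏ f ∈ F.filter (fun f => ¬ f ⊆ e), condProb μ (skel k V j) (C f)
  have hDe : ∀ e ∈ L, D = cell j ψ e c ∩ ⋂ f ∈ F.filter (fun f => ¬ f ⊆ e), C f := by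
    intro e he
    ext ω
    simp only [hD, hF, mem_iInter, Finset.mem_filter, Finset.mem_univ, true_and, mem_inter_iff,
      mem_cell, hC, mem_preimage, mem_singleton_iff]
    constructor
    · exact fun h => ⟨fun f h1 h2 => h f ⟨h2, e, he, h1⟩, fun f hf => h f hf.1⟩
    · intro h f hf
      by_cases hfe : f ⊆ e
      · exact h.1 f hfe hf.1
      · exact h.2 f ⟨hf, hfe⟩
  have hsplit : ∀ e, ∀ R, MeasurableSet[sig V e] R →
      condProb μ (skel k V j) (R ∩ ⋂ f ∈ F.filter (fun f => ¬ f ⊆ e), C f) =ᵐ[μ]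
        condProb μ (low V j e) R * q e := by
    intro e R hR
    refine (condProb_inter_biInter _ (fun f hf => ?_) (fun f _ => hCm f) hR fun f hf => ?_).trans
      ((condProb_skel hR).mul EventuallyEq.rfl)
    · exact (Finset.mem_filter.1 (Finset.mem_filter.1 hf).1).2.1
    · exact (Finset.mem_filter.1 hf).2
  have hgood : ∀ e ∈ L, ∀ ω, ω ∈ (⋂ e ∈ L, goodSet μ (low V j e) κ (cell j ψ e c)
      (cell j ψ e c \ H e)) → ω ∈ goodSet μ (low V j e) κ (cell j ψ e c) (cell j ψ e c \ H e) :=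
    fun e he ω hω => mem_iInter₂.1 hω e he
  refine measure_eq_zero_of_condProb_le (skel_le j) hκ (D := D) ?_ hDm
    (fun e he => sig_le e _ (hH e he)) h0 (fun e he => ?_) ?_
  · exact @Finset.measurableSet_biInter _ _ (skel k V j) _ _ fun e _ =>
      low_le_skel j e _ measurableSet_goodSet
  · have h1 := hsplit e _ (measurableSet_cell (j := j) hψ e c)
    have h2 := hsplit e _ ((measurableSet_cell (j := j) hψ e c).diff (hH e he))
    rw [← hDe e he] at h1
    rw [sdiff_inter_right_comm, ← hDe e he] at h2
    have h3 : ∀ᵐ ω ∂μ, ∀ f ∈ F.filter (fun f => ¬ f ⊆ e),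
        0 ≤ condProb μ (skel k V j) (C f) ω :=
      (eventually_all_finset _).2 fun f _ => condProb_nonneg
    filter_upwards [h1, h2, h3] with ω h1 h2 h3 hω
    rw [h1, h2, Pi.mul_apply, Pi.mul_apply, ← mul_assoc]
    refine mul_le_mul_of_nonneg_right (hgood e he ω hω).1 ?_
    simp only [q, Finset.prod_apply]
    exact Finset.prod_nonneg h3
  · rcases L.eq_empty_or_nonempty with rfl | ⟨e, he⟩
    · simp at h0
    · have h1 := hsplit e _ (measurableSet_cell (j := j) hψ e c)
      rw [← hDe e he] at h1
      have h3 : ∀ᵐ ω ∂μ, ∀ f ∈ F, ∀ e' ∈ L, f ⊆ e' →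
          condProb μ (low V j e') (cell j ψ e' c) ω ≤ condProb μ (skel k V j) (C f) ω := by
        refine (eventually_all_finset _).2 fun f hf => (eventually_all_finset _).2 fun e' he' => ?_
        rw [eventually_imp_distrib_left]
        intro hfe
        have hsub : cell j ψ e' c ⊆ C f := fun ω hω =>
          mem_cell.1 hω f hfe (Finset.mem_filter.1 hf).2.1
        filter_upwards [condProb_skel (measurableSet_cell (j := j) hψ e' c),
          condProb_mono (μ := μ) (m := skel k V j) (sig_le e' _ (measurableSet_cell hψ e' c))
            (sig_le f _ (hCm f)) hsub] with ω h4 h5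
        rw [← h4]
        exact h5
      filter_upwards [h1, h3] with ω h1 h3 hω
      rw [h1, Pi.mul_apply]
      refine mul_pos (hgood e he ω hω).2 ?_
      simp only [q, Finset.prod_apply]
      refine Finset.prod_pos fun f hf => ?_
      have hf := (Finset.mem_filter.1 hf).1
      obtain ⟨-, e', he', hfe⟩ := (Finset.mem_filter.1 hf).2
      exact (hgood e' he' ω hω).2.trans_le (h3 f hf e' he' hfe)

/-- A null intersection of events at level `j` can be made empty by removing small events. -/
def Removable (V : ℕ → Type) [∀ n, Fintype (V n)] [∀ n, Nonempty (V n)] (j : ℕ)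
    (L : Finset (Finset (Fin k))) : Prop :=
  ∀ H : Finset (Fin k) → Set (Seq (Pow k V)), (∀ e ∈ L, MeasurableSet[low V j e] (H e)) →
    loeb (Pow k V) (⋂ e ∈ L, H e) = 0 → ∀ ε : ℝ, 0 < ε →
      ∃ H' : Finset (Fin k) → Set (Seq (Pow k V)),
        (∀ e ∈ L, H' e ∈ alg V e ∧ (loeb (Pow k V)).real (H e \ H' e) ≤ ε) ∧ ⋂ e ∈ L, H' e = ∅

lemma removable_zero (L : Finset (Finset (Fin k))) : Removable V 0 L := by
  intro H hH h0 ε hε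
  refine ⟨H, fun e he => ⟨?_, by simpa using hε.le⟩, ?_⟩
  · have := hH e he
    rw [low_zero, MeasurableSpace.measurableSet_bot_iff] at this
    rcases this with h | h <;> rw [h]
    exacts [(isSetAlgebra_alg e).empty_mem, (isSetAlgebra_alg e).univ_mem]
  · by_cases h : ∃ e ∈ L, H e = ∅
    · obtain ⟨e, he, h⟩ := h
      exact subset_empty_iff.1 ((biInter_subset_of_mem he).trans h.subset)
    · push Not at h
      have : ⋂ e ∈ L, H e = univ := by
        refine eq_univ_of_forall fun ω => mem_iInter₂.2 fun e he => ?_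
        have h' := hH e he
        rw [low_zero, MeasurableSpace.measurableSet_bot_iff] at h'
        rw [h'.resolve_left (h e he).ne_empty]
        trivial
      rw [this] at h0
      simp at h0

lemma measureReal_biUnion_cell_diff_goodSet_le {ι : Type} [Fintype ι] {j : ℕ}
    {ψ : Finset (Fin k) → Seq (Pow k V) → ι} (hψ : ∀ f i, ψ f ⁻¹' {i} ∈ alg V f)
    {e : Finset (Fin k)} {U H : Set (Seq (Pow k V))}
    (hH : MeasurableSet H) {κ : ℝ} (hκ : 0 < κ) :
    κ * (loeb (Pow k V)).real (⋃ c ∈ {c | cell j ψ e c ⊆ U}, (cell j ψ e c \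
      goodSet (loeb (Pow k V)) (low V j e) κ (cell j ψ e c) (cell j ψ e c \ H))) ≤
      (loeb (Pow k V)).real (U \ H) := by
  classical
  set μ := loeb (Pow k V)
  set S : Finset (Set (Seq (Pow k V))) :=
    (Finset.univ.filter fun c => cell j ψ e c ⊆ U).image (cell j ψ e) with hS
  have hSm : ∀ D ∈ S, MeasurableSet D ∧ D ⊆ U := by
    intro D hD
    obtain ⟨c, hc, rfl⟩ := Finset.mem_image.1 hD
    exact ⟨measurableSet_of_mem_alg (cell_mem_alg hψ e c), (Finset.mem_filter.1 hc).2⟩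
  have hdisj : (S : Set (Set (Seq (Pow k V)))).PairwiseDisjoint (fun D => D \ H) := by
    intro D hD D' hD' hne
    obtain ⟨c, hc, rfl⟩ := Finset.mem_image.1 hD
    obtain ⟨c', hc', rfl⟩ := Finset.mem_image.1 hD'
    refine Set.disjoint_left.2 fun ω h h' => hne ?_
    have h1 := mem_cell.1 h.1
    have h2 := mem_cell.1 h'.1
    ext ω'
    simp only [mem_cell]
    refine forall_congr' fun f => forall_congr' fun hf => forall_congr' fun hj => ?_
    rw [← h1 f hf hj, ← h2 f hf hj]
  calc _ ≤ κ * μ.real (⋃ D ∈ S, (D \ goodSet μ (low V j e) κ D (D \ H))) := by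
        refine mul_le_mul_of_nonneg_left (measureReal_mono ?_ (measure_ne_top _ _)) hκ.le
        refine iUnion₂_subset fun c hc => ?_
        exact subset_biUnion_of_mem (u := fun D => D \ goodSet μ (low V j e) κ D (D \ H))
          (Finset.mem_coe.2 (Finset.mem_image.2 ⟨c,
            Finset.mem_filter.2 ⟨Finset.mem_univ _, hc⟩, rfl⟩))
    _ ≤ κ * ∑ D ∈ S, μ.real (D \ goodSet μ (low V j e) κ D (D \ H)) :=
        mul_le_mul_of_nonneg_left (measureReal_biUnion_finset_le _ _) hκ.le
    _ ≤ ∑ D ∈ S, μ.real (D \ H) := by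
        rw [Finset.mul_sum]
        exact Finset.sum_le_sum fun D hD => mul_measureReal_diff_goodSet_le (low_le j e) hκ
          (hSm D hD).1 ((hSm D hD).1.diff hH)
    _ = μ.real (⋃ D ∈ S, D \ H) :=
        (measureReal_biUnion_finset hdisj fun D hD => (hSm D hD).1.diff hH).symm
    _ ≤ μ.real (U \ H) :=
        measureReal_mono (iUnion₂_subset fun D hD => sdiff_subset_sdiff_left (hSm D hD).2)

lemma Removable.succ {j : ℕ} {L : Finset (Finset (Fin k))} (hj : Removable V j L) :
    Removable V (j + 1) L := by
  classical
  intro H hH h0 ε hε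
  set μ := loeb (Pow k V)
  have hHs : ∀ e ∈ L, MeasurableSet[sig V e] (H e) := fun e he => low_le_sig _ e _ (hH e he)
  set M : ℝ := L.card + 1 with hM
  have hM0 : 1 ≤ M := by simp [hM]
  have hex : ∀ e, ∃ U, Adapted j e U ∧ (e ∈ L → μ (H e ∆ U) < ENNReal.ofReal (ε / (3 * M))) := by
    intro e
    by_cases he : e ∈ L
    · obtain ⟨U, hU, h⟩ := exists_measure_symmDiff_lt μ (isSetAlgebra_adapted j e)
        (generateFrom_adapted_le j e) (low_succ_le_generateFrom j e _ (hH e he))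
        (ε := ε / (3 * M)) (by positivity)
      exact ⟨U, hU, fun _ => h⟩
    · exact ⟨∅, (isSetAlgebra_adapted j e).empty_mem, fun h => absurd h he⟩
  choose U hUa hUμ using hex
  obtain ⟨ι, hι, ψ, hψ, hU⟩ := exists_common_partition hUa
  have hUalg : ∀ e, U e ∈ alg V e := fun e => (hUa e).mem_alg
  set N : ℝ := Fintype.card (Finset (Fin k) → ι) + 1 with hN
  have hN0 : 1 ≤ N := by simp [hN]
  let G : (Finset (Fin k) → ι) → Finset (Fin k) → Set (Seq (Pow k V)) := fun c e =>
    goodSet μ (low V j e) M⁻¹ (cell j ψ e c) (cell j ψ e c \ H e)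
  have hGex : ∀ c, ∃ H' : Finset (Fin k) → Set (Seq (Pow k V)),
      (∀ e ∈ L, H' e ∈ alg V e ∧ μ.real (G c e \ H' e) ≤ ε / (3 * N)) ∧ ⋂ e ∈ L, H' e = ∅ := by
    intro c
    refine hj (G c) (fun e _ => measurableSet_goodSet) ?_ _ (by positivity)
    refine measure_biInter_goodSet_eq_zero hψ hHs h0 ?_ c
    rw [inv_mul_lt_iff₀ (by positivity)]
    simp [hM]
  choose H' hH' hH'0 using hGex
  have hreal : ∀ e ∈ L, μ.real (H e ∆ U e) ≤ ε / (3 * M) := fun e he =>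
    ENNReal.toReal_le_of_le_ofReal (by positivity) (hUμ e he).le
  refine ⟨fun e => U e ∩ ⋂ c ∈ Finset.univ, ((cell j ψ e c)ᶜ ∪ H' c e), fun e he => ⟨?_, ?_⟩, ?_⟩
  · refine (isSetAlgebra_alg e).inter_mem (hUalg e)
      ((isSetAlgebra_alg e).biInter_mem _ fun c _ => (isSetAlgebra_alg e).union_mem
        ((isSetAlgebra_alg e).compl_mem (cell_mem_alg hψ e c)) (hH' c e he).1)
  · have hsub : H e \ (U e ∩ ⋂ c ∈ Finset.univ, ((cell j ψ e c)ᶜ ∪ H' c e)) ⊆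
        (H e ∆ U e) ∪ ((⋃ c ∈ Finset.univ, (G c e \ H' c e)) ∪
          ⋃ c ∈ {c | cell j ψ e c ⊆ U e}, (cell j ψ e c \ G c e)) := by
      rintro ω ⟨h1, h2⟩
      by_cases hωU : ω ∈ U e
      · right
        have h3 : ∃ c, ω ∈ cell j ψ e c ∧ ω ∉ H' c e := by
          by_contra! h
          refine h2 ⟨hωU, mem_iInter₂.2 fun c _ => ?_⟩
          by_cases hc : ω ∈ cell j ψ e c
          · exact Or.inr (h c hc)
          · exact Or.inl hc
        obtain ⟨c, hc, hc'⟩ := h3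
        by_cases hG : ω ∈ G c e
        · exact Or.inl (mem_biUnion (Finset.mem_univ c) ⟨hG, hc'⟩)
        · refine Or.inr (mem_biUnion (x := c) (fun ω' hω' => ?_) ⟨hc, hG⟩)
          exact (hU e ω ω' fun f hf hj => ((mem_cell.1 hc f hf hj).trans
            (mem_cell.1 hω' f hf hj).symm)).1 hωU
      · exact Or.inl (Or.inl ⟨h1, hωU⟩)
    have hb := measureReal_biUnion_cell_diff_goodSet_le (j := j) hψ (e := e)
      (U := U e) (sig_le e _ (hHs e he)) (κ := M⁻¹) (by positivity)
    have hc : μ.real (⋃ c ∈ Finset.univ, (G c e \ H' c e)) ≤ ε / 3 := by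
      refine (measureReal_biUnion_finset_le _ _).trans
        ((Finset.sum_le_sum fun c _ => (hH' c e he).2).trans ?_)
      rw [Finset.sum_const, nsmul_eq_mul, Finset.card_univ, mul_div_assoc', div_le_div_iff₀
        (by positivity) (by norm_num)]
      nlinarith
    have hd : μ.real (U e \ H e) ≤ μ.real (H e ∆ U e) := measureReal_mono fun ω h => Or.inr h
    have he1 := hreal e he
    have he2 : M * (ε / (3 * M)) = ε / 3 := by field_simp
    have he3 : ε / (3 * M) ≤ ε / 3 := by
      rw [← he2]
      exact le_mul_of_one_le_left (by positivity) hM0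
    rw [inv_mul_le_iff₀ (by positivity)] at hb
    have hb' := hb.trans (mul_le_mul_of_nonneg_left (hd.trans he1) (by positivity))
    rw [he2] at hb'
    have := (measureReal_mono hsub).trans ((measureReal_union_le (μ := μ) _ _).trans
      (add_le_add_right (measureReal_union_le _ _) _))
    simp only [G] at this hc ⊢
    linarith
  · refine eq_empty_of_forall_notMem fun ω hω => ?_
    have h1 : ω ∈ ⋂ e ∈ L, H' (fun f => ψ f ω) e := by
      refine mem_iInter₂.2 fun e he => ?_
      have h2 := mem_iInter₂.1 (mem_iInter₂.1 hω e he).2 (fun f => ψ f ω) (Finset.mem_univ _)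
      exact h2.resolve_left fun h => h (mem_cell.2 fun _ _ _ => rfl)
    rw [hH'0] at h1
    exact h1

lemma removable (j : ℕ) (L : Finset (Finset (Fin k))) : Removable V j L := by
  induction j with
  | zero => exact removable_zero L
  | succ j ih => exact ih.succ

/-- The removal lemma on the limit space. -/
theorem exists_mem_alg_biInter_eq_empty (L : Finset (Finset (Fin k)))
    (H : Finset (Fin k) → Set (Seq (Pow k V))) (hH : ∀ e ∈ L, H e ∈ alg V e)
    (h0 : loeb (Pow k V) (⋂ e ∈ L, H e) = 0) {ε : ℝ} (hε : 0 < ε) :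
    ∃ H' : Finset (Fin k) → Set (Seq (Pow k V)),
      (∀ e ∈ L, H' e ∈ alg V e ∧ (loeb (Pow k V)).real (H e \ H' e) ≤ ε) ∧
      ⋂ e ∈ L, H' e = ∅ :=
  removable (k + 1) L H (fun e he => sig_le_low (Nat.lt_succ_of_le (card_finset_fin_le e)) _
    (MeasurableSpace.measurableSet_generateFrom (hH e he))) h0 ε hε

end
end Loeb

/-- The image of the index set `e` under a tuple of elements of `{0, …, n - 1}`. -/
def tupleImage {k n : ℕ} (x : Fin k → Fin n) (e : Finset (Fin k)) : Finset ℕ :=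
  e.image fun i => (x i : ℕ)

lemma tupleImage_congr {k n : ℕ} {x y : Fin k → Fin n} {e : Finset (Fin k)}
    (h : ∀ i ∈ e, x i = y i) : tupleImage x e = tupleImage y e :=
  Finset.image_congr fun i hi => congrArg Fin.val (h i hi)

lemma tupleImage_subset_range {k n : ℕ} (x : Fin k → Fin n) (e : Finset (Fin k)) :
    tupleImage x e ⊆ Finset.range n := by
  intro a ha
  obtain ⟨i, -, rfl⟩ := Finset.mem_image.1 ha
  exact Finset.mem_range.2 (x i).2

lemma card_tupleImage {k n : ℕ} {x : Fin k → Fin n} (hx : Function.Injective x)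
    (e : Finset (Fin k)) : (tupleImage x e).card = e.card :=
  Finset.card_image_of_injective _ (Fin.val_injective.comp hx)

/-- The tuples whose restriction to `e` enumerates a member of `F`. -/
def edgeTuples {k : ℕ} (n : ℕ) (F : Finset (Finset ℕ)) (e : Finset (Fin k)) :
    Set (Fin k → Fin n) := {x | tupleImage x e ∈ F}

lemma depOn_edgeTuples {k n : ℕ} (F : Finset (Finset ℕ)) (e : Finset (Fin k)) :
    Loeb.DepOn e (edgeTuples n F e) := fun x y h => by
  simp only [edgeTuples, mem_ofPred_eq, tupleImage_congr h]

lemma injective_of_forall_mem_edgeTuples {k l n : ℕ} (hl : 2 ≤ l) (hkl : l ≤ k)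
    {F : Finset (Finset ℕ)} (hF : ∀ e ∈ F, e.card = l) {x : Fin k → Fin n}
    (hx : ∀ e ∈ Finset.powersetCard l Finset.univ, x ∈ edgeTuples n F e) :
    Function.Injective x := by
  intro i j hij
  by_contra hne
  obtain ⟨e, he, -, hcard⟩ := Finset.exists_subsuperset_card_eq (n := l)
    (Finset.subset_univ ({i, j} : Finset (Fin k))) ((Finset.card_le_two).trans hl) (by simpa)
  have h1 : (tupleImage x e).card = e.card := by
    rw [hcard]
    exact hF _ (hx e (Finset.mem_powersetCard.2 ⟨Finset.subset_univ _, hcard⟩))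
  refine hne (Finset.card_image_iff.1 h1 (he (by simp)) (he (by simp)) ?_)
  simp [hij]

lemma mem_of_forall_mem_edgeTuples {k l n : ℕ} {F : Finset (Finset ℕ)} {x : Fin k → Fin n}
    (hinj : Function.Injective x)
    (hx : ∀ e ∈ Finset.powersetCard l Finset.univ, x ∈ edgeTuples n F e) {b : Finset ℕ}
    (hb : b ⊆ tupleImage x Finset.univ) (hbl : b.card = l) : b ∈ F := by
  have h1 : tupleImage x (Finset.univ.filter fun i => (x i : ℕ) ∈ b) = b := by
    ext a
    simp only [tupleImage, Finset.mem_image, Finset.mem_filter, Finset.mem_univ, true_and]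
    constructor
    · rintro ⟨i, hi, rfl⟩
      exact hi
    · intro ha
      obtain ⟨i, -, rfl⟩ := Finset.mem_image.1 (hb ha)
      exact ⟨i, ha, rfl⟩
  rw [← h1]
  refine hx _ (Finset.mem_powersetCard.2 ⟨Finset.subset_univ _, ?_⟩)
  rw [← card_tupleImage hinj, h1, hbl]

lemma ncard_biInter_edgeTuples_le {k l n : ℕ} (hl : 2 ≤ l) (hkl : l ≤ k)
    {F K : Finset (Finset ℕ)} (hF : ∀ e ∈ F, e.card = l)
    (hK : ∀ A, A ⊆ Finset.range n → A.card = k → (∀ e, e ⊆ A → e.card = l → e ∈ F) → A ∈ K) :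
    (⋂ e ∈ Finset.powersetCard l (Finset.univ : Finset (Fin k)), edgeTuples n F e).ncard ≤
      k ^ k * K.card := by
  classical
  rw [ncard_eq_toFinset_card']
  set s := (⋂ e ∈ Finset.powersetCard l (Finset.univ : Finset (Fin k)),
    edgeTuples n F e).toFinset with hs
  have hmem : ∀ x ∈ s, Function.Injective x ∧ tupleImage x Finset.univ ∈ K := by
    intro x hx
    rw [hs, mem_toFinset, mem_iInter₂] at hx
    have hinj := injective_of_forall_mem_edgeTuples hl hkl hF hx
    refine ⟨hinj, hK _ (tupleImage_subset_range x _) ?_ fun e he hel =>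
      mem_of_forall_mem_edgeTuples hinj hx he hel⟩
    rw [card_tupleImage hinj, Finset.card_univ, Fintype.card_fin]
  refine (Finset.card_le_mul_card_image (f := fun x => tupleImage x Finset.univ) s (k ^ k)
    fun a ha => ?_).trans (Nat.mul_le_mul_left _ (Finset.card_le_card fun a ha => ?_))
  · obtain ⟨x, hx, rfl⟩ := Finset.mem_image.1 ha
    set A := tupleImage x Finset.univ with hA
    have hAk : A.card = k := by
      rw [card_tupleImage (hmem x hx).1, Finset.card_univ, Fintype.card_fin]
    calc (s.filter fun y => tupleImage y Finset.univ = A).card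
        ≤ (Fintype.piFinset fun _ : Fin k =>
            Finset.univ.filter fun v : Fin n => (v : ℕ) ∈ A).card := by
          refine Finset.card_le_card fun y hy => Fintype.mem_piFinset.2 fun i => ?_
          refine Finset.mem_filter.2 ⟨Finset.mem_univ _, ?_⟩
          rw [← (Finset.mem_filter.1 hy).2]
          exact Finset.mem_image_of_mem _ (Finset.mem_univ i)
      _ ≤ k ^ k := by
          rw [Fintype.card_piFinset_const]
          refine Nat.pow_le_pow_left ?_ k
          rw [← hAk]
          exact Finset.card_le_card_of_injOn _ (fun v hv => (Finset.mem_filter.1 hv).2)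
            Fin.val_injective.injOn
  · obtain ⟨x, hx, rfl⟩ := Finset.mem_image.1 ha
    exact (hmem x hx).2

/-- The members of `F` enumerated by the restriction to `e` of a tuple outside `T`. -/
noncomputable def removed {k n : ℕ} (F : Finset (Finset ℕ)) (e : Finset (Fin k))
    (T : Set (Fin k → Fin n)) : Finset (Finset ℕ) := by
  classical
  exact F.filter fun b => ∃ x : Fin k → Fin n, tupleImage x e = b ∧ x ∉ T

lemma removed_subset {k n : ℕ} (F : Finset (Finset ℕ)) (e : Finset (Fin k))
    (T : Set (Fin k → Fin n)) : removed F e T ⊆ F := by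
  classical exact Finset.filter_subset _ _

lemma card_removed_mul_le {k n : ℕ} (F : Finset (Finset ℕ)) {e : Finset (Fin k)}
    {T : Set (Fin k → Fin n)} (hT : Loeb.DepOn e T) :
    (removed F e T).card * n ^ (k - e.card) ≤ (edgeTuples n F e \ T).ncard := by
  classical
  have hex : ∀ b : removed F e T, ∃ x : Fin k → Fin n, tupleImage x e = b ∧ x ∉ T := fun b =>
    (Finset.mem_filter.1 b.2).2
  choose x hx hxT using hex
  let g : removed F e T × ({i // i ∉ e} → Fin n) → Fin k → Fin n := fun p i =>
    if h : i ∈ e then x p.1 i else p.2 ⟨i, h⟩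
  have hge : ∀ p, ∀ i ∈ e, g p i = x p.1 i := fun p i hi => by simp [g, hi]
  have hgim : ∀ p, tupleImage (g p) e = p.1 := fun p => (tupleImage_congr (hge p)).trans (hx _)
  have hinj : Function.Injective g := by
    intro p q hpq
    have h1 : p.1 = q.1 := Subtype.ext (by rw [← hgim p, ← hgim q, hpq])
    refine Prod.ext h1 (funext fun i => ?_)
    have h2 := congrFun hpq i
    simpa [g, i.2] using h2
  have hrange : range g ⊆ edgeTuples n F e \ T := by
    rintro _ ⟨p, rfl⟩
    refine ⟨?_, fun h => hxT p.1 ((hT _ _ (hge p)).1 h)⟩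
    change tupleImage (g p) e ∈ F
    rw [hgim]
    exact (Finset.mem_filter.1 p.1.2).1
  calc (removed F e T).card * n ^ (k - e.card)
      = Nat.card (removed F e T × ({i // i ∉ e} → Fin n)) := by
        rw [Nat.card_eq_fintype_card, Fintype.card_prod, Fintype.card_coe, Fintype.card_fun,
          Fintype.card_fin, Fintype.card_subtype_compl, Fintype.card_fin, Fintype.card_coe]
    _ = (range g).ncard := by
        rw [← image_univ, ncard_image_of_injective _ hinj, ncard_univ]
    _ ≤ _ := ncard_le_ncard hrange (toFinite _)

lemma exists_notMem_sdiff_removed {k l n : ℕ} (F : Finset (Finset ℕ))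
    {T : Finset (Fin k) → Set (Fin k → Fin n)}
    (hT : ⋂ e ∈ Finset.powersetCard l Finset.univ, T e = ∅) {A : Finset ℕ}
    (hA : A ⊆ Finset.range n) (hAk : A.card = k) :
    ∃ b, b ⊆ A ∧ b.card = l ∧
      b ∉ F \ (Finset.powersetCard l Finset.univ).biUnion fun e => removed F e (T e) := by
  classical
  let x : Fin k → Fin n := fun i =>
    ⟨A.orderEmbOfFin hAk i, Finset.mem_range.1 (hA (A.orderEmbOfFin_mem hAk i))⟩
  have hinj : Function.Injective x := fun i j h =>
    (A.orderEmbOfFin hAk).injective (congrArg Fin.val h)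
  have hx : x ∉ ⋂ e ∈ Finset.powersetCard l Finset.univ, T e := by
    rw [hT]
    exact fun h => h
  simp only [mem_iInter, not_forall] at hx
  obtain ⟨e, he, hxe⟩ := hx
  refine ⟨tupleImage x e, fun a ha => ?_, ?_, fun hb => ?_⟩
  · obtain ⟨i, -, rfl⟩ := Finset.mem_image.1 ha
    exact A.orderEmbOfFin_mem hAk i
  · rw [card_tupleImage hinj]
    exact (Finset.mem_powersetCard.1 he).2
  · obtain ⟨h1, h2⟩ := Finset.mem_sdiff.1 hb
    exact h2 (Finset.mem_biUnion.2 ⟨e, he, Finset.mem_filter.2 ⟨h1, x, rfl, hxe⟩⟩)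

/-- Hypergraph removal for complete hypergraphs: a family of `l`-sets with few complete `k`-sets
becomes `K_k`-free after removing few of its members. -/
theorem hypergraph_removal {k l : ℕ} (hl : 2 ≤ l) (hkl : l < k) {δ : ℝ} (hδ : 0 < δ) :
    ∃ N : ℕ, ∀ n, N ≤ n → ∀ F K : Finset (Finset ℕ), (∀ e ∈ F, e.card = l) →
      (∀ A, A ⊆ Finset.range n → A.card = k → (∀ e, e ⊆ A → e.card = l → e ∈ F) → A ∈ K) →
      K.card ≤ n ^ l →
      ∃ R, R ⊆ F ∧ (R.card : ℝ) ≤ δ * (n : ℝ) ^ l ∧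
        ∀ A, A ⊆ Finset.range n → A.card = k → ∃ e, e ⊆ A ∧ e.card = l ∧ e ∉ F \ R := by
  classical
  by_contra! hcon
  choose n hn F K hF hK hKn hbad using fun i : ℕ => hcon (i + 1)
  have hn0 : ∀ i, 0 < n i := fun i => (Nat.succ_pos i).trans_le (hn i)
  let V : ℕ → Type := fun i => Fin (n i)
  let _ : ∀ i, Fintype (V i) := fun i => Fin.fintype (n i)
  have : ∀ i, Nonempty (V i) := fun i => ⟨⟨0, hn0 i⟩⟩
  have hcardV : ∀ i, (Fintype.card (Loeb.Pow k V i) : ℝ) = (n i : ℝ) ^ k := by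
    intro i
    have : Fintype.card (Loeb.Pow k V i) = n i ^ k := by
      rw [← Nat.card_eq_fintype_card]
      change Nat.card (Fin k → Fin (n i)) = n i ^ k
      simp
    rw [this, Nat.cast_pow]
  set L : Finset (Finset (Fin k)) := Finset.powersetCard l Finset.univ with hL
  set ε : ℝ := δ / (2 * (L.card + 1)) with hε
  have hε0 : 0 < ε := by positivity
  have h0 : Loeb.loeb (Loeb.Pow k V)
      (⋂ e ∈ L, Loeb.intSet (W := Loeb.Pow k V) fun i => edgeTuples (n i) (F i) e) = 0 := by
    rw [Loeb.intSet_biInter]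
    refine (measureReal_eq_zero_iff (measure_ne_top _ _)).1 (tendsto_nhds_unique
      (Loeb.tendsto_loeb_real (W := Loeb.Pow k V)
        fun i => ⋂ e ∈ L, edgeTuples (n i) (F i) e) ?_)
    have hlim : Tendsto (fun i : ℕ => (k : ℝ) ^ k * (1 / ((i : ℝ) + 1))) (hyperfilter ℕ) (𝓝 0) := by
      have := (tendsto_one_div_add_atTop_nhds_zero_nat (𝕜 := ℝ)).const_mul ((k : ℝ) ^ k)
      rw [mul_zero] at this
      exact this.mono_left Nat.hyperfilter_le_atTop
    refine squeeze_zero (fun i => by positivity) (fun i => ?_) hlim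
    rw [hcardV]
    have h1 : ((⋂ e ∈ L, edgeTuples (n i) (F i) e).ncard : ℝ) ≤ (k : ℝ) ^ k * (n i : ℝ) ^ l := by
      exact_mod_cast (ncard_biInter_edgeTuples_le hl hkl.le (hF i) (hK i)).trans
        (Nat.mul_le_mul_left _ (hKn i))
    have h2 : ((i : ℝ) + 1) ≤ n i := by exact_mod_cast hn i
    have h3 : (1 : ℝ) ≤ n i := by exact_mod_cast hn0 i
    have h4 : (n i : ℝ) ^ l * n i ≤ (n i : ℝ) ^ k := by
      rw [← pow_succ]
      exact pow_le_pow_right₀ h3 hkl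
    rw [div_le_iff₀ (by positivity)]
    refine h1.trans ?_
    rw [mul_assoc]
    refine mul_le_mul_of_nonneg_left ?_ (by positivity)
    rw [one_div_mul_eq_div, le_div_iff₀ (by positivity)]
    exact (mul_le_mul_of_nonneg_left h2 (by positivity)).trans h4
  obtain ⟨H', hH', hH'0⟩ := Loeb.exists_mem_alg_biInter_eq_empty L _
    (fun e _ => ⟨_, fun i => depOn_edgeTuples (F i) e, rfl⟩) h0 hε0
  have hT : ∀ e, ∃ T : ∀ i, Set (Loeb.Pow k V i), e ∈ L →
      (∀ i, Loeb.DepOn e (T i)) ∧ H' e = Loeb.intSet T := by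
    intro e
    by_cases he : e ∈ L
    · obtain ⟨T, hT⟩ := (hH' e he).1
      exact ⟨T, fun _ => hT⟩
    · exact ⟨fun _ => ∅, fun h => absurd h he⟩
  choose T hT using hT
  have hempty : ∀ᶠ i in (hyperfilter ℕ : Filter ℕ), ⋂ e ∈ L, T e i = ∅ := by
    refine Loeb.eventually_eq_empty (W := Loeb.Pow k V) ?_
    rw [← Loeb.intSet_biInter, ← hH'0]
    exact iInter₂_congr fun e he => (hT e he).2.symm
  have hsmall : ∀ᶠ i in (hyperfilter ℕ : Filter ℕ), ∀ e ∈ L,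
      ((edgeTuples (n i) (F i) e \ T e i).ncard : ℝ) / (n i : ℝ) ^ k < 2 * ε := by
    refine (eventually_all_finset _).2 fun e he => ?_
    have h1 := Loeb.tendsto_loeb_real (W := Loeb.Pow k V)
      fun i => edgeTuples (n i) (F i) e \ T e i
    simp only [hcardV] at h1
    refine h1.eventually_lt_const ?_
    rw [← Loeb.intSet_sdiff, ← (hT e he).2]
    exact (hH' e he).2.trans_lt (by linarith)
  obtain ⟨i, hi1, hi2⟩ := (hempty.and hsmall).exists
  obtain ⟨A, hA, hAk, hAF⟩ := hbad i (L.biUnion fun e => removed (F i) e (T e i))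
    (Finset.biUnion_subset.2 fun e _ => removed_subset _ _ _) (by
      have hpos : (0 : ℝ) < n i := by exact_mod_cast hn0 i
      have h1 : ∀ e ∈ L, ((removed (F i) e (T e i)).card : ℝ) ≤ 2 * ε * (n i : ℝ) ^ l := by
        intro e he
        have hel : e.card = l := (Finset.mem_powersetCard.1 he).2
        have h2 := card_removed_mul_le (n := n i) (F i) ((hT e he).1 i)
        rw [hel] at h2
        have h3 : ((removed (F i) e (T e i)).card : ℝ) * (n i : ℝ) ^ (k - l) ≤
            ((edgeTuples (n i) (F i) e \ T e i).ncard : ℝ) := by exact_mod_cast h2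
        have h4 := (div_lt_iff₀ (by positivity)).1 (hi2 e he)
        have h5 : (n i : ℝ) ^ k = (n i : ℝ) ^ l * (n i : ℝ) ^ (k - l) := by
          rw [← pow_add, Nat.add_sub_of_le hkl.le]
        rw [h5, ← mul_assoc] at h4
        exact le_of_mul_le_mul_right (h3.trans h4.le) (by positivity)
      calc ((L.biUnion fun e => removed (F i) e (T e i)).card : ℝ)
          ≤ ∑ e ∈ L, ((removed (F i) e (T e i)).card : ℝ) := by
            exact_mod_cast Finset.card_biUnion_le
        _ ≤ ∑ e ∈ L, 2 * ε * (n i : ℝ) ^ l := Finset.sum_le_sum h1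
        _ = (L.card * (2 * ε)) * (n i : ℝ) ^ l := by rw [Finset.sum_const, nsmul_eq_mul]; ring
        _ ≤ δ * (n i : ℝ) ^ l := by
            refine mul_le_mul_of_nonneg_right ?_ (by positivity)
            rw [hε, mul_div_assoc', mul_div_assoc', div_le_iff₀ (by positivity)]
            nlinarith)
  obtain ⟨b, hb1, hb2, hb3⟩ := exists_notMem_sdiff_removed (F i) hi1 hA hAk
  exact hb3 (hAF b hb1 hb2)

lemma exists_isDomSet_gamma (n : ℕ) {k l : ℕ} (hkl : l ≤ k) :
    ∃ E K, IsDomSet n k l E K ∧ gamma n k l = E.card + K.card ∧ gamma n k l ≤ n.choose l := by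
  have hmem : n.choose l ∈ {m | ∃ E K : Finset (Finset ℕ), IsDomSet n k l E K ∧
      m = E.card + K.card} := by
    refine ⟨Finset.powersetCard l (Finset.range n), ∅, ⟨fun e => Finset.mem_powersetCard.1,
      fun A hA => absurd hA (Finset.notMem_empty A), fun A hA hAk _ => ?_,
      fun e he hel h => absurd (Finset.mem_powersetCard.2 ⟨he, hel⟩) h⟩, by simp⟩
    obtain ⟨e, he, hel⟩ := Finset.exists_subset_card_eq (hkl.trans hAk.ge)
    exact ⟨e, Finset.mem_powersetCard.2 ⟨he.trans hA, hel⟩, he⟩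
  obtain ⟨E, K, hEK, h⟩ := Nat.sInf_mem ⟨_, hmem⟩
  exact ⟨E, K, hEK, h, Nat.sInf_le hmem⟩

lemma card_le_exTuran {n k l : ℕ} {F : Finset (Finset ℕ)}
    (hF : ∀ e ∈ F, e ⊆ Finset.range n ∧ e.card = l)
    (hfree : ∀ A, A ⊆ Finset.range n → A.card = k → ∃ e, e ⊆ A ∧ e.card = l ∧ e ∉ F) :
    F.card ≤ exTuran n k l := by
  refine le_csSup ⟨n.choose l, ?_⟩ ⟨F, hF, hfree, rfl⟩
  rintro _ ⟨F', hF', -, rfl⟩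
  rw [← Finset.card_range n, ← Finset.card_powersetCard]
  exact Finset.card_le_card fun e he => Finset.mem_powersetCard.2 (hF' e he)

lemma card_le_choose_sub_one_mul {n k l : ℕ} {F K : Finset (Finset ℕ)}
    (hF : ∀ e ∈ F, e.card = l) (hK : ∀ A ∈ K, A ⊆ Finset.range n ∧ A.card = k)
    (hfree : ∀ A, A ⊆ Finset.range n → A.card = k → ∃ e, e ⊆ A ∧ e.card = l ∧ e ∉ F)
    (hcov : ∀ e ∈ F, ∃ A ∈ K, e ⊆ A) :
    F.card ≤ K.card * (k.choose l - 1) := by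
  have hsub : F ⊆ K.biUnion fun A => (Finset.powersetCard l A).filter (· ∈ F) := by
    intro e he
    obtain ⟨A, hA, heA⟩ := hcov e he
    exact Finset.mem_biUnion.2
      ⟨A, hA, Finset.mem_filter.2 ⟨Finset.mem_powersetCard.2 ⟨heA, hF e he⟩, he⟩⟩
  refine (Finset.card_le_card hsub).trans (Finset.card_biUnion_le_card_mul _ _ _ fun A hA => ?_)
  obtain ⟨hAn, hAk⟩ := hK A hA
  obtain ⟨e, heA, hel, heF⟩ := hfree A hAn hAk
  have he : e ∈ Finset.powersetCard l A := Finset.mem_powersetCard.2 ⟨heA, hel⟩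
  rw [← hAk, ← Finset.card_powersetCard, ← Finset.card_erase_of_mem he]
  refine Finset.card_le_card fun b hb => ?_
  obtain ⟨hb1, hb2⟩ := Finset.mem_filter.1 hb
  exact Finset.mem_erase.2 ⟨fun h => heF (h ▸ hb2), hb1⟩

lemma pow_le_mul_choose {n l : ℕ} (hn : 2 * l ≤ n) :
    (n : ℝ) ^ l ≤ 2 ^ l * l.factorial * n.choose l := by
  have h1 : (n + 1 - l) ^ l ≤ l.factorial * n.choose l := by
    rw [← Nat.descFactorial_eq_factorial_mul_choose]
    exact Nat.pow_sub_le_descFactorial n l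
  have h2 : n ^ l ≤ 2 ^ l * (l.factorial * n.choose l) := by
    refine le_trans ?_ (Nat.mul_le_mul_left _ h1)
    rw [← mul_pow]
    exact Nat.pow_le_pow_left (by lia) l
  rw [mul_assoc]
  exact_mod_cast h2

/-- If `ex(n, K_k^{(l)}) = (1 - α)·C(n, l) + o(n^l)`, then
`γ(G_{k,l}) ≥ (α + (1-α)/(C(k,l) - 1))·C(n, l) + o(n^l)`. -/
theorem domination_number_Gkl_lower (k l : ℕ) (hl : 2 ≤ l) (hkl : l < k)
    (α : ℝ) (hα0 : 0 ≤ α) (hα1 : α ≤ 1)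
    (hex : Filter.Tendsto (fun n : ℕ => (exTuran n k l : ℝ) / (n.choose l : ℝ))
      Filter.atTop (nhds (1 - α))) :
    ∀ ε : ℝ, 0 < ε → ∃ N : ℕ, ∀ n : ℕ, N ≤ n →
      (α + (1 - α) / ((k.choose l : ℝ) - 1) - ε) * (n.choose l : ℝ)
        ≤ (gamma n k l : ℝ) := by
  intro ε hε
  set c : ℝ := 2 ^ l * l.factorial with hc
  have hc0 : 0 < c := by positivity
  obtain ⟨N₁, hN₁⟩ := hypergraph_removal hl hkl (δ := ε / (2 * c)) (by positivity)
  obtain ⟨N₂, hN₂⟩ := eventually_atTop.1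
    (hex.eventually_lt_const (show 1 - α < 1 - α + ε / 2 by linarith))
  refine ⟨max (max N₁ N₂) (2 * l), fun n hn => ?_⟩
  obtain ⟨hn1, hn2, hn3⟩ : N₁ ≤ n ∧ N₂ ≤ n ∧ 2 * l ≤ n := by simpa using hn
  have hC0 : (0 : ℝ) < n.choose l := by exact_mod_cast Nat.choose_pos (by lia)
  obtain ⟨E, K, ⟨hE, hK, hEK, hKE⟩, hγ, hγC⟩ := exists_isDomSet_gamma n hkl.le
  set F := Finset.powersetCard l (Finset.range n) \ E with hFdef
  have hF : ∀ e ∈ F, (e ⊆ Finset.range n ∧ e.card = l) ∧ e ∉ E := fun e he =>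
    ⟨Finset.mem_powersetCard.1 (Finset.mem_sdiff.1 he).1, (Finset.mem_sdiff.1 he).2⟩
  have hFcard : F.card + E.card = n.choose l := by
    rw [hFdef, Finset.card_sdiff_add_card_eq_card fun e he =>
      Finset.mem_powersetCard.2 (hE e he), Finset.card_powersetCard, Finset.card_range]
  obtain ⟨R, hRF, hR, hfree⟩ := hN₁ n hn1 F K (fun e he => (hF e he).1.2)
    (fun A hA hAk h => by
      by_contra hAK
      obtain ⟨e, he, heA⟩ := hEK A hA hAk hAK
      exact (hF e (h e heA (hE e he).2)).2 he)
    (((Nat.le_add_left _ _).trans (hγ ▸ hγC)).trans (Nat.choose_le_pow n l))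
  have hF' : ∀ e ∈ F \ R, (e ⊆ Finset.range n ∧ e.card = l) ∧ e ∉ E := fun e he =>
    hF e (Finset.mem_sdiff.1 he).1
  have hturan : ((F \ R).card : ℝ) ≤ (1 - α + ε / 2) * n.choose l :=
    (Nat.cast_le.2 (card_le_exTuran (fun e he => (hF' e he).1) hfree)).trans
      ((div_lt_iff₀ hC0).1 (hN₂ n hn2)).le
  have hcover := card_le_choose_sub_one_mul (fun e he => (hF' e he).1.2) hK hfree
    fun e he => hKE e (hF' e he).1.1 (hF' e he).1.2 (hF' e he).2
  have hM : 2 < k.choose l := by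
    have h1 : (l + 1).choose l ≤ k.choose l := Nat.choose_le_choose l hkl
    rw [Nat.choose_succ_self_right] at h1
    lia
  have hM' : (2 : ℝ) < k.choose l := by exact_mod_cast hM
  have hcover' : ((F \ R).card : ℝ) / (k.choose l - 1) ≤ K.card := by
    rw [div_le_iff₀ (by linarith), ← Nat.cast_one, ← Nat.cast_sub (by lia)]
    exact_mod_cast hcover
  have hRC : (R.card : ℝ) ≤ ε / 2 * n.choose l := by
    calc (R.card : ℝ) ≤ ε / (2 * c) * (n : ℝ) ^ l := hR
      _ ≤ ε / (2 * c) * (c * n.choose l) :=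
        mul_le_mul_of_nonneg_left (pow_le_mul_choose hn3) (by positivity)
      _ = ε / 2 * n.choose l := by field_simp
  have hsum : ((F \ R).card : ℝ) + R.card + E.card = n.choose l := by
    rw [← hFcard, ← Finset.card_sdiff_add_card_eq_card hRF]
    push_cast
    rfl
  have hγ' : (gamma n k l : ℝ) = E.card + K.card := by exact_mod_cast hγ
  set t : ℝ := ((k.choose l : ℝ) - 1)⁻¹ with ht
  have ht0 : 0 ≤ t := by rw [ht]; exact inv_nonneg.2 (by linarith)
  have ht1 : t ≤ 1 := inv_le_one_of_one_le₀ (by linarith)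
  rw [div_eq_mul_inv] at hcover' ⊢
  have key := mul_le_mul_of_nonneg_left hturan (sub_nonneg.2 ht1)
  have key2 : (1 - t) * (ε / 2 * n.choose l) ≤ ε / 2 * n.choose l :=
    mul_le_of_le_one_left (by positivity) (by linarith)
  rw [hγ']
  linarith
end

section
/- For every ε > 0 there exists N such that for all n ≥ N, the domination number satisfies γ(G_{5,3}) ≤ (1/3 + ε) · C(n,3). -/
/-- The vertices `0, …, 6k - 1`, labelled by a half, one of three groups in that half, and a
residue modulo `k`. -/
def halfGroupVertex (k : ℕ) (s : Bool) (g : Fin 3) (x : ZMod k) : ℕ :=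
  (if s then 3 * k else 0) + g.val * k + x.val

/-- The pair `{d + t, d - t}` in one group of a half, together with the transversal
`{x, x + d, x + 2d}` of the three groups of the other half. -/
def pairTransversalBlock (k : ℕ) (s : Bool) (d x : ZMod k) (g : Fin 3) (t : ℕ) : Finset ℕ :=
  {halfGroupVertex k s g (d + t), halfGroupVertex k s g (d - t),
    halfGroupVertex k (!s) 0 x, halfGroupVertex k (!s) 1 (x + d),
    halfGroupVertex k (!s) 2 (x + 2 * d)}

lemma mem_pairTransversalBlock_of_transversal {k : ℕ} (s : Bool) (d x : ZMod k) (g h : Fin 3)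
    (t : ℕ) :
    halfGroupVertex k (!s) h (x + (h.val : ZMod k) * d) ∈ pairTransversalBlock k s d x g t := by
  fin_cases h <;> simp [pairTransversalBlock]

lemma exists_halfGroupVertex_eq {k : ℕ} [NeZero k] {v : ℕ} (hv : v < 6 * k) :
    ∃ (g : Fin 3) (x : ZMod k), halfGroupVertex k (decide (3 * k ≤ v)) g x = v := by
  have hk : 0 < k := Nat.pos_of_ne_zero (NeZero.ne k)
  have key : ∀ u, u < 3 * k → ∃ (g : Fin 3) (x : ZMod k), g.val * k + x.val = u := by
    intro u hu
    refine ⟨⟨u / k, (Nat.div_lt_iff_lt_mul hk).2 hu⟩, ((u % k : ℕ) : ZMod k), ?_⟩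
    rw [ZMod.val_cast_of_lt (Nat.mod_lt _ hk)]
    exact Nat.div_add_mod' u k
  by_cases h : 3 * k ≤ v
  · obtain ⟨g, x, hgx⟩ := key (v - 3 * k) (by omega)
    refine ⟨g, x, ?_⟩
    simp only [halfGroupVertex, h, decide_true, if_true]
    omega
  · obtain ⟨g, x, hgx⟩ := key v (by omega)
    refine ⟨g, x, ?_⟩
    simp [halfGroupVertex, h, hgx]

lemma ZMod.exists_natCast_eq_or_eq_neg {q : ℕ} (z : ZMod (2 * q + 1)) :
    ∃ t < q + 1, z = (t : ZMod (2 * q + 1)) ∨ z = -(t : ZMod (2 * q + 1)) := by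
  have hz := ZMod.val_lt z
  by_cases h : z.val < q + 1
  · exact ⟨z.val, h, Or.inl (ZMod.natCast_zmod_val z).symm⟩
  · refine ⟨2 * q + 1 - z.val, by omega, Or.inr ?_⟩
    rw [Nat.cast_sub hz.le, ZMod.natCast_self, ZMod.natCast_zmod_val]
    ring

lemma ZMod.two_mul_natCast_succ_eq_one (q : ℕ) : 2 * ((q : ZMod (2 * q + 1)) + 1) = 1 := by
  have h : ((2 * q + 1 : ℕ) : ZMod (2 * q + 1)) = 0 := ZMod.natCast_self _
  push_cast at h
  linear_combination h

/-- Two residues in different groups lie on a common transversal. -/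
lemma exists_transversal {q : ℕ} {g h : Fin 3} (hgh : g ≠ h) (i j : ZMod (2 * q + 1)) :
    ∃ x d : ZMod (2 * q + 1), x + (g.val : ZMod (2 * q + 1)) * d = i ∧
      x + (h.val : ZMod (2 * q + 1)) * d = j := by
  have h2 := ZMod.two_mul_natCast_succ_eq_one q
  set w : ZMod (2 * q + 1) := (q : ZMod (2 * q + 1)) + 1
  have key : ∃ d, ((h.val : ZMod (2 * q + 1)) - g.val) * d = j - i := by
    fin_cases g <;> fin_cases h <;> simp at hgh ⊢
    · exact ⟨w * (j - i), by linear_combination (j - i) * h2⟩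
    · exact ⟨i - j, by ring⟩
    · exact ⟨j - i, by ring⟩
    · exact ⟨w * (i - j), by linear_combination (j - i) * h2⟩
    · exact ⟨i - j, by ring⟩
  obtain ⟨d, hd⟩ := key
  exact ⟨i - (g.val : ZMod (2 * q + 1)) * d, d, by ring, by linear_combination hd⟩

/-- Two vertices of one half and a vertex of the other half lie in a common block. -/
lemma exists_pairTransversalBlock {q : ℕ} (s : Bool) (g h f : Fin 3)
    (i j y : ZMod (2 * q + 1)) :
    ∃ (s' : Bool) (d x : ZMod (2 * q + 1)) (e : Fin 3), ∃ t < q + 1,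
      halfGroupVertex (2 * q + 1) s g i ∈ pairTransversalBlock (2 * q + 1) s' d x e t ∧
      halfGroupVertex (2 * q + 1) s h j ∈ pairTransversalBlock (2 * q + 1) s' d x e t ∧
      halfGroupVertex (2 * q + 1) (!s) f y ∈ pairTransversalBlock (2 * q + 1) s' d x e t := by
  have h2 := ZMod.two_mul_natCast_succ_eq_one q
  by_cases hgh : g = h
  · subst hgh
    set d : ZMod (2 * q + 1) := ((q : ZMod (2 * q + 1)) + 1) * (i + j) with hd
    obtain ⟨t, ht, htz⟩ := ZMod.exists_natCast_eq_or_eq_neg (i - d)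
    have hsum : i + j = 2 * d := by
      rw [hd]
      linear_combination -(i + j) * h2
    refine ⟨s, d, y - (f.val : ZMod (2 * q + 1)) * d, g, t, ht, ?_, ?_, ?_⟩
    · rcases htz with htz | htz
      · have : i = d + t := by linear_combination htz
        simp [pairTransversalBlock, this]
      · have : i = d - t := by linear_combination htz
        simp [pairTransversalBlock, this]
    · rcases htz with htz | htz
      · have : j = d - t := by linear_combination hsum - htz
        simp [pairTransversalBlock, this]
      · have : j = d + t := by linear_combination hsum - htz
        simp [pairTransversalBlock, this]
    · have := mem_pairTransversalBlock_of_transversal s d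
        (y - (f.val : ZMod (2 * q + 1)) * d) g f t
      rwa [sub_add_cancel] at this
  · obtain ⟨x, d, hi, hj⟩ := exists_transversal hgh i j
    obtain ⟨t, ht, htz⟩ := ZMod.exists_natCast_eq_or_eq_neg (y - d)
    refine ⟨!s, d, x, f, t, ht, ?_, ?_, ?_⟩
    · simpa [hi] using mem_pairTransversalBlock_of_transversal (!s) d x f g t
    · simpa [hj] using mem_pairTransversalBlock_of_transversal (!s) d x f h t
    · rcases htz with htz | htz
      · have : y = d + t := by linear_combination htz
        simp [pairTransversalBlock, this]
      · have : y = d - t := by linear_combination htz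
        simp [pairTransversalBlock, this]

/-- `3k²(k + 1)` sets of size five, `k = 2q + 1`, cover all triples meeting both
`{v < n | v < 3k}` and `{v < n | 3k ≤ v}`. -/
lemma exists_cover_crossing_triples {n q : ℕ} (hn5 : 5 ≤ n) (hn : n ≤ 6 * (2 * q + 1)) :
    ∃ K : Finset (Finset ℕ), K.card ≤ 6 * (2 * q + 1) ^ 2 * (q + 1) ∧
      (∀ A ∈ K, A ⊆ Finset.range n ∧ A.card = 5) ∧
      ∀ a < n, ∀ b < n, ∀ c < n,
        decide (3 * (2 * q + 1) ≤ a) = decide (3 * (2 * q + 1) ≤ b) →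
        decide (3 * (2 * q + 1) ≤ c) = !decide (3 * (2 * q + 1) ≤ a) →
        ∃ A ∈ K, a ∈ A ∧ b ∈ A ∧ c ∈ A := by
  set k := 2 * q + 1 with hk
  have hext : ∀ B : Finset ℕ, B.card ≤ 5 →
      ∃ A, B ∩ Finset.range n ⊆ A ∧ A ⊆ Finset.range n ∧ A.card = 5 := fun B hB =>
    Finset.exists_subsuperset_card_eq Finset.inter_subset_right
      ((Finset.card_le_card Finset.inter_subset_left).trans hB) (by simpa using hn5)
  have hcard : ∀ s d x g t, (pairTransversalBlock k s d x g t).card ≤ 5 :=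
    fun _ _ _ _ _ => Finset.card_le_five
  choose F hF₁ hF₂ hF₃ using
    fun p : Bool × ZMod k × ZMod k × Fin 3 × Fin (q + 1) =>
      hext _ (hcard p.1 p.2.1 p.2.2.1 p.2.2.2.1 p.2.2.2.2)
  refine ⟨Finset.univ.image F, Finset.card_image_le.trans ?_, ?_, ?_⟩
  · simp only [Finset.card_univ, Fintype.card_prod, Fintype.card_bool, ZMod.card,
      Fintype.card_fin]
    apply le_of_eq
    ring
  · intro A hA
    obtain ⟨p, -, rfl⟩ := Finset.mem_image.1 hA
    exact ⟨hF₂ p, hF₃ p⟩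
  · intro a ha b hb c hc hab hca
    obtain ⟨g, i, hi⟩ := exists_halfGroupVertex_eq (k := k) (ha.trans_le hn)
    obtain ⟨h, j, hj⟩ := exists_halfGroupVertex_eq (k := k) (hb.trans_le hn)
    obtain ⟨f, y, hy⟩ := exists_halfGroupVertex_eq (k := k) (hc.trans_le hn)
    rw [← hab] at hj
    rw [hca] at hy
    obtain ⟨s, d, x, e, t, ht, h₁, h₂, h₃⟩ :=
      exists_pairTransversalBlock (decide (3 * k ≤ a)) g h f i j y
    rw [hi] at h₁
    rw [hj] at h₂
    rw [hy] at h₃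
    refine ⟨F (s, d, x, e, ⟨t, ht⟩), Finset.mem_image_of_mem _ (Finset.mem_univ _), ?_, ?_, ?_⟩
    · exact hF₁ _ (Finset.mem_inter.2 ⟨h₁, Finset.mem_range.2 ha⟩)
    · exact hF₁ _ (Finset.mem_inter.2 ⟨h₂, Finset.mem_range.2 hb⟩)
    · exact hF₁ _ (Finset.mem_inter.2 ⟨h₃, Finset.mem_range.2 hc⟩)

lemma gamma_five_three_le {n q : ℕ} (hn5 : 5 ≤ n) (hn : n ≤ 6 * (2 * q + 1)) :
    gamma n 5 3 ≤ 2 * (3 * (2 * q + 1)).choose 3 + 6 * (2 * q + 1) ^ 2 * (q + 1) := by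
  obtain ⟨K, hKcard, hK, hcov⟩ := exists_cover_crossing_triples hn5 hn
  set k := 2 * q + 1 with hk
  let S : Bool → Finset ℕ := fun s => (Finset.range n).filter fun v => decide (3 * k ≤ v) = s
  have hS : ∀ s, (S s).card ≤ 3 * k := by
    intro s
    cases s
    · calc (S false).card ≤ (Finset.range (3 * k)).card := Finset.card_le_card (by
            intro v hv
            simp only [S, Finset.mem_filter, Finset.mem_range, decide_eq_false_iff_not] at hv ⊢
            omega)
        _ = 3 * k := Finset.card_range _
    · calc (S true).card ≤ (Finset.Ico (3 * k) (6 * k)).card := Finset.card_le_card (by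
            intro v hv
            simp only [S, Finset.mem_filter, Finset.mem_range, decide_eq_true_eq,
              Finset.mem_Ico] at hv ⊢
            omega)
        _ = 3 * k := by
            rw [Nat.card_Ico]
            omega
  let E := (S true).powersetCard 3 ∪ (S false).powersetCard 3
  have hE : ∀ s (e : Finset ℕ), e ⊆ S s → e.card = 3 → e ∈ E := by
    intro s e hes he
    cases s <;> simp [E, Finset.mem_powersetCard, hes, he]
  have hEcard : E.card ≤ 2 * (3 * k).choose 3 := by
    refine (Finset.card_union_le _ _).trans ?_
    rw [Finset.card_powersetCard, Finset.card_powersetCard, two_mul]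
    exact add_le_add (Nat.choose_le_choose 3 (hS _)) (Nat.choose_le_choose 3 (hS _))
  have hdom : IsDomSet n 5 3 E K := by
    refine ⟨?_, hK, ?_, ?_⟩
    · intro e he
      rcases Finset.mem_union.1 he with he | he <;> rw [Finset.mem_powersetCard] at he <;>
        exact ⟨he.1.trans (Finset.filter_subset _ _), he.2⟩
    · intro A hA hAcard _
      have hsplit := Finset.card_filter_add_card_filter_not (s := A) (fun v => 3 * k ≤ v)
      rcases le_or_gt 3 (A.filter fun v => 3 * k ≤ v).card with h3 | h3
      · obtain ⟨e, he, hecard⟩ := Finset.exists_subset_card_eq h3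
        refine ⟨e, hE true e (fun v hv => ?_) hecard, he.trans (Finset.filter_subset _ _)⟩
        have := Finset.mem_filter.1 (he hv)
        simpa [S, this.2] using hA this.1
      · obtain ⟨e, he, hecard⟩ := Finset.exists_subset_card_eq
          (show 3 ≤ (A.filter fun v => ¬ 3 * k ≤ v).card by omega)
        refine ⟨e, hE false e (fun v hv => ?_) hecard, he.trans (Finset.filter_subset _ _)⟩
        have := Finset.mem_filter.1 (he hv)
        exact Finset.mem_filter.2 ⟨hA this.1, decide_eq_false this.2⟩
    · intro e he hecard heE
      obtain ⟨a, b, c, -, -, -, rfl⟩ := Finset.card_eq_three.1 hecard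
      have ha : a < n := Finset.mem_range.1 (he (by simp))
      have hb : b < n := Finset.mem_range.1 (he (by simp))
      have hc : c < n := Finset.mem_range.1 (he (by simp))
      have hnot : ¬ (decide (3 * k ≤ b) = decide (3 * k ≤ a) ∧
          decide (3 * k ≤ c) = decide (3 * k ≤ a)) := by
        rintro ⟨h₁, h₂⟩
        refine heE (hE (decide (3 * k ≤ a)) _ (fun v hv => Finset.mem_filter.2 ⟨he hv, ?_⟩) hecard)
        simp only [Finset.mem_insert, Finset.mem_singleton] at hv
        rcases hv with rfl | rfl | rfl
        exacts [rfl, h₁, h₂]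
      have hcov' : ∃ A ∈ K, a ∈ A ∧ b ∈ A ∧ c ∈ A := by
        have h₁ := hcov a ha b hb c hc
        have h₂ := hcov a ha c hc b hb
        have h₃ := hcov b hb c hc a ha
        revert hnot h₁ h₂ h₃
        generalize decide (3 * k ≤ a) = u
        generalize decide (3 * k ≤ b) = v
        generalize decide (3 * k ≤ c) = w
        intro hnot h₁ h₂ h₃
        by_cases hab : u = v
        · exact h₁ hab (by cases u <;> cases v <;> cases w <;> simp_all)
        · by_cases hac : u = w
          · obtain ⟨A, hA, h⟩ := h₂ hac (by cases u <;> cases v <;> simp_all)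
            exact ⟨A, hA, h.1, h.2.2, h.2.1⟩
          · obtain ⟨A, hA, h⟩ := h₃ (by cases u <;> cases v <;> cases w <;> simp_all)
              (by cases u <;> cases v <;> simp_all)
            exact ⟨A, hA, h.2.2, h.1, h.2.1⟩
      obtain ⟨A, hA, h₁, h₂, h₃⟩ := hcov'
      refine ⟨A, hA, fun v hv => ?_⟩
      simp only [Finset.mem_insert, Finset.mem_singleton] at hv
      rcases hv with rfl | rfl | rfl <;> assumption
  have hle : gamma n 5 3 ≤ E.card + K.card := Nat.sInf_le ⟨E, K, hdom, rfl⟩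
  exact hle.trans (add_le_add hEcard hKcard)

lemma cube_sub_two_le_six_mul_choose_three {n : ℕ} (hn : 2 ≤ n) :
    ((n : ℝ) - 2) ^ 3 ≤ 6 * (n.choose 3 : ℝ) := by
  obtain ⟨m, rfl⟩ := Nat.exists_eq_add_of_le' hn
  have h6 := Nat.descFactorial_eq_factorial_mul_choose (m + 2) 3
  have hd : (m + 2).descFactorial 3 = m * ((m + 1) * (m + 2)) := by
    simp [Nat.descFactorial]
  rw [hd] at h6
  have h6' : (m : ℝ) * ((m + 1) * (m + 2)) = 6 * ((m + 2).choose 3 : ℝ) := by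
    have : ((3 : ℕ).factorial : ℝ) = 6 := by norm_num [Nat.factorial]
    rw [← this]
    exact_mod_cast h6
  rw [← h6']
  have hm : (0 : ℝ) ≤ m := Nat.cast_nonneg m
  push_cast
  nlinarith [mul_nonneg hm hm]

/-- `γ(G_{5,3}) ≤ (1/3)·C(n,3) + o(n³)`. -/
theorem domination_number_G53_upper (ε : ℝ) (hε : 0 < ε) :
    ∃ N : ℕ, ∀ n : ℕ, N ≤ n →
      (gamma n 5 3 : ℝ) ≤ (1 / 3 + ε) * (n.choose 3 : ℝ) := by
  refine ⟨⌈54 / ε⌉₊ + 22, fun n hn => ?_⟩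
  set k := 2 * (n / 12 + 1) + 1 with hk
  have hγ : (gamma n 5 3 : ℝ) ≤
      2 * ((3 * k).choose 3 : ℝ) + 6 * (k : ℝ) ^ 2 * ((n / 12 + 1 : ℕ) + 1) := by
    exact_mod_cast gamma_five_three_le (n := n) (q := n / 12 + 1) (by omega) (by omega)
  have hq : (k : ℝ) = 2 * ((n / 12 + 1 : ℕ) : ℝ) + 1 := by exact_mod_cast hk
  have hchoose : ((3 * k).choose 3 : ℝ) ≤ (3 * (k : ℝ)) ^ 3 / 6 := by
    have := Nat.choose_le_pow_div (α := ℝ) 3 (3 * k)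
    norm_num [Nat.factorial] at this ⊢
    exact this
  have hkn : 6 * (k : ℝ) ≤ n + 18 := by
    have : 6 * k ≤ n + 18 := by omega
    exact_mod_cast this
  have hlower := cube_sub_two_le_six_mul_choose_three (n := n) (by omega)
  have hm : 54 / ε + 20 ≤ (n : ℝ) - 2 := by
    have h₁ : ((⌈54 / ε⌉₊ + 22 : ℕ) : ℝ) ≤ n := by exact_mod_cast hn
    push_cast at h₁
    linarith [Nat.le_ceil (54 / ε)]
  set m : ℝ := (n : ℝ) - 2 with hmdef
  have hεpos : 0 < 54 / ε := by positivity
  have hm20 : 20 ≤ m := by linarith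
  have hεm : 54 ≤ ε * m := by
    have : 54 / ε ≤ m := by linarith
    rwa [div_le_iff₀ hε, mul_comm] at this
  have hk0 : (0 : ℝ) ≤ k := Nat.cast_nonneg k
  have hkm : (k : ℝ) ≤ (m + 20) / 6 := by linarith
  have hk3 : (k : ℝ) ^ 3 ≤ ((m + 20) / 6) ^ 3 := by gcongr
  have hk2 : (k : ℝ) ^ 2 ≤ ((m + 20) / 6) ^ 2 := by gcongr
  have hupper : (gamma n 5 3 : ℝ) ≤ 12 * (k : ℝ) ^ 3 + 3 * (k : ℝ) ^ 2 := by
    have : 6 * (k : ℝ) ^ 2 * (((n / 12 + 1 : ℕ) : ℝ) + 1) = 3 * (k : ℝ) ^ 3 + 3 * (k : ℝ) ^ 2 := by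
      have : ((n / 12 + 1 : ℕ) : ℝ) = ((k : ℝ) - 1) / 2 := by linarith
      rw [this]
      ring
    linarith
  calc (gamma n 5 3 : ℝ)
      ≤ 12 * ((m + 20) / 6) ^ 3 + 3 * ((m + 20) / 6) ^ 2 := by linarith
    _ ≤ m ^ 3 / 18 + 9 * m ^ 2 := by nlinarith
    _ ≤ (1 / 3 + ε) * (m ^ 3 / 6) := by nlinarith [mul_le_mul_of_nonneg_right hεm (sq_nonneg m)]
    _ ≤ (1 / 3 + ε) * (n.choose 3 : ℝ) := by
        gcongr
        linarith
end

section
/- For every ε > 0 there exists N such that for all n ≥ N, the domination number satisfies γ(G_{4,3}) ≤ (17/27 + ε) · C(n,3). -/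
section

open Finset

theorem IsDomSet.gamma_le {n k l : ℕ} {E K : Finset (Finset ℕ)} (h : IsDomSet n k l E K) :
    gamma n k l ≤ E.card + K.card :=
  Nat.sInf_le ⟨E, K, h, rfl⟩

/-- The domination number may be computed on any vertex set of size `n`. -/
theorem gamma_le_of_card_eq {V : Type*} [Fintype V] [DecidableEq V] {n k l : ℕ}
    (hV : Fintype.card V = n) (E K : Finset (Finset V))
    (hE : ∀ e ∈ E, e.card = l) (hK : ∀ A ∈ K, A.card = k)
    (hdomK : ∀ A : Finset V, A.card = k → A ∉ K → ∃ e ∈ E, e ⊆ A)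
    (hdomE : ∀ e : Finset V, e.card = l → e ∉ E → ∃ A ∈ K, e ⊆ A) :
    gamma n k l ≤ E.card + K.card := by
  let f : V ↪ ℕ := (Fintype.equivFinOfCardEq hV).toEmbedding.trans Fin.valEmbedding
  have hf : ∀ s : Finset V, s.map f ⊆ range n := by
    intro s x hx
    obtain ⟨y, -, rfl⟩ := mem_map.1 hx
    exact mem_range.2 (Fintype.equivFinOfCardEq hV y).2
  have hsurj : ∀ t : Finset ℕ, t ⊆ range n → ∃ s : Finset V, s.map f = t := by
    intro t ht
    have : t ⊆ (univ : Finset V).map f := by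
      intro x hx
      refine mem_map.2 ⟨(Fintype.equivFinOfCardEq hV).symm ⟨x, mem_range.1 (ht hx)⟩,
        mem_univ _, ?_⟩
      simp [f]
    obtain ⟨s, -, rfl⟩ := subset_map_iff.1 this
    exact ⟨s, rfl⟩
  let F : Finset V ↪ Finset ℕ := mapEmbedding f |>.toEmbedding
  have hF : ∀ s, F s = s.map f := fun _ => rfl
  have h : IsDomSet n k l (E.map F) (K.map F) := by
    refine ⟨?_, ?_, ?_, ?_⟩
    · intro e he
      obtain ⟨s, hs, rfl⟩ := mem_map.1 he
      exact ⟨hf s, by rw [hF, card_map, hE s hs]⟩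
    · intro e he
      obtain ⟨s, hs, rfl⟩ := mem_map.1 he
      exact ⟨hf s, by rw [hF, card_map, hK s hs]⟩
    · intro A hA hc hAK
      obtain ⟨s, rfl⟩ := hsurj A hA
      obtain ⟨e, he, hes⟩ := hdomK s (by simpa using hc)
        (fun h => hAK (mem_map.2 ⟨s, h, rfl⟩))
      exact ⟨F e, mem_map_of_mem F he, map_subset_map.2 hes⟩
    · intro A hA hc hAK
      obtain ⟨s, rfl⟩ := hsurj A hA
      obtain ⟨e, he, hes⟩ := hdomE s (by simpa using hc)
        (fun h => hAK (mem_map.2 ⟨s, h, rfl⟩))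
      exact ⟨F e, mem_map_of_mem F he, map_subset_map.2 hes⟩
  simpa using h.gamma_le

theorem exists_isDomSet_gamma_eq (n k l : ℕ) (hlk : l ≤ k) :
    ∃ E K : Finset (Finset ℕ), IsDomSet n k l E K ∧ gamma n k l = E.card + K.card := by
  have hne : {m | ∃ E K : Finset (Finset ℕ), IsDomSet n k l E K ∧
      m = E.card + K.card}.Nonempty := by
    refine ⟨_, powersetCard l (range n), ∅, ⟨?_, ?_, ?_, ?_⟩, rfl⟩
    · exact fun e he => mem_powersetCard.1 he
    · simp
    · intro A hA hc _
      obtain ⟨e, he, hel⟩ := exists_subset_card_eq (hlk.trans hc.ge)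
      exact ⟨e, mem_powersetCard.2 ⟨he.trans hA, hel⟩, he⟩
    · exact fun e he hc hn => absurd (mem_powersetCard.2 ⟨he, hc⟩) hn
  exact Nat.sInf_mem hne

/-- A new vertex can be handled by adding every triple through it. -/
theorem gamma_succ_le (n : ℕ) : gamma (n + 1) 4 3 ≤ gamma n 4 3 + n ^ 2 := by
  obtain ⟨E, K, ⟨hE, hK, hdomK, hdomE⟩, hγ⟩ := exists_isDomSet_gamma_eq n 4 3 (by norm_num)
  let S := (powersetCard 2 (range n)).image (insert n)
  have hS : ∀ e ⊆ range (n + 1), e.card = 3 → n ∈ e → e ∈ S := by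
    intro e he hc hn
    refine mem_image.2 ⟨e.erase n, mem_powersetCard.2 ⟨?_, ?_⟩, insert_erase hn⟩
    · intro x hx
      have := mem_range.1 (he (mem_of_mem_erase hx))
      have := ne_of_mem_erase hx
      exact mem_range.2 (by omega)
    · rw [card_erase_of_mem hn, hc]
  have hlow : ∀ e ⊆ range (n + 1), n ∉ e → e ⊆ range n := by
    intro e he hn x hx
    have h1 := mem_range.1 (he hx)
    have h2 : x ≠ n := fun h => hn (h ▸ hx)
    exact mem_range.2 (by omega)
  have hsub : range n ⊆ range (n + 1) := range_mono n.le_succ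
  have h : IsDomSet (n + 1) 4 3 (E ∪ S) K := by
    refine ⟨?_, fun A hA => ⟨(hK A hA).1.trans hsub, (hK A hA).2⟩, ?_, ?_⟩
    · intro e he
      rcases mem_union.1 he with he | he
      · exact ⟨(hE e he).1.trans hsub, (hE e he).2⟩
      · obtain ⟨s, hs, rfl⟩ := mem_image.1 he
        obtain ⟨hs, hc⟩ := mem_powersetCard.1 hs
        refine ⟨insert_subset (by simp) (hs.trans hsub), ?_⟩
        rw [card_insert_of_notMem (fun h => by simpa using hs h), hc]
    · intro A hA hc hAK
      by_cases hn : n ∈ A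
      · obtain ⟨e, hne, heA, hce⟩ := exists_subsuperset_card_eq (n := 3)
          (singleton_subset_iff.2 hn) (by simp) (by omega)
        exact ⟨e, mem_union_right _ (hS e (heA.trans hA) hce (singleton_subset_iff.1 hne)), heA⟩
      · obtain ⟨e, he, heA⟩ := hdomK A (hlow A hA hn) hc hAK
        exact ⟨e, mem_union_left _ he, heA⟩
    · intro e he hc hne
      have hn : n ∉ e := fun hn => hne (mem_union_right _ (hS e he hc hn))
      exact hdomE e (hlow e he hn) hc fun h => hne (mem_union_left _ h)
  have hSc : S.card ≤ n ^ 2 := by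
    refine card_image_le.trans ?_
    rw [card_powersetCard, card_range]
    exact Nat.choose_le_pow n 2
  have := h.gamma_le
  have := card_union_le E S
  omega

section Construction

variable (m : ℕ) [NeZero m]

/-- The three vertex classes, each a copy of `ZMod m`. -/
def part (i : Fin 3) : Finset (Fin 3 × ZMod m) := univ.filter fun x => x.1 = i

/-- Triples inside one class. -/
def innerTriples : Finset (Finset (Fin 3 × ZMod m)) :=
  univ.biUnion fun i => powersetCard 3 (part m i)

/-- Triples with two vertices in one class and one in the next class. -/
def forwardTriples : Finset (Finset (Fin 3 × ZMod m)) :=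
  univ.biUnion fun i =>
    (powersetCard 2 (part m i) ×ˢ part m (i + 1)).image fun p => insert p.2 p.1

/-- Three-element subsets of a class with sum zero. -/
def zeroSumBlocks (i : Fin 3) : Finset (Finset (Fin 3 × ZMod m)) :=
  (powersetCard 3 (part m i)).filter fun s => ∑ x ∈ s, x.2 = 0

/-- Zero-sum blocks in class `i` together with a vertex of the preceding class. -/
def blockQuads (i : Fin 3) : Finset (Finset (Fin 3 × ZMod m)) :=
  (zeroSumBlocks m i ×ˢ part m (i + 2)).image fun p => insert p.2 p.1

/-- Pairs in class `0`, their sum in class `1`, and a vertex of class `2`. -/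
def sumQuads : Finset (Finset (Fin 3 × ZMod m)) :=
  (powersetCard 2 (part m 0) ×ˢ part m 2).image fun p =>
    insert p.2 (insert (1, ∑ x ∈ p.1, x.2) p.1)

/-- The triples missed by the Turán triples and the quadruples. -/
def exceptionalTriples : Finset (Finset (Fin 3 × ZMod m)) :=
  ((univ : Finset (ZMod m × ZMod m)).image (fun p => {(0, p.1), (1, p.1 + p.1), (2, p.2)}) ∪
    (univ : Finset (Fin 3 × ZMod m × ZMod m)).image
      (fun p => {(p.1, p.2.1), (p.1, -(p.2.1 + p.2.1)), (p.1 + 2, p.2.2)})).filter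
    fun e => e.card = 3

variable {m}

@[simp] theorem mem_part {i : Fin 3} {x : Fin 3 × ZMod m} : x ∈ part m i ↔ x.1 = i := by
  simp [part]

@[simp] theorem card_part (i : Fin 3) : (part m i).card = m := by
  have : part m i = {i} ×ˢ (univ : Finset (ZMod m)) := by
    ext ⟨a, b⟩; simp [eq_comm]
  rw [this, card_product]
  simp [ZMod.card]

theorem factorial_mul_choose_le_pow (a k : ℕ) : k.factorial * a.choose k ≤ a ^ k := by
  rw [← Nat.descFactorial_eq_factorial_mul_choose]
  exact Nat.descFactorial_le_pow a k

theorem card_of_mem_innerTriples {e : Finset (Fin 3 × ZMod m)} (he : e ∈ innerTriples m) :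
    e.card = 3 := by
  obtain ⟨i, -, he⟩ := mem_biUnion.1 he
  exact (mem_powersetCard.1 he).2

theorem card_insert_of_subset_part {i j : Fin 3} (hij : j ≠ i) {s : Finset (Fin 3 × ZMod m)}
    (hs : s ⊆ part m i) {v : Fin 3 × ZMod m} (hv : v.1 = j) :
    (insert v s).card = s.card + 1 :=
  card_insert_of_notMem fun h => hij (hv.symm.trans (mem_part.1 (hs h)))

theorem mem_forwardTriples {i : Fin 3} {s : Finset (Fin 3 × ZMod m)} (hs : s ⊆ part m i)
    (hc : s.card = 2) {v : Fin 3 × ZMod m} (hv : v.1 = i + 1) :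
    insert v s ∈ forwardTriples m :=
  mem_biUnion.2 ⟨i, mem_univ i, mem_image.2
    ⟨(s, v), mem_product.2 ⟨mem_powersetCard.2 ⟨hs, hc⟩, mem_part.2 hv⟩, rfl⟩⟩

theorem card_of_mem_forwardTriples {e : Finset (Fin 3 × ZMod m)}
    (he : e ∈ forwardTriples m) : e.card = 3 := by
  obtain ⟨i, -, he⟩ := mem_biUnion.1 he
  obtain ⟨⟨s, v⟩, hp, rfl⟩ := mem_image.1 he
  obtain ⟨hs, hv⟩ := mem_product.1 hp
  obtain ⟨hs, hc⟩ := mem_powersetCard.1 hs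
  rw [card_insert_of_subset_part (by fin_cases i <;> decide) hs (mem_part.1 hv), hc]

theorem card_of_mem_blockQuads {i : Fin 3} {A : Finset (Fin 3 × ZMod m)}
    (hA : A ∈ blockQuads m i) : A.card = 4 := by
  obtain ⟨⟨s, v⟩, hp, rfl⟩ := mem_image.1 hA
  obtain ⟨hs, hv⟩ := mem_product.1 hp
  obtain ⟨hs, hc⟩ := mem_powersetCard.1 (mem_filter.1 hs).1
  rw [card_insert_of_subset_part (by fin_cases i <;> decide) hs (mem_part.1 hv), hc]

theorem card_of_mem_sumQuads {A : Finset (Fin 3 × ZMod m)} (hA : A ∈ sumQuads m) :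
    A.card = 4 := by
  obtain ⟨⟨s, v⟩, hp, rfl⟩ := mem_image.1 hA
  obtain ⟨hs, hv⟩ := mem_product.1 hp
  obtain ⟨hs, hc⟩ := mem_powersetCard.1 hs
  have hv := mem_part.1 hv
  dsimp only at hs hc hv ⊢
  rw [card_insert_of_notMem, card_insert_of_subset_part (j := 1) (by decide) hs rfl, hc]
  intro h
  rcases mem_insert.1 h with h | h
  · simp [h] at hv
  · exact absurd (hv.symm.trans (mem_part.1 (hs h))) (by decide)

/-- The Turán property: four vertices always contain an inner or a forward triple. -/
theorem exists_triple_subset {A : Finset (Fin 3 × ZMod m)} (hA : A.card = 4) :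
    ∃ e ∈ innerTriples m ∪ forwardTriples m, e ⊆ A := by
  by_contra! h
  have h3 : ∀ i, (A.filter fun x => x.1 = i).card ≤ 2 := by
    intro i
    by_contra! hi
    obtain ⟨e, he, hc⟩ := exists_subset_card_eq hi
    refine h e (mem_union_left _ (mem_biUnion.2 ⟨i, mem_univ i, mem_powersetCard.2
      ⟨fun x hx => ?_, hc⟩⟩)) (he.trans (filter_subset _ _))
    exact mem_part.2 (mem_filter.1 (he hx)).2
  have h2 : ∀ i, (A.filter fun x => x.1 = i).card ≤ 1 ∨
      (A.filter fun x => x.1 = i + 1).card = 0 := by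
    intro i
    by_contra! hi
    obtain ⟨s, hs, hc⟩ := exists_subset_card_eq hi.1
    obtain ⟨v, hv⟩ := card_ne_zero.1 hi.2
    obtain ⟨hvA, hv⟩ := mem_filter.1 hv
    exact h _ (mem_union_right _ (mem_forwardTriples
      (fun x hx => mem_part.2 (mem_filter.1 (hs hx)).2) hc hv))
      (insert_subset hvA (hs.trans (filter_subset _ _)))
  have hsum := card_eq_sum_card_fiberwise (s := A) (t := univ) (f := Prod.fst)
    (fun _ _ => mem_univ _)
  rw [Fin.sum_univ_three, hA] at hsum
  have h30 := h3 0
  have h31 := h3 1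
  have h32 := h3 2
  have h20 := h2 0
  have h21 := h2 1
  have h22 := h2 2
  rw [show (0 : Fin 3) + 1 = 1 from rfl] at h20
  rw [show (1 : Fin 3) + 1 = 2 from rfl] at h21
  rw [show (2 : Fin 3) + 1 = 0 from rfl] at h22
  omega

/-- The three shapes of a triple of vertices. -/
theorem triple_shapes {P : Finset (Fin 3 × ZMod m) → Prop}
    (h3 : ∀ i, ∀ s ⊆ part m i, s.card = 3 → P s)
    (h2 : ∀ i j a b c, i ≠ j → a ≠ b → P {(i, a), (i, b), (j, c)})
    (h1 : ∀ a b c, P {(0, a), (1, b), (2, c)})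
    (e : Finset (Fin 3 × ZMod m)) (he : e.card = 3) : P e := by
  obtain ⟨⟨i, a⟩, ⟨j, b⟩, ⟨k, c⟩, hab, hac, hbc, rfl⟩ := card_eq_three.1 he
  by_cases hij : i = j
  · subst hij
    by_cases hik : i = k
    · subst hik
      exact h3 i _ (by intro x hx; simp at hx; aesop) he
    · exact h2 i k a b c hik (by rintro rfl; exact hab rfl)
  by_cases hik : i = k
  · subst hik
    rw [pair_comm (j, b)]
    exact h2 i j a c b hij (by rintro rfl; exact hac rfl)
  by_cases hjk : j = k
  · subst hjk
    rw [insert_comm, pair_comm (i, a)]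
    exact h2 j i b c a (Ne.symm hij) (by rintro rfl; exact hbc rfl)
  have perm : ∃ a' b' c' : ZMod m, ({(i, a), (j, b), (k, c)} : Finset (Fin 3 × ZMod m)) =
      {(0, a'), (1, b'), (2, c')} := by
    fin_cases i <;> fin_cases j <;> fin_cases k <;> simp at hij hik hjk
    · exact ⟨a, b, c, rfl⟩
    · exact ⟨a, c, b, by ext x; simp; tauto⟩
    · exact ⟨b, a, c, by ext x; simp; tauto⟩
    · exact ⟨c, a, b, by ext x; simp; tauto⟩
    · exact ⟨b, c, a, by ext x; simp; tauto⟩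
    · exact ⟨c, b, a, by ext x; simp; tauto⟩
  obtain ⟨a', b', c', h⟩ := perm
  rw [h]
  exact h1 a' b' c'

theorem mem_sumQuads {a b c : ZMod m} (hab : a ≠ b) :
    {(0, a), (0, b), (1, a + b), (2, c)} ∈ sumQuads m := by
  refine mem_image.2 ⟨({(0, a), (0, b)}, (2, c)), mem_product.2
    ⟨mem_powersetCard.2 ⟨by simp [insert_subset_iff], card_pair (by simpa using hab)⟩,
      by simp⟩, ?_⟩
  simp only
  rw [sum_pair (by simpa using hab)]
  ext x; simp; tauto

theorem mem_blockQuads {i : Fin 3} {a b c : ZMod m} (hab : a ≠ b)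
    (ha : b ≠ -(a + a)) (hb : a ≠ -(b + b)) :
    {(i, a), (i, b), (i, -(a + b)), (i + 2, c)} ∈ blockQuads m i := by
  have hac : a ≠ -(a + b) := fun h => ha (by linear_combination h)
  have hbc : b ≠ -(a + b) := fun h => hb (by linear_combination h)
  have h3 : ({(i, a), (i, b), (i, -(a + b))} : Finset (Fin 3 × ZMod m)).card = 3 :=
    card_eq_three.2 ⟨_, _, _, by simpa using hab, by simpa using hac, by simpa using hbc, rfl⟩
  refine mem_image.2 ⟨({(i, a), (i, b), (i, -(a + b))}, (i + 2, c)), mem_product.2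
    ⟨mem_filter.2 ⟨mem_powersetCard.2 ⟨by simp [insert_subset_iff], h3⟩, ?_⟩, by simp⟩, ?_⟩
  · dsimp only
    rw [sum_insert (by simpa [-neg_add_rev] using ⟨hab, hac⟩), sum_pair (by simpa using hbc)]
    ring
  · ext x; simp; tauto

theorem mem_exceptionalTriples_transversal (a c : ZMod m) :
    {(0, a), (1, a + a), (2, c)} ∈ exceptionalTriples m :=
  mem_filter.2 ⟨mem_union_left _ (mem_image.2 ⟨(a, c), mem_univ _, rfl⟩),
    card_eq_three.2 ⟨_, _, _, by simp, by simp, by simp, rfl⟩⟩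

theorem mem_exceptionalTriples_block (i : Fin 3) {a c : ZMod m} (ha : a ≠ -(a + a)) :
    {(i, a), (i, -(a + a)), (i + 2, c)} ∈ exceptionalTriples m := by
  have hi : i ≠ i + 2 := by fin_cases i <;> decide
  exact mem_filter.2 ⟨mem_union_right _ (mem_image.2 ⟨(i, a, c), mem_univ _, rfl⟩),
    card_eq_three.2 ⟨_, _, _, by simpa using ha,
      fun h => hi (congrArg Prod.fst h), fun h => hi (congrArg Prod.fst h), rfl⟩⟩

variable (m) in
/-- The triples of the dominating set. -/
def domTriples : Finset (Finset (Fin 3 × ZMod m)) :=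
  innerTriples m ∪ forwardTriples m ∪ exceptionalTriples m

variable (m) in
/-- The quadruples of the dominating set. -/
def domQuads : Finset (Finset (Fin 3 × ZMod m)) :=
  sumQuads m ∪ (blockQuads m 1 ∪ blockQuads m 2)

theorem covered_of_transversal (a b c : ZMod m) :
    {(0, a), (1, b), (2, c)} ∈ domTriples m ∨
      ∃ A ∈ domQuads m, {(0, a), (1, b), (2, c)} ⊆ A := by
  by_cases hb : b = a + a
  · subst hb
    exact .inl (mem_union_right _ (mem_exceptionalTriples_transversal a c))
  · have hab : a ≠ b - a := fun h => hb (by linear_combination -h)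
    refine .inr ⟨_, mem_union_left _ (mem_sumQuads (c := c) hab), ?_⟩
    simp [insert_subset_iff]

theorem covered_of_two_one (i j : Fin 3) (a b c : ZMod m) (hij : i ≠ j) (hab : a ≠ b) :
    {(i, a), (i, b), (j, c)} ∈ domTriples m ∨
      ∃ A ∈ domQuads m, {(i, a), (i, b), (j, c)} ⊆ A := by
  have hj : j = i + 1 ∨ j = i + 2 := by
    revert i j; decide
  rcases hj with rfl | rfl
  · refine .inl (mem_union_left _ (mem_union_right _ ?_))
    have := mem_forwardTriples (m := m) (i := i) (s := {(i, a), (i, b)})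
      (by simp [insert_subset_iff]) (card_pair (by simpa using hab)) (v := (i + 1, c)) rfl
    convert this using 1
    ext x; simp; tauto
  · by_cases hi : i = 0
    · subst hi
      refine .inr ⟨_, mem_union_left _ (mem_sumQuads (c := c) hab), ?_⟩
      simp [insert_subset_iff]
    by_cases ha : b = -(a + a)
    · subst ha
      exact .inl (mem_union_right _ (mem_exceptionalTriples_block i hab))
    by_cases hb : a = -(b + b)
    · subst hb
      rw [insert_comm]
      exact .inl (mem_union_right _ (mem_exceptionalTriples_block i hab.symm))
    refine .inr ⟨{(i, a), (i, b), (i, -(a + b)), (i + 2, c)}, mem_union_right _ ?_, ?_⟩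
    · have hi' : i = 1 ∨ i = 2 := by revert i; decide
      have := mem_blockQuads (i := i) (c := c) hab ha hb
      rcases hi' with rfl | rfl
      · exact mem_union_left _ this
      · exact mem_union_right _ this
    · simp [insert_subset_iff]

theorem gamma_three_mul_le_card :
    gamma (3 * m) 4 3 ≤ (domTriples m).card + (domQuads m).card := by
  refine gamma_le_of_card_eq (V := Fin 3 × ZMod m) (by simp [ZMod.card]) _ _ ?_ ?_ ?_ ?_
  · intro e he
    rcases mem_union.1 he with he | he
    · rcases mem_union.1 he with he | he
      · exact card_of_mem_innerTriples he
      · exact card_of_mem_forwardTriples he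
    · exact (mem_filter.1 he).2
  · intro A hA
    rcases mem_union.1 hA with hA | hA
    · exact card_of_mem_sumQuads hA
    · rcases mem_union.1 hA with hA | hA <;> exact card_of_mem_blockQuads hA
  · intro A hA _
    obtain ⟨e, he, heA⟩ := exists_triple_subset hA
    exact ⟨e, mem_union_left _ he, heA⟩
  · intro e he
    rw [← or_iff_not_imp_left]
    refine triple_shapes (P := fun e => e ∈ domTriples m ∨ ∃ A ∈ domQuads m, e ⊆ A)
      ?_ covered_of_two_one covered_of_transversal e he
    exact fun i s hs hc => .inl (mem_union_left _ (mem_union_left _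
      (mem_biUnion.2 ⟨i, mem_univ i, mem_powersetCard.2 ⟨hs, hc⟩⟩)))

theorem card_innerTriples_le : (innerTriples m).card ≤ 3 * m.choose 3 := by
  refine card_biUnion_le.trans ?_
  simp

theorem card_forwardTriples_le : (forwardTriples m).card ≤ 3 * (m.choose 2 * m) := by
  refine card_biUnion_le.trans ((sum_le_sum fun i _ => card_image_le).trans ?_)
  simp

theorem card_sumQuads_le : (sumQuads m).card ≤ m.choose 2 * m := by
  refine card_image_le.trans ?_
  simp

theorem card_exceptionalTriples_le : (exceptionalTriples m).card ≤ 4 * m ^ 2 := by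
  refine (card_filter_le _ _).trans ((card_union_le _ _).trans
    ((add_le_add card_image_le card_image_le).trans ?_))
  simp only [card_univ, Fintype.card_prod, ZMod.card, Fintype.card_fin]
  exact le_of_eq (by ring)

/-- Two zero-sum blocks in one class share at most one vertex. -/
theorem three_mul_card_zeroSumBlocks_le (i : Fin 3) :
    3 * (zeroSumBlocks m i).card ≤ m.choose 2 := by
  have hdisj : ∀ s ∈ zeroSumBlocks m i, ∀ t ∈ zeroSumBlocks m i, s ≠ t →
      Disjoint (powersetCard 2 s) (powersetCard 2 t) := by
    intro s hs t ht hst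
    rw [Finset.disjoint_left]
    intro p hps hpt
    obtain ⟨hps, hp⟩ := mem_powersetCard.1 hps
    obtain ⟨hpt, -⟩ := mem_powersetCard.1 hpt
    obtain ⟨hs, hs0⟩ := mem_filter.1 hs
    obtain ⟨ht, ht0⟩ := mem_filter.1 ht
    obtain ⟨hs, hsc⟩ := mem_powersetCard.1 hs
    obtain ⟨ht, htc⟩ := mem_powersetCard.1 ht
    obtain ⟨x, hx, rfl⟩ := (covBy_iff_exists_insert.1
      (covBy_iff_card_sdiff_eq_one.2 ⟨hps, by rw [card_sdiff_of_subset hps]; omega⟩))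
    obtain ⟨y, hy, rfl⟩ := (covBy_iff_exists_insert.1
      (covBy_iff_card_sdiff_eq_one.2 ⟨hpt, by rw [card_sdiff_of_subset hpt]; omega⟩))
    rw [sum_insert hx] at hs0
    rw [sum_insert hy] at ht0
    have h1 : x.1 = y.1 := (mem_part.1 (hs (mem_insert_self x p))).trans
      (mem_part.1 (ht (mem_insert_self y p))).symm
    have h2 : x.2 = y.2 := by linear_combination hs0 - ht0
    exact hst (by rw [Prod.ext h1 h2])
  have hcard := card_biUnion hdisj
  have hthree : ∀ s ∈ zeroSumBlocks m i, (powersetCard 2 s).card = 3 := by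
    intro s hs
    rw [card_powersetCard, (mem_powersetCard.1 (mem_filter.1 hs).1).2]
    rfl
  rw [sum_congr rfl hthree, sum_const, smul_eq_mul, mul_comm] at hcard
  calc 3 * (zeroSumBlocks m i).card = _ := hcard.symm
    _ ≤ (powersetCard 2 (part m i)).card := card_le_card (biUnion_subset.2 fun s hs =>
        powersetCard_mono (mem_powersetCard.1 (mem_filter.1 hs).1).1)
    _ = m.choose 2 := by simp

theorem three_mul_card_blockQuads_le (i : Fin 3) :
    3 * (blockQuads m i).card ≤ m.choose 2 * m := by
  have h : (blockQuads m i).card ≤ (zeroSumBlocks m i).card * m :=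
    card_image_le.trans (by simp)
  have := Nat.mul_le_mul_right m (three_mul_card_zeroSumBlocks_le (m := m) i)
  linarith

theorem six_mul_gamma_three_mul_le :
    6 * gamma (3 * m) 4 3 ≤ 17 * m ^ 3 + 24 * m ^ 2 := by
  have h := gamma_three_mul_le_card (m := m)
  have hT : (domTriples m).card ≤ _ := (card_union_le _ _).trans
    (add_le_add_left (card_union_le (innerTriples m) (forwardTriples m)) _)
  have hQ : (domQuads m).card ≤ _ := (card_union_le _ _).trans
    (add_le_add_right (card_union_le (blockQuads m 1) (blockQuads m 2)) _)
  have h2 := Nat.mul_le_mul_right m (factorial_mul_choose_le_pow m 2)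
  have h3 := factorial_mul_choose_le_pow m 3
  have hi := card_innerTriples_le (m := m)
  have hf := card_forwardTriples_le (m := m)
  have hs := card_sumQuads_le (m := m)
  have he := card_exceptionalTriples_le (m := m)
  have hb1 := three_mul_card_blockQuads_le (m := m) 1
  have hb2 := three_mul_card_blockQuads_le (m := m) 2
  simp only [Nat.factorial] at h2 h3
  linarith [pow_succ m 2]

end Construction

theorem six_mul_gamma_le (n : ℕ) (hn : 3 ≤ n) :
    (6 * gamma n 4 3 : ℝ) ≤ 17 / 27 * n ^ 3 + 15 * n ^ 2 := by
  obtain ⟨m, r, hr, rfl⟩ : ∃ m r, r < 3 ∧ n = 3 * m + r :=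
    ⟨n / 3, n % 3, Nat.mod_lt _ (by norm_num), by omega⟩
  have : NeZero m := ⟨by omega⟩
  have h := six_mul_gamma_three_mul_le (m := m)
  have hstep : gamma (3 * m + r) 4 3 ≤ gamma (3 * m) 4 3 + r * (3 * m + r) ^ 2 := by
    clear hn h
    induction r with
    | zero => simp
    | succ r ih =>
      have h1 := ih (by omega)
      have h2 := gamma_succ_le (3 * m + r)
      rw [← add_assoc]
      nlinarith [Nat.zero_le (r * (2 * (3 * m + r) + 1)), Nat.zero_le (3 * m + r)]
  have hr2 : r * (3 * m + r) ^ 2 ≤ 2 * (3 * m + r) ^ 2 :=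
    Nat.mul_le_mul_right _ (by omega)
  have hnat : 6 * gamma (3 * m + r) 4 3 ≤ 17 * m ^ 3 + 24 * m ^ 2 + 12 * (3 * m + r) ^ 2 := by
    linarith
  have hreal : (6 * gamma (3 * m + r) 4 3 : ℝ) ≤
      17 * m ^ 3 + 24 * m ^ 2 + 12 * ((3 * m + r : ℕ) : ℝ) ^ 2 := by
    exact_mod_cast hnat
  have hle : 3 * (m : ℝ) ≤ ((3 * m + r : ℕ) : ℝ) := by
    push_cast
    linarith [(Nat.cast_nonneg r : (0 : ℝ) ≤ r)]
  have hp3 := pow_le_pow_left₀ (by positivity) hle 3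
  have hp2 := pow_le_pow_left₀ (by positivity) hle 2
  rw [mul_pow] at hp3 hp2
  linarith [sq_nonneg ((3 * m + r : ℕ) : ℝ)]

theorem cube_sub_le_six_mul_choose_three (n : ℕ) :
    (n : ℝ) ^ 3 - 3 * n ^ 2 ≤ 6 * (n.choose 3 : ℝ) := by
  have h : (n : ℤ) ^ 3 - 3 * n ^ 2 ≤ 6 * (n.choose 3 : ℤ) := by
    have hd := Nat.descFactorial_eq_factorial_mul_choose n 3
    rcases Nat.lt_or_ge n 3 with h | h
    · interval_cases n <;> simp [Nat.choose]
    · obtain ⟨k, rfl⟩ := Nat.exists_eq_add_of_le' h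
      simp only [Nat.descFactorial, Nat.factorial] at hd
      have hd : (k + 1) * ((k + 2) * (k + 3)) = 6 * (k + 3).choose 3 := by
        simpa using hd
      have hd : ((k : ℤ) + 1) * ((k + 2) * (k + 3)) = 6 * ((k + 3).choose 3 : ℤ) := by
        exact_mod_cast hd
      rw [← hd]
      push_cast
      nlinarith
  exact_mod_cast h

end

/-- `γ(G_{4,3}) ≤ (17/27)·C(n,3) + o(n³)`. -/
theorem domination_number_G43_upper (ε : ℝ) (hε : 0 < ε) :
    ∃ N : ℕ, ∀ n : ℕ, N ≤ n →
      (gamma n 4 3 : ℝ) ≤ (17 / 27 + ε) * (n.choose 3 : ℝ) := by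
  obtain ⟨N, hN⟩ := exists_nat_ge (17 / ε + 3)
  refine ⟨max N 3, fun n hn => ?_⟩
  have hγ := six_mul_gamma_le n ((le_max_right _ _).trans hn)
  have hc := cube_sub_le_six_mul_choose_three n
  have hnN : 17 / ε + 3 ≤ (n : ℝ) :=
    hN.trans (by exact_mod_cast (le_max_left _ _).trans hn)
  have hεn : 17 + 3 * ε ≤ ε * n := by
    calc 17 + 3 * ε = ε * (17 / ε + 3) := by field_simp
      _ ≤ ε * n := mul_le_mul_of_nonneg_left hnN hε.le
  have h1 := mul_le_mul_of_nonneg_right hεn (sq_nonneg (n : ℝ))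
  have h2 := mul_le_mul_of_nonneg_left hc (show (0 : ℝ) ≤ 17 / 27 + ε by positivity)
  nlinarith [sq_nonneg (n : ℝ)]
end
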